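/- arXiv:1707.01604 — 3 statements merged into one kernel-verified Lean document; each statement's English description precedes it below -/
import Mathlib

section
/- Fix a real number c > 0 and an integer j ≥ 0, and for each n set t_n = ⌊cn⌋. Then lim_{n→∞} μ_{t_n+1}({σ ∈ S_n : fix(σ) = j}) = Σ_{i=j}^{∞} (−1)^{i−j}·C(i,j)·(1 + i·e^{−2c}/(1−e^{−2c}))·(1−e^{−2c})^i/i!. -/
-- Common setup for the random (n-k)-cycle to transpositions walk on the symmetric group.
open Finset Filter Real

noncomputable section

/-- Convolution of two (probability) distributions on `S_n`. -/
def conv {n : ℕ} (μ ν : Equiv.Perm (Fin n) → ℝ) : Equiv.Perm (Fin n) → ℝ :=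
  fun g => ∑ h : Equiv.Perm (Fin n), μ (g * h⁻¹) * ν h

/-- `t`-fold convolution power (with `μ^{*0}` the point mass at the identity). -/
def convPow {n : ℕ} (μ : Equiv.Perm (Fin n) → ℝ) : ℕ → (Equiv.Perm (Fin n) → ℝ)
  | 0 => fun g => if g = 1 then 1 else 0
  | t + 1 => conv (convPow μ t) μ

/-- Uniform probability distribution on a finite set of permutations. -/
def unifOn {n : ℕ} (S : Finset (Equiv.Perm (Fin n))) : Equiv.Perm (Fin n) → ℝ :=
  fun g => if g ∈ S then (1 : ℝ) / S.card else 0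

/-- The set of `(n-k)`-cycles of `S_n`: one cycle of length `n - k` and `k` fixed points. -/
def cycles (n k : ℕ) : Finset (Equiv.Perm (Fin n)) :=
  letI := Classical.decPred fun σ : Equiv.Perm (Fin n) => σ.IsCycle ∧ σ.support.card = n - k
  Finset.univ.filter fun σ : Equiv.Perm (Fin n) => σ.IsCycle ∧ σ.support.card = n - k

/-- The set of transpositions of `S_n`. -/
def transpositions (n : ℕ) : Finset (Equiv.Perm (Fin n)) :=
  letI := Classical.decPred fun σ : Equiv.Perm (Fin n) => σ.IsSwap
  Finset.univ.filter fun σ : Equiv.Perm (Fin n) => σ.IsSwap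

/-- The law `μ_{t+1} = ν_n * τ_n^{*t}` of the walk after the initial random `(n-k)`-cycle
and `t` random transpositions. -/
def walk (n k t : ℕ) : Equiv.Perm (Fin n) → ℝ :=
  conv (unifOn (cycles n k)) (convPow (unifOn (transpositions n)) t)

/-- The alternating group `A_n` as a finset. -/
def evenPerms (n : ℕ) : Finset (Equiv.Perm (Fin n)) :=
  Finset.univ.filter fun σ => Equiv.Perm.sign σ = 1

/-- `S_n \ A_n` as a finset. -/
def oddPerms (n : ℕ) : Finset (Equiv.Perm (Fin n)) :=
  Finset.univ.filter fun σ => ¬ (Equiv.Perm.sign σ = 1)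

/-- The stationary distribution `U_s` at step `s`: uniform on `A_n` if `s` and `n - k`
have the same parity, uniform on `S_n \ A_n` otherwise. -/
def stationary (n k s : ℕ) : Equiv.Perm (Fin n) → ℝ :=
  if s % 2 = (n - k) % 2 then unifOn (evenPerms n) else unifOn (oddPerms n)

/-- Total variation distance between two distributions on `S_n`. -/
def tvDist {n : ℕ} (μ ν : Equiv.Perm (Fin n) → ℝ) : ℝ :=
  (1 / 2) * ∑ σ : Equiv.Perm (Fin n), |μ σ - ν σ|

/-- The number of fixed points of a permutation. -/
def fixCount {n : ℕ} (σ : Equiv.Perm (Fin n)) : ℕ :=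
  (Finset.univ.filter fun i => σ i = i).card

end

namespace FixWalk
open Equiv

/-- Expectation of `f` under the law of the walk. -/
noncomputable def Ex (n t : ℕ) (f : Perm (Fin n) → ℝ) : ℝ := ∑ g, walk n 1 t g * f g

/-- One transposition step acting on functions. -/
noncomputable def P {n : ℕ} (f : Perm (Fin n) → ℝ) : Perm (Fin n) → ℝ := fun σ =>
  (∑ p ∈ (univ : Finset (Fin n)).offDiag, f (σ * swap p.1 p.2)) / ((n : ℝ) * (n - 1))

/-- Number of fixed points of the square. -/
def sqFix {n : ℕ} (σ : Perm (Fin n)) : ℕ := (univ.filter fun i => σ (σ i) = i).card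

lemma sum_conv {n : ℕ} (a b f : Perm (Fin n) → ℝ) :
    ∑ g, conv a b g * f g = ∑ σ, a σ * ∑ τ, b τ * f (σ * τ) := by
  unfold conv
  simp_rw [Finset.sum_mul, Finset.mul_sum]
  rw [Finset.sum_comm]
  rw [Finset.sum_comm (s := univ) (t := univ) (f := fun σ τ => a σ * (b τ * f (σ * τ)))]
  refine Finset.sum_congr rfl fun h _ => ?_
  refine Fintype.sum_equiv (Equiv.mulRight h⁻¹) _ _ fun g => ?_
  simp [mul_assoc]

lemma mem_transpositions {n : ℕ} (τ : Perm (Fin n)) : τ ∈ transpositions n ↔ τ.IsSwap := by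
  simp [transpositions]

lemma sum_swaps {n : ℕ} (f : Perm (Fin n) → ℝ) :
    ∑ p ∈ (univ : Finset (Fin n)).offDiag, f (swap p.1 p.2) = 2 * ∑ τ ∈ transpositions n, f τ := by
  classical
  rw [← Finset.sum_fiberwise_of_maps_to (t := transpositions n) (g := fun p => swap p.1 p.2)]
  · rw [Finset.mul_sum]
    refine Finset.sum_congr rfl fun τ hτ => ?_
    obtain ⟨x, y, hxy, rfl⟩ := (mem_transpositions τ).1 hτ
    have : (univ : Finset (Fin n)).offDiag.filter (fun p => swap p.1 p.2 = swap x y)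
        = {(x, y), (y, x)} := by
      ext ⟨u, v⟩
      simp only [Finset.mem_filter, Finset.mem_offDiag, Finset.mem_univ, true_and,
        Finset.mem_insert, Finset.mem_singleton, Prod.mk.injEq]
      constructor
      · rintro ⟨huv, h⟩
        have h1 : swap u v u = swap x y u := by rw [h]
        have h2 : swap u v v = swap x y v := by rw [h]
        rw [swap_apply_left] at h1
        rw [swap_apply_right] at h2
        rw [swap_apply_def] at h1 h2
        grind
      · rintro (⟨rfl, rfl⟩ | ⟨rfl, rfl⟩)
        · exact ⟨hxy, rfl⟩
        · exact ⟨hxy.symm, swap_comm _ _⟩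
    rw [this, Finset.sum_pair]
    · simp only []
      rw [swap_comm y x]; ring
    · intro h; exact hxy (Prod.mk.inj h).1
  · intro p hp
    rw [mem_transpositions]
    exact ⟨p.1, p.2, (Finset.mem_offDiag.1 hp).2.2, rfl⟩

lemma card_offDiag_real (n : ℕ) : (((univ : Finset (Fin n)).offDiag.card : ℕ) : ℝ) = n * (n - 1) := by
  rw [Finset.offDiag_card]
  simp only [Finset.card_univ, Fintype.card_fin]
  rw [Nat.cast_sub (Nat.le_mul_self n)]; push_cast; ring

lemma card_transp (n : ℕ) : 2 * ((transpositions n).card : ℝ) = n * (n - 1) := by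
  have := sum_swaps (n := n) (fun _ => 1)
  simp only [Finset.sum_const, nsmul_eq_mul, mul_one] at this
  rw [← this, card_offDiag_real]

lemma sum_unif_transp {n : ℕ} (f : Perm (Fin n) → ℝ) (σ : Perm (Fin n)) :
    ∑ τ, unifOn (transpositions n) τ * f (σ * τ) = P f σ := by
  unfold unifOn P
  rw [sum_swaps (fun τ => f (σ * τ)), ← card_transp]
  simp only [ite_mul, zero_mul, Finset.sum_ite_mem, Finset.univ_inter]
  rw [← Finset.mul_sum]
  rw [mul_div_mul_left _ _ two_ne_zero]; ring

lemma Ex_succ (n t : ℕ) (f : Perm (Fin n) → ℝ) : Ex n (t + 1) f = Ex n t (P f) := by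
  unfold Ex walk
  rw [sum_conv, sum_conv]
  refine Finset.sum_congr rfl fun σ _ => ?_
  congr 1
  rw [convPow, sum_conv]
  refine Finset.sum_congr rfl fun h _ => ?_
  congr 1
  rw [← sum_unif_transp]
  simp [mul_assoc]

lemma Ex_zero (n : ℕ) (f : Perm (Fin n) → ℝ) :
    Ex n 0 f = ∑ σ, unifOn (cycles n 1) σ * f σ := by
  unfold Ex walk
  rw [sum_conv]
  refine Finset.sum_congr rfl fun σ _ => ?_
  simp [convPow]

lemma unifOn_nonneg {n : ℕ} (S : Finset (Perm (Fin n))) (g) : 0 ≤ unifOn S g := by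
  unfold unifOn; split_ifs <;> positivity

lemma conv_nonneg {n : ℕ} {a b : Perm (Fin n) → ℝ} (ha : ∀ g, 0 ≤ a g) (hb : ∀ g, 0 ≤ b g) (g) :
    0 ≤ conv a b g := Finset.sum_nonneg fun _ _ => mul_nonneg (ha _) (hb _)

lemma walk_nonneg (n t : ℕ) (g) : 0 ≤ walk n 1 t g := by
  refine conv_nonneg (unifOn_nonneg _) ?_ g
  induction t with
  | zero => intro g; simp only [convPow]; split_ifs <;> norm_num
  | succ t ih => exact conv_nonneg ih (unifOn_nonneg _)

lemma Ex_mono (n t : ℕ) {f g : Perm (Fin n) → ℝ} (h : ∀ σ, f σ ≤ g σ) : Ex n t f ≤ Ex n t g :=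
  Finset.sum_le_sum fun σ _ => mul_le_mul_of_nonneg_left (h σ) (walk_nonneg n t σ)

lemma Ex_add (n t : ℕ) (f g : Perm (Fin n) → ℝ) :
    Ex n t (fun σ => f σ + g σ) = Ex n t f + Ex n t g := by
  simp [Ex, mul_add, Finset.sum_add_distrib]

lemma Ex_sub (n t : ℕ) (f g : Perm (Fin n) → ℝ) :
    Ex n t (fun σ => f σ - g σ) = Ex n t f - Ex n t g := by
  simp [Ex, mul_sub, Finset.sum_sub_distrib]

lemma Ex_smul (n t : ℕ) (a : ℝ) (f : Perm (Fin n) → ℝ) :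
    Ex n t (fun σ => a * f σ) = a * Ex n t f := by
  simp only [Ex, Finset.mul_sum]
  exact Finset.sum_congr rfl fun _ _ => by ring

lemma abs_Ex_le (n t : ℕ) (f : Perm (Fin n) → ℝ) : |Ex n t f| ≤ Ex n t (fun σ => |f σ|) := by
  unfold Ex
  refine (Finset.abs_sum_le_sum_abs _ _).trans (le_of_eq ?_)
  exact Finset.sum_congr rfl fun σ _ => by rw [abs_mul, abs_of_nonneg (walk_nonneg n t σ)]

lemma mem_cycles {n : ℕ} (σ : Perm (Fin n)) :
    σ ∈ cycles n 1 ↔ σ.IsCycle ∧ σ.support.card = n - 1 := by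
  simp [cycles]

lemma fixCount_add (n : ℕ) (σ : Perm (Fin n)) : fixCount σ + σ.support.card = n := by
  have h := Finset.card_filter_add_card_filter_not (s := (univ : Finset (Fin n))) (fun i => σ i = i)
  rw [Finset.card_univ, Fintype.card_fin] at h
  exact h

lemma fixCount_cycle {n : ℕ} (hn : 4 ≤ n) {σ : Perm (Fin n)} (h : σ ∈ cycles n 1) :
    fixCount σ = 1 := by
  have := fixCount_add n σ
  have := ((mem_cycles σ).1 h).2
  omega

lemma sqFix_cycle {n : ℕ} (hn : 4 ≤ n) {σ : Perm (Fin n)} (h : σ ∈ cycles n 1) :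
    sqFix σ = 1 := by
  rw [← fixCount_cycle hn h]
  obtain ⟨hc, hs⟩ := (mem_cycles σ).1 h
  unfold sqFix fixCount
  congr 1
  ext a
  simp only [Finset.mem_filter, Finset.mem_univ, true_and]
  constructor
  · intro h2
    by_contra h1
    have h3 : σ ^ 2 = 1 := (hc.pow_eq_one_iff).2 ⟨a, h1, by simpa [pow_two] using h2⟩
    have h4 := orderOf_dvd_of_pow_eq_one h3
    rw [hc.orderOf] at h4
    have := Nat.le_of_dvd (by norm_num) h4
    omega
  · intro h1; rw [h1, h1]

lemma cycles_nonempty {n : ℕ} (hn : 4 ≤ n) : (cycles n 1).Nonempty := by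
  obtain ⟨σ, hσ⟩ := (Perm.exists_with_cycleType_iff (α := Fin n) (m := {n - 1})).2
    ⟨by simp, by simp; omega⟩
  refine ⟨σ, (mem_cycles σ).2 ⟨?_, ?_⟩⟩
  · rw [← Perm.card_cycleType_eq_one, hσ]; simp
  · rw [← Perm.sum_cycleType, hσ]; simp

lemma Ex_zero_eq {n : ℕ} (hn : 4 ≤ n) (f : Perm (Fin n) → ℝ) (a : ℝ)
    (h : ∀ σ ∈ cycles n 1, f σ = a) : Ex n 0 f = a := by
  rw [Ex_zero]
  unfold unifOn
  simp only [ite_mul, zero_mul, Finset.sum_ite_mem, Finset.univ_inter]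
  rw [Finset.sum_congr rfl (fun σ hσ => by rw [h σ hσ]), Finset.sum_const, nsmul_eq_mul]
  have : ((cycles n 1).card : ℝ) ≠ 0 := by
    have := (cycles_nonempty hn).card_pos
    positivity
  field_simp

lemma P_const {n : ℕ} (hn : 4 ≤ n) (a : ℝ) : P (n := n) (fun _ => a) = fun _ => a := by
  funext σ
  unfold P
  rw [Finset.sum_const, nsmul_eq_mul, card_offDiag_real]
  have : (4 : ℝ) ≤ n := by exact_mod_cast hn
  rw [mul_div_cancel_left₀]
  exact mul_ne_zero (by linarith) (by linarith)

lemma Ex_const {n : ℕ} (hn : 4 ≤ n) (t : ℕ) (a : ℝ) : Ex n t (fun _ => a) = a := by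
  induction t with
  | zero => exact Ex_zero_eq hn _ a (fun _ _ => rfl)
  | succ t ih => rw [Ex_succ, P_const hn, ih]

lemma sum_offDiag' {n : ℕ} (g : Fin n → Fin n → ℝ) :
    ∑ p ∈ (univ : Finset (Fin n)).offDiag, g p.1 p.2 = ∑ x, ∑ y, g x y - ∑ x, g x x := by
  have h := Finset.sum_union (Finset.disjoint_diag_offDiag (univ : Finset (Fin n)))
    (f := fun p => g p.1 p.2)
  rw [Finset.diag_union_offDiag, Finset.sum_product, Finset.sum_diag] at h
  rw [h]; ring

/-- Real indicator that `σ x = y`. -/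
noncomputable def I {n : ℕ} (σ : Perm (Fin n)) (x y : Fin n) : ℝ := if σ x = y then 1 else 0

lemma fix_eq_sum {n : ℕ} (σ : Perm (Fin n)) : (fixCount σ : ℝ) = ∑ x, I σ x x := by
  simp [fixCount, I]

lemma fix_mul_swap {n : ℕ} (σ : Perm (Fin n)) {x y : Fin n} (h : x ≠ y) :
    (fixCount (σ * swap x y) : ℝ) = fixCount σ - I σ x x - I σ y y + I σ y x + I σ x y := by
  have : ∑ a, (I (σ * swap x y) a a - I σ a a)
      = (I (σ * swap x y) x x - I σ x x) + (I (σ * swap x y) y y - I σ y y) := by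
    refine Fintype.sum_eq_add x y h ?_
    rintro a ⟨h1, h2⟩
    simp [I, swap_apply_of_ne_of_ne h1 h2]
  rw [Finset.sum_sub_distrib, ← fix_eq_sum, ← fix_eq_sum] at this
  simp [I] at this ⊢
  linarith

lemma sum_A {n : ℕ} (σ : Perm (Fin n)) :
    ∑ p ∈ (univ : Finset (Fin n)).offDiag, I σ p.1 p.1 = fixCount σ * (n - 1) := by
  rw [sum_offDiag' (fun x _ => I σ x x)]
  simp only [Finset.sum_const, ← Finset.smul_sum, ← fix_eq_sum]
  simp; ring
lemma sum_B {n : ℕ} (σ : Perm (Fin n)) :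
    ∑ p ∈ (univ : Finset (Fin n)).offDiag, I σ p.2 p.2 = fixCount σ * (n - 1) := by
  rw [sum_offDiag' (fun _ x => I σ x x)]
  simp only [Finset.sum_const, ← fix_eq_sum]
  simp; ring
lemma sum_D {n : ℕ} (σ : Perm (Fin n)) :
    ∑ p ∈ (univ : Finset (Fin n)).offDiag, I σ p.1 p.2 = n - fixCount σ := by
  rw [sum_offDiag' (fun x y => I σ x y), ← fix_eq_sum]
  simp [I]
lemma sum_C {n : ℕ} (σ : Perm (Fin n)) :
    ∑ p ∈ (univ : Finset (Fin n)).offDiag, I σ p.2 p.1 = n - fixCount σ := by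
  rw [sum_offDiag' (fun x y => I σ y x), ← fix_eq_sum, Finset.sum_comm]
  simp [I]

lemma I_nonneg {n : ℕ} (σ : Perm (Fin n)) (x y) : 0 ≤ I σ x y := by
  unfold I; split_ifs <;> norm_num

lemma sum_AB {n : ℕ} (σ : Perm (Fin n)) :
    ∑ p ∈ (univ : Finset (Fin n)).offDiag, I σ p.1 p.1 * I σ p.2 p.2 ≤ (fixCount σ : ℝ) ^ 2 := by
  rw [sum_offDiag' (fun x y => I σ x x * I σ y y), fix_eq_sum, pow_two, Finset.sum_mul_sum]
  have := Finset.sum_nonneg (s := (univ : Finset (Fin n)))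
    (fun x _ => mul_nonneg (I_nonneg σ x x) (I_nonneg σ x x))
  linarith

lemma sum_CD {n : ℕ} (σ : Perm (Fin n)) :
    ∑ p ∈ (univ : Finset (Fin n)).offDiag, I σ p.2 p.1 * I σ p.1 p.2 ≤ (sqFix σ : ℝ) := by
  rw [sum_offDiag' (fun x y => I σ y x * I σ x y)]
  have := Finset.sum_nonneg (s := (univ : Finset (Fin n)))
    (fun x _ => mul_nonneg (I_nonneg σ x x) (I_nonneg σ x x))
  have h : ∑ x, ∑ y, I σ y x * I σ x y = (sqFix σ : ℝ) := by
    simp [I, sqFix]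
  linarith

/-- trichotomy for the four indicators -/
lemma I_cases {n : ℕ} (σ : Perm (Fin n)) {x y : Fin n} (h : x ≠ y) :
    (I σ y x = 0 ∧ I σ x y = 0 ∧ (I σ x x = 0 ∨ I σ x x = 1) ∧ (I σ y y = 0 ∨ I σ y y = 1)) ∨
    (I σ x x = 0 ∧ I σ y y = 0 ∧ (I σ y x = 0 ∨ I σ y x = 1) ∧ (I σ x y = 0 ∨ I σ x y = 1)) := by
  have h1 : σ x ≠ σ y := fun e => h (σ.injective e)
  unfold I
  grind

lemma P_fix_sq {n : ℕ} (hn : 4 ≤ n) (σ : Perm (Fin n)) :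
    P (fun σ => (fixCount σ : ℝ) ^ 2) σ ≤ (fixCount σ : ℝ) ^ 2 + 8 / (n - 1) := by
  have hn' : (4 : ℝ) ≤ n := by exact_mod_cast hn
  unfold P
  rw [div_le_iff₀ (mul_pos (by linarith) (by linarith))]
  set N : ℝ := (fixCount σ : ℝ) with hN
  have hN0 : 0 ≤ N := by positivity
  have key : ∑ p ∈ (univ : Finset (Fin n)).offDiag, (fixCount (σ * swap p.1 p.2) : ℝ) ^ 2
      ≤ ∑ p ∈ (univ : Finset (Fin n)).offDiag, (N ^ 2 + (2 * N) * (I σ p.2 p.1 + I σ p.1 p.2 - I σ p.1 p.1 - I σ p.2 p.2)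
        + 2 * (I σ p.2 p.1 + I σ p.1 p.2 + I σ p.1 p.1 + I σ p.2 p.2)) := by
    refine Finset.sum_le_sum fun p hp => ?_
    have hne := (Finset.mem_offDiag.1 hp).2.2
    rw [fix_mul_swap σ hne, ← hN]
    rcases I_cases σ hne with ⟨h1, h2, h3, h4⟩ | ⟨h1, h2, h3, h4⟩ <;>
    rcases h3 with h3 | h3 <;> rcases h4 with h4 | h4 <;> rw [h1, h2, h3, h4] <;> nlinarith
  refine key.trans ?_
  simp only [Finset.sum_add_distrib, Finset.sum_sub_distrib, ← Finset.mul_sum, sum_A, sum_B, sum_C, sum_D,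
    Finset.sum_const, nsmul_eq_mul, card_offDiag_real, ← hN]
  have : (N ^ 2 + 8 / (n - 1)) * (n * (n - 1)) = N ^ 2 * (n * (n - 1)) + 8 * n := by
    have : (n : ℝ) - 1 ≠ 0 := by linarith
    field_simp
  rw [this]
  nlinarith [mul_nonneg (show (0 : ℝ) ≤ n by linarith) (sq_nonneg (N - 1))]

lemma sq_count {n : ℕ} (σ : Perm (Fin n)) (a : Fin n) :
    (((univ : Finset (Fin n)).offDiag.filter
      (fun p => σ (swap p.1 p.2 (σ (swap p.1 p.2 a))) = a)).card : ℝ)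
      ≤ (if σ (σ a) = a then 1 else 0) * (n * (n - 1)) + 6 := by
  split_ifs with h
  · have := Finset.card_filter_le (univ : Finset (Fin n)).offDiag (fun p => σ (swap p.1 p.2 (σ (swap p.1 p.2 a))) = a)
    have h2 : (((univ : Finset (Fin n)).offDiag.filter
      (fun p => σ (swap p.1 p.2 (σ (swap p.1 p.2 a))) = a)).card : ℝ) ≤ (((univ : Finset (Fin n)).offDiag.card : ℕ) : ℝ) := by
      exact_mod_cast this
    rw [card_offDiag_real] at h2
    linarith
  · have ha : σ a ≠ a := fun e => h (by rw [e, e])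
    have hsub : (univ : Finset (Fin n)).offDiag.filter
      (fun p => σ (swap p.1 p.2 (σ (swap p.1 p.2 a))) = a) ⊆
      {(a, σ⁻¹ (σ⁻¹ a)), (a, σ⁻¹ a), (σ⁻¹ (σ⁻¹ a), a), (σ⁻¹ a, a), (σ a, σ⁻¹ a), (σ⁻¹ a, σ a)} := by
      rintro ⟨x, y⟩ hp
      simp only [Finset.mem_filter, Finset.mem_offDiag, Finset.mem_univ, true_and] at hp
      obtain ⟨hxy, he⟩ := hp
      simp only [Finset.mem_insert, Finset.mem_singleton, Prod.mk.injEq, Perm.eq_inv_iff_eq]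
      have inj := σ.injective
      by_cases hx : x = a
      · subst hx
        rw [swap_apply_left, swap_apply_def] at he
        grind
      by_cases hy : y = a
      · subst hy
        rw [swap_apply_right, swap_apply_def] at he
        grind
      rw [swap_apply_of_ne_of_ne (Ne.symm hx) (Ne.symm hy), swap_apply_def] at he
      grind
    have := (Finset.card_le_card hsub).trans Finset.card_le_six
    have h2 : (((univ : Finset (Fin n)).offDiag.filter
      (fun p => σ (swap p.1 p.2 (σ (swap p.1 p.2 a))) = a)).card : ℝ) ≤ 6 := by exact_mod_cast this
    linarith

lemma P_sqFix {n : ℕ} (hn : 4 ≤ n) (σ : Perm (Fin n)) :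
    P (fun σ => (sqFix σ : ℝ)) σ ≤ (sqFix σ : ℝ) + 6 / (n - 1) := by
  have hn' : (4 : ℝ) ≤ n := by exact_mod_cast hn
  unfold P
  rw [div_le_iff₀ (mul_pos (by linarith) (by linarith))]
  have h1 : ∑ p ∈ (univ : Finset (Fin n)).offDiag, (sqFix (σ * swap p.1 p.2) : ℝ)
      = ∑ a : Fin n, (((univ : Finset (Fin n)).offDiag.filter
      (fun p => σ (swap p.1 p.2 (σ (swap p.1 p.2 a))) = a)).card : ℝ) := by
    have h0 : ∀ p : Fin n × Fin n, (sqFix (σ * swap p.1 p.2) : ℝ)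
        = ∑ a, if σ (swap p.1 p.2 (σ (swap p.1 p.2 a))) = a then (1 : ℝ) else 0 := by
      intro p
      rw [sqFix, Finset.natCast_card_filter]
      rfl
    simp only [h0, Finset.natCast_card_filter]
    rw [Finset.sum_comm]
  rw [h1]
  refine (Finset.sum_le_sum fun a _ => sq_count σ a).trans ?_
  rw [Finset.sum_add_distrib, ← Finset.sum_mul]
  have : ((sqFix σ : ℝ) + 6 / (n - 1)) * (n * (n - 1)) = sqFix σ * (n * (n - 1)) + n * 6 := by
    have : (n : ℝ) - 1 ≠ 0 := by linarith
    field_simp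
  rw [this]
  simp [sqFix]

lemma Ex_growth {n : ℕ} (hn : 4 ≤ n) (f : Perm (Fin n) → ℝ) (b : ℝ)
    (h : ∀ σ, P f σ ≤ f σ + b) (t : ℕ) : Ex n t f ≤ Ex n 0 f + t * b := by
  induction t with
  | zero => simp
  | succ t ih =>
    rw [Ex_succ]
    have h1 := Ex_mono n t h
    rw [Ex_add, Ex_const hn] at h1
    push_cast
    linarith

lemma Ex_V {n : ℕ} (hn : 4 ≤ n) (t : ℕ) :
    Ex n t (fun σ => 1 + (fixCount σ : ℝ) ^ 2 + sqFix σ) ≤ 3 + t * (14 / (n - 1)) := by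
  rw [Ex_add, Ex_add, Ex_const hn]
  have h1 := Ex_growth hn _ _ (P_fix_sq hn) t
  have h2 := Ex_growth hn _ _ (P_sqFix hn) t
  rw [Ex_zero_eq hn _ 1 (fun σ hσ => by rw [fixCount_cycle hn hσ]; simp)] at h1
  rw [Ex_zero_eq hn _ 1 (fun σ hσ => by rw [sqFix_cycle hn hσ]; simp)] at h2
  have : (14 : ℝ) / (n - 1) = 8 / (n - 1) + 6 / (n - 1) := by ring
  rw [this]; linarith

end FixWalk

namespace FixWalk
open Equiv

lemma pow_taylor {w d : ℝ} (hw : 0 ≤ w) (hd : 0 ≤ d) (h1 : w + d ≤ 1) (N : ℕ) :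
    |(w + d) ^ N - w ^ N - N * w ^ (N - 1) * d| ≤ (N : ℝ) ^ 2 * d ^ 2 := by
  induction N with
  | zero => simp
  | succ N ih =>
    have hw1 : w ≤ 1 := by linarith
    have e : (w + d) ^ (N + 1) - w ^ (N + 1) - (N + 1 : ℕ) * w ^ (N + 1 - 1) * d
        = (w + d) * ((w + d) ^ N - w ^ N - N * w ^ (N - 1) * d) + N * w ^ (N - 1) * d ^ 2 := by
      rcases N with _ | N
      · simp
      · simp only [Nat.add_sub_cancel]; push_cast; ring
    rw [e]
    refine (abs_add_le _ _).trans ?_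
    rw [abs_mul, abs_of_nonneg (show 0 ≤ w + d by linarith)]
    have h2 : (w + d) * |(w + d) ^ N - w ^ N - N * w ^ (N - 1) * d| ≤ (N : ℝ) ^ 2 * d ^ 2 := by
      refine le_trans ?_ ih
      exact mul_le_of_le_one_left (abs_nonneg _) h1
    have h3 : |(N : ℝ) * w ^ (N - 1) * d ^ 2| ≤ N * d ^ 2 := by
      rw [abs_of_nonneg (by positivity)]
      have := pow_le_one₀ hw hw1 (n := N - 1)
      have h4 : 0 ≤ (N : ℝ) * d ^ 2 := by positivity
      nlinarith
    push_cast
    have h4 : 0 ≤ (N : ℝ) * d ^ 2 := by positivity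
    nlinarith [sq_nonneg d]

lemma exp_step {w d : ℝ} (hw : 0 ≤ w) (hd : 0 ≤ d) (h1 : w + d ≤ 1) (N : ℕ) :
    |Real.exp (-d) * (w + d) ^ N - (w ^ N + N * w ^ (N - 1) * d - d * w ^ N)|
      ≤ (1 + 3 * (N : ℝ) ^ 2) * d ^ 2 := by
  have ht := pow_taylor hw hd h1 N
  have he := Real.abs_exp_sub_one_sub_id_le (x := -d) (by rw [abs_neg, abs_of_nonneg hd]; linarith)
  have hp : (w + d) ^ N ≤ 1 := pow_le_one₀ (by linarith) h1
  have hp0 : 0 ≤ (w + d) ^ N := by positivity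
  have e : Real.exp (-d) * (w + d) ^ N - (w ^ N + N * w ^ (N - 1) * d - d * w ^ N)
      = (Real.exp (-d) - 1 - -d) * (w + d) ^ N
        + (1 - d) * ((w + d) ^ N - w ^ N - N * w ^ (N - 1) * d) - N * w ^ (N - 1) * d ^ 2 := by ring
  rw [e]
  have a1 : |(Real.exp (-d) - 1 - -d) * (w + d) ^ N| ≤ d ^ 2 := by
    rw [abs_mul, abs_of_nonneg hp0]
    calc _ ≤ |Real.exp (-d) - 1 - -d| * 1 := by gcongr
      _ ≤ _ := by linarith [neg_sq d]
  have a2 : |(1 - d) * ((w + d) ^ N - w ^ N - N * w ^ (N - 1) * d)| ≤ (N : ℝ) ^ 2 * d ^ 2 := by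
    rw [abs_mul, abs_of_nonneg (show 0 ≤ 1 - d by linarith)]
    exact (mul_le_of_le_one_left (abs_nonneg _) (by linarith)).trans ht
  have a3 : |(N : ℝ) * w ^ (N - 1) * d ^ 2| ≤ (N : ℝ) ^ 2 * d ^ 2 := by
    rw [abs_of_nonneg (by positivity)]
    have := pow_le_one₀ hw (show w ≤ 1 by linarith) (n := N - 1)
    have hN : (N : ℝ) ≤ (N : ℝ) ^ 2 := by exact_mod_cast Nat.le_self_pow (by norm_num) N
    gcongr
    calc (N : ℝ) * w ^ (N - 1) ≤ N * 1 := by gcongr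
      _ ≤ _ := by linarith
  have := abs_sub ((Real.exp (-d) - 1 - -d) * (w + d) ^ N
        + (1 - d) * ((w + d) ^ N - w ^ N - N * w ^ (N - 1) * d)) (N * w ^ (N - 1) * d ^ 2)
  have := abs_add_le ((Real.exp (-d) - 1 - -d) * (w + d) ^ N)
    ((1 - d) * ((w + d) ^ N - w ^ N - N * w ^ (N - 1) * d))
  nlinarith [sq_nonneg d, mul_nonneg (sq_nonneg (N : ℝ)) (sq_nonneg d)]

lemma pair_err {n : ℕ} (σ : Perm (Fin n)) {x y : Fin n} (h : x ≠ y) {w : ℝ} (hw : 0 ≤ w)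
    (hw1 : w ≤ 1) :
    |w ^ fixCount (σ * swap x y) - (w ^ fixCount σ
      + (I σ x x + I σ y y) * (w ^ (fixCount σ - 1) * (1 - w))
      - (I σ y x + I σ x y) * (w ^ fixCount σ * (1 - w)))|
      ≤ I σ x x * I σ y y + I σ y x * I σ x y := by
  have hf := fix_mul_swap σ h
  have hb : ∀ M : ℕ, |w ^ M * (1 - w) ^ 2| ≤ 1 := by
    intro M
    rw [abs_of_nonneg (by positivity)]
    exact mul_le_one₀ (pow_le_one₀ hw hw1) (by positivity) (pow_le_one₀ (by linarith) (by linarith))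
  generalize fixCount (σ * swap x y) = M at *
  generalize fixCount σ = N at *
  rcases I_cases σ h with ⟨h1, h2, h3, h4⟩ | ⟨h1, h2, h3, h4⟩ <;>
    rcases h3 with h3 | h3 <;> rcases h4 with h4 | h4 <;> rw [h1, h2, h3, h4] at hf ⊢
  · have : M = N := by exact_mod_cast (by linarith : (M : ℝ) = N)
    subst this; simp
  · have : N = M + 1 := by exact_mod_cast (by linarith : (N : ℝ) = M + 1)
    subst this
    simp only [Nat.add_sub_cancel]; ring_nf; simp
  · have : N = M + 1 := by exact_mod_cast (by linarith : (N : ℝ) = M + 1)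
    subst this
    simp only [Nat.add_sub_cancel]; ring_nf; simp
  · have : N = M + 2 := by exact_mod_cast (by linarith : (N : ℝ) = M + 2)
    subst this
    have := hb M
    rw [show M + 2 - 1 = M + 1 from rfl]
    refine le_trans (le_of_eq ?_) (this.trans (by norm_num))
    congr 1; ring
  · have : M = N := by exact_mod_cast (by linarith : (M : ℝ) = N)
    subst this; simp
  · have : M = N + 1 := by exact_mod_cast (by linarith : (M : ℝ) = N + 1)
    subst this; ring_nf; simp
  · have : M = N + 1 := by exact_mod_cast (by linarith : (M : ℝ) = N + 1)
    subst this; ring_nf; simp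
  · have : M = N + 2 := by exact_mod_cast (by linarith : (M : ℝ) = N + 2)
    subst this
    refine le_trans (le_of_eq ?_) ((hb N).trans (by norm_num))
    congr 1; ring

lemma P_pow {n : ℕ} (hn : 4 ≤ n) (σ : Perm (Fin n)) {w : ℝ} (hw : 0 ≤ w) (hw1 : w ≤ 1) :
    |P (fun σ => w ^ fixCount σ) σ - (w ^ fixCount σ
      + fixCount σ * w ^ (fixCount σ - 1) * (2 / n * (1 - w)) - 2 / n * (1 - w) * w ^ fixCount σ)|
      ≤ (2 + 3 * (fixCount σ : ℝ) ^ 2 + sqFix σ) / (n * (n - 1)) := by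
  have hn' : (4 : ℝ) ≤ n := by exact_mod_cast hn
  have hpos : (0 : ℝ) < n * (n - 1) := mul_pos (by linarith) (by linarith)
  have key := (Finset.abs_sum_le_sum_abs _ _).trans (Finset.sum_le_sum
    (s := (univ : Finset (Fin n)).offDiag) (fun p hp =>
      pair_err σ (Finset.mem_offDiag.1 hp).2.2 hw hw1))
  simp only [Finset.sum_add_distrib, Finset.sum_sub_distrib, ← Finset.sum_mul, sum_A, sum_B, sum_C,
    sum_D, Finset.sum_const, nsmul_eq_mul, card_offDiag_real] at key
  have key2 := key.trans (add_le_add (sum_AB σ) (sum_CD σ))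
  unfold P
  set S := ∑ p ∈ (univ : Finset (Fin n)).offDiag, w ^ fixCount (σ * swap p.1 p.2)
  have hN : (fixCount σ : ℝ) ≤ (fixCount σ : ℝ) ^ 2 := by
    exact_mod_cast Nat.le_self_pow (by norm_num) _
  have hN0 : (0 : ℝ) ≤ fixCount σ := by positivity
  rw [le_div_iff₀ hpos, ← abs_of_pos hpos, ← abs_mul, abs_of_pos hpos]
  have hq0 : 0 ≤ w ^ fixCount σ * (1 - w) := mul_nonneg (by positivity) (by linarith)
  have hq1 : w ^ fixCount σ * (1 - w) ≤ 1 :=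
    mul_le_one₀ (pow_le_one₀ hw hw1) (by linarith) (by linarith)
  set N : ℝ := (fixCount σ : ℝ)
  have e : (S / (n * (n - 1)) - (w ^ fixCount σ
      + N * w ^ (fixCount σ - 1) * (2 / n * (1 - w)) - 2 / n * (1 - w) * w ^ fixCount σ)) * (n * (n - 1))
      = (S - (n * (n - 1) * w ^ fixCount σ
        + (N * (n - 1) + N * (n - 1)) * (w ^ (fixCount σ - 1) * (1 - w))
        - (n - N + (n - N)) * (w ^ fixCount σ * (1 - w)))) 
        + 2 * (N - 1) * (w ^ fixCount σ * (1 - w)) := by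
    have : (n : ℝ) - 1 ≠ 0 := by linarith
    have : (n : ℝ) ≠ 0 := by linarith
    field_simp
    ring
  rw [e]
  refine (abs_add_le _ _).trans ?_
  have : |2 * (N - 1) * (w ^ fixCount σ * (1 - w))| ≤ 2 * (N + 1) := by
    rw [abs_mul, abs_of_nonneg hq0, abs_mul, abs_two]
    have : |N - 1| ≤ N + 1 := abs_le.2 ⟨by linarith, by linarith⟩
    calc _ ≤ 2 * |N - 1| * 1 := by gcongr
      _ ≤ _ := by linarith
  linarith

lemma P_pow' {n : ℕ} (hn : 4 ≤ n) (σ : Perm (Fin n)) {w : ℝ} (hw : 0 ≤ w) (hw1 : w ≤ 1) :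
    |P (fun σ => w ^ fixCount σ) σ - Real.exp (-(2 / n * (1 - w))) * (w + 2 / n * (1 - w)) ^ fixCount σ|
      ≤ 20 / (n * (n - 1)) * (1 + (fixCount σ : ℝ) ^ 2 + sqFix σ) := by
  have hn' : (4 : ℝ) ≤ n := by exact_mod_cast hn
  have hpos : (0 : ℝ) < n * (n - 1) := mul_pos (by linarith) (by linarith)
  have h1 := P_pow hn σ hw hw1
  have hd : 0 ≤ 2 / (n : ℝ) * (1 - w) := mul_nonneg (by positivity) (by linarith)
  have hn2 : 2 / (n : ℝ) ≤ 1 := by rw [div_le_one (by linarith)]; linarith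
  have h2 := exp_step hw hd (by nlinarith) (fixCount σ)
  have h3 : (2 / (n : ℝ) * (1 - w)) ^ 2 ≤ 4 / (n * (n - 1)) := by
    rw [mul_pow, div_pow]
    calc (2 : ℝ) ^ 2 / (n : ℝ) ^ 2 * (1 - w) ^ 2 ≤ (2 : ℝ) ^ 2 / (n : ℝ) ^ 2 * 1 := by
          gcongr
          exact pow_le_one₀ (by linarith) (by linarith)
      _ ≤ 4 / ((n : ℝ) * (n - 1)) := by
        rw [mul_one, show (2 : ℝ) ^ 2 = 4 by norm_num]
        gcongr
        nlinarith
  have h4 : (1 + 3 * (fixCount σ : ℝ) ^ 2) * (2 / (n : ℝ) * (1 - w)) ^ 2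
      ≤ (1 + 3 * (fixCount σ : ℝ) ^ 2) * (4 / (n * (n - 1))) := by gcongr
  rw [abs_sub_comm] at h2
  refine (abs_sub_le _ _ _).trans ((add_le_add h1 (h2.trans h4)).trans ?_)
  rw [mul_div_assoc', div_mul_eq_mul_div, ← add_div]
  gcongr
  have : (0 : ℝ) ≤ sqFix σ := by positivity
  nlinarith [sq_nonneg (fixCount σ : ℝ)]

lemma Ex_pow {n : ℕ} (hn : 4 ≤ n) (B : ℝ) (t : ℕ) 
    (hB : ∀ s ≤ t, Ex n s (fun σ => 1 + (fixCount σ : ℝ) ^ 2 + sqFix σ) ≤ B) :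
    ∀ w : ℝ, 0 ≤ w → w ≤ 1 → 
    |Ex n t (fun σ => w ^ fixCount σ) - Real.exp (-((1 - w) * (1 - (1 - 2 / (n : ℝ)) ^ t))) *
      (1 - (1 - w) * (1 - 2 / (n : ℝ)) ^ t)| ≤ t * (20 / (n * (n - 1)) * B) := by
  have hn' : (4 : ℝ) ≤ n := by exact_mod_cast hn
  have hpos : (0 : ℝ) < n * (n - 1) := mul_pos (by linarith) (by linarith)
  have hn2 : 2 / (n : ℝ) ≤ 1 := by rw [div_le_one (by linarith)]; linarith
  have hn0 : 0 ≤ 2 / (n : ℝ) := by positivity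
  induction t with
  | zero =>
    intro w hw hw1
    rw [Ex_zero_eq hn _ w (fun σ hσ => by rw [fixCount_cycle hn hσ]; simp)]
    simp
  | succ t ih =>
    intro w hw hw1
    have ih' := ih (fun s hs => hB s (by omega)) (w + 2 / n * (1 - w)) (by nlinarith) (by nlinarith)
    rw [Ex_succ]
    have h1 := (abs_Ex_le n t _).trans (Ex_mono n t (fun σ => P_pow' hn σ hw hw1))
    rw [Ex_smul, Ex_sub, Ex_smul] at h1
    have h2 := hB t (by omega)
    have h3 : 20 / ((n : ℝ) * (n - 1)) * Ex n t (fun σ => 1 + (fixCount σ : ℝ) ^ 2 + sqFix σ)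
      ≤ 20 / (n * (n - 1)) * B := by gcongr
    set E := Ex n t (fun σ => (w + 2 / n * (1 - w)) ^ fixCount σ)
    have e1 : Real.exp (-((1 - w) * (1 - (1 - 2 / (n : ℝ)) ^ (t + 1)))) *
      (1 - (1 - w) * (1 - 2 / (n : ℝ)) ^ (t + 1)) = Real.exp (-(2 / n * (1 - w))) *
        (Real.exp (-((1 - (w + 2 / n * (1 - w))) * (1 - (1 - 2 / (n : ℝ)) ^ t))) *
      (1 - (1 - (w + 2 / n * (1 - w))) * (1 - 2 / (n : ℝ)) ^ t)) := by
      rw [← mul_assoc, ← Real.exp_add]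
      congr 2 <;> ring
    rw [e1]
    refine (abs_sub_le _ (Real.exp (-(2 / n * (1 - w))) * E) _).trans ?_
    rw [← mul_sub, abs_mul, Real.abs_exp]
    have h5 : Real.exp (-(2 / n * (1 - w))) ≤ 1 := by
      rw [Real.exp_le_one_iff]; nlinarith
    have h6 := (mul_le_of_le_one_left (abs_nonneg _) h5).trans ih'
    push_cast
    linarith


lemma coeff_tendsto (b : ℕ → ℕ → ℝ) (M : ℝ) (hM : ∀ n k, |b n k| ≤ M)
    (h : ∀ z : ℝ, 0 < z → z < 1 → Tendsto (fun n => ∑' k, b n k * z ^ k) atTop (nhds 0)) (j : ℕ) :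
    Tendsto (fun n => b n j) atTop (nhds 0) := by
  have hM0 : 0 ≤ M := (abs_nonneg _).trans (hM 0 0)
  induction j using Nat.strong_induction_on with
  | _ j ih =>
  have hsum : ∀ n, ∀ z : ℝ, 0 < z → z < 1 → Summable (fun k => b n k * z ^ k) := by
    intro n z h0 h1
    refine Summable.of_norm_bounded ((summable_geometric_of_lt_one h0.le h1).mul_left M) fun k => ?_
    rw [Real.norm_eq_abs, abs_mul, abs_of_nonneg (show 0 ≤ z ^ k by positivity)]
    gcongr
    exact hM n k
  rw [Metric.tendsto_atTop]
  intro ε hε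
  obtain ⟨z, hz0, hz1, hz2⟩ : ∃ z : ℝ, 0 < z ∧ z ≤ 1 / 2 ∧ 2 * M * z ≤ ε / 2 := by
    refine ⟨min (1 / 2) (ε / (4 * (M + 1))), by positivity, min_le_left _ _, ?_⟩
    have := min_le_right (1 / 2) (ε / (4 * (M + 1)))
    calc 2 * M * min (1 / 2) (ε / (4 * (M + 1))) ≤ 2 * (M + 1) * (ε / (4 * (M + 1))) := by
          gcongr; linarith
      _ = ε / 2 := by field_simp; norm_num
  have hz1' : z < 1 := by linarith
  have hlim : Tendsto (fun n => (∑' k, b n k * z ^ k - ∑ k ∈ Finset.range j, b n k * z ^ k) / z ^ j)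
      atTop (nhds 0) := by
    have h1 := (h z hz0 hz1').sub (tendsto_finsetSum (Finset.range j)
      (fun k hk => (ih k (Finset.mem_range.1 hk)).mul_const (z ^ k)))
    simpa using h1.div_const (z ^ j)
  obtain ⟨n0, hn0⟩ := (Metric.tendsto_atTop.1 hlim) (ε / 2) (by positivity)
  refine ⟨n0, fun n hn => ?_⟩
  have h1 := hn0 n hn
  rw [Real.dist_eq, sub_zero] at h1 ⊢
  have hs := hsum n z hz0 hz1'
  have e : (∑' k, b n k * z ^ k - ∑ k ∈ Finset.range j, b n k * z ^ k) / z ^ j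
      = b n j + ∑' k, b n (k + (j + 1)) * z ^ (k + 1) := by
    rw [← hs.sum_add_tsum_nat_add (j + 1), Finset.sum_range_succ]
    have : ∑' k, b n (k + (j + 1)) * z ^ (k + (j + 1))
        = z ^ j * ∑' k, b n (k + (j + 1)) * z ^ (k + 1) := by
      rw [← tsum_mul_left]
      congr 1; ext k; ring
    rw [this]
    field_simp
    ring
  rw [e] at h1
  have h2 : |∑' k, b n (k + (j + 1)) * z ^ (k + 1)| ≤ M * z * (1 - z)⁻¹ := by
    rw [← Real.norm_eq_abs]
    refine tsum_of_norm_bounded ((hasSum_geometric_of_lt_one hz0.le hz1').mul_left (M * z)) fun k => ?_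
    rw [Real.norm_eq_abs, abs_mul, abs_of_nonneg (show 0 ≤ z ^ (k + 1) by positivity), mul_assoc,
      ← pow_succ']
    gcongr
    exact hM _ _
  have h3 : M * z * (1 - z)⁻¹ ≤ M * z * 2 := by
    gcongr
    rw [inv_le_comm₀ (by linarith) (by norm_num)]; linarith
  have h4 := abs_sub_abs_le_abs_sub (b n j) (-(∑' k, b n (k + (j + 1)) * z ^ (k + 1)))
  rw [sub_neg_eq_add, abs_neg] at h4
  linarith

/-- The limiting law. -/
noncomputable def L (q r : ℝ) (j : ℕ) : ℝ := Real.exp (-q) * (q ^ j / j.factorial * (q + j * (r / q)))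

lemma hasSum_exp (x : ℝ) : HasSum (fun m : ℕ => x ^ m / m.factorial) (Real.exp x) := by
  rw [Real.exp_eq_exp_ℝ]; exact NormedSpace.expSeries_div_hasSum_exp x

lemma hasSum_of_eq {f g : ℕ → ℝ} {a b : ℝ} (h : HasSum g b) (hf : ∀ m, f m = g m) (ha : a = b) :
    HasSum f a := by
  have : f = g := funext hf
  rw [this, ha]; exact h

lemma hasSum_mul_exp (x : ℝ) : HasSum (fun m : ℕ => m * (x ^ m / m.factorial)) (x * Real.exp x) := by
  rw [← hasSum_nat_add_iff' 1]
  simp only [Finset.sum_range_one, Nat.cast_zero, zero_mul, sub_zero]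
  refine hasSum_of_eq ((hasSum_exp x).mul_left x) (fun m => ?_) rfl
  rw [Nat.factorial_succ]
  push_cast
  field_simp
  ring

lemma L_eq {q r : ℝ} (hq : 0 < q) (hr : r = 1 - q) (j : ℕ) :
    (∑' i : ℕ, if j ≤ i then (-1 : ℝ) ^ (i - j) * (i.choose j) * (1 + (i : ℝ) * r / q) *
      q ^ i / (Nat.factorial i) else 0) = L q r j := by
  have hmain : HasSum (fun m : ℕ => (-1 : ℝ) ^ (m + j - j) * ((m + j).choose j) * (1 + ((m + j : ℕ) : ℝ) * r / q) *
      q ^ (m + j) / (Nat.factorial (m + j))) (L q r j) := by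
    refine hasSum_of_eq (((((hasSum_exp (-q)).mul_left (1 + j * (r / q))).add
      ((hasSum_mul_exp (-q)).mul_left (r / q)))).mul_left (q ^ j / j.factorial)) (fun m => ?_) ?_
    · have h1 : (((m + j).choose j : ℕ) : ℝ) * j.factorial * m.factorial = (m + j).factorial := by
        have := Nat.choose_mul_factorial_mul_factorial (Nat.le_add_left j m)
        rw [Nat.add_sub_cancel] at this
        exact_mod_cast this
      have h2 : (((m + j).choose j : ℕ) : ℝ) / (m + j).factorial = 1 / (j.factorial * m.factorial) := by
        rw [← h1]
        have : (((m + j).choose j : ℕ) : ℝ) ≠ 0 := by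
          exact_mod_cast (Nat.choose_pos (Nat.le_add_left j m)).ne'
        field_simp
      rw [Nat.add_sub_cancel]
      calc _ = (-1 : ℝ) ^ m * (1 + ((m + j : ℕ) : ℝ) * r / q) * q ^ (m + j) * 
            ((((m + j).choose j : ℕ) : ℝ) / (m + j).factorial) := by ring
        _ = _ := by
          rw [h2, neg_pow q]
          push_cast
          field_simp
          ring
    · unfold L
      rw [hr]; field_simp; ring
  have h := (hasSum_nat_add_iff (f := fun i : ℕ => if j ≤ i then (-1 : ℝ) ^ (i - j) * (i.choose j) * (1 + (i : ℝ) * r / q) *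
      q ^ i / (Nat.factorial i) else 0) j (g := L q r j)).1 (by
        simpa only [Nat.le_add_left, if_true] using hmain)
  rw [h.tsum_eq, Finset.sum_eq_zero, add_zero]
  intro i hi
  rw [if_neg]
  simpa using hi

lemma L_gf {q r : ℝ} (hq : 0 < q) (hr : r = 1 - q) (z : ℝ) :
    HasSum (fun j => L q r j * z ^ j) (Real.exp (-((1 - z) * q)) * (1 - (1 - z) * r)) := by
  refine hasSum_of_eq (((((hasSum_exp (q * z)).mul_left q).add
      ((hasSum_mul_exp (q * z)).mul_left (r / q)))).mul_left (Real.exp (-q))) (fun j => ?_) ?_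
  · unfold L; rw [mul_pow]; ring
  · have : Real.exp (-((1 - z) * q)) = Real.exp (-q) * Real.exp (q * z) := by
      rw [← Real.exp_add]; congr 1; ring
    rw [this, hr]
    field_simp; ring

lemma L_bound {q r : ℝ} (hq : 0 < q) (hq1 : q < 1) (hr : r = 1 - q) (j : ℕ) :
    |L q r j| ≤ q + r / q := by
  have hr0 : 0 < r := by linarith
  unfold L
  rw [abs_of_nonneg (by positivity)]
  have h1 : Real.exp (-q) ≤ 1 := by rw [Real.exp_le_one_iff]; linarith
  refine (mul_le_of_le_one_left (by positivity) h1).trans ?_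
  have h2 : q ^ j ≤ 1 := pow_le_one₀ hq.le hq1.le
  have h3 : (1 : ℝ) ≤ j.factorial := by exact_mod_cast Nat.factorial_pos j
  have h4 : (j : ℝ) ≤ j.factorial := by exact_mod_cast Nat.self_le_factorial j
  rw [div_mul_eq_mul_div, div_le_iff₀ (by linarith)]
  refine (mul_le_of_le_one_left (by positivity) h2).trans ?_
  have : 0 < r / q := by positivity
  nlinarith

lemma pow_floor_tendsto {c : ℝ} (hc : 0 < c) :
    Tendsto (fun n : ℕ => (1 - 2 / (n : ℝ)) ^ ⌊c * (n : ℝ)⌋₊) atTop (nhds (Real.exp (-2 * c))) := by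
  have h0 : Tendsto (fun n : ℕ => (n : ℝ) * Real.log (1 + (-2) / (n : ℝ))) atTop (nhds (-2)) :=
    (Real.tendsto_mul_log_one_add_div_atTop (-2)).comp tendsto_natCast_atTop_atTop
  have h1 : Tendsto (fun n : ℕ => (⌊c * (n : ℝ)⌋₊ : ℝ) / n) atTop (nhds c) :=
    (tendsto_nat_floor_mul_div_atTop hc.le).comp tendsto_natCast_atTop_atTop
  have h2 := (Real.continuous_exp.tendsto _).comp (h0.mul h1)
  refine h2.congr' ?_
  filter_upwards [eventually_ge_atTop 4] with n hn
  have hn' : (4 : ℝ) ≤ n := by exact_mod_cast hn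
  have hp : 0 < 1 + (-2) / (n : ℝ) := by
    have : 2 / (n : ℝ) < 1 := by rw [div_lt_one (by linarith)]; linarith
    rw [neg_div]; linarith
  simp only [Function.comp]
  rw [show (n : ℝ) * Real.log (1 + -2 / n) * (⌊c * (n : ℝ)⌋₊ / n)
    = ⌊c * (n : ℝ)⌋₊ * Real.log (1 + -2 / n) by field_simp]
  rw [Real.exp_nat_mul, Real.exp_log hp, neg_div, ← sub_eq_add_neg]

lemma Ex_gf_tendsto {c : ℝ} (hc : 0 < c) {z : ℝ} (hz : 0 ≤ z) (hz1 : z ≤ 1) :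
    Tendsto (fun n : ℕ => Ex n ⌊c * (n : ℝ)⌋₊ (fun σ => z ^ fixCount σ)) atTop
      (nhds (Real.exp (-((1 - z) * (1 - Real.exp (-2 * c)))) * (1 - (1 - z) * Real.exp (-2 * c)))) := by
  have hp := pow_floor_tendsto hc
  have h1 : Tendsto (fun n : ℕ => Real.exp (-((1 - z) * (1 - (1 - 2 / (n : ℝ)) ^ ⌊c * (n : ℝ)⌋₊))) *
      (1 - (1 - z) * (1 - 2 / (n : ℝ)) ^ ⌊c * (n : ℝ)⌋₊)) atTop 
      (nhds (Real.exp (-((1 - z) * (1 - Real.exp (-2 * c)))) * (1 - (1 - z) * Real.exp (-2 * c)))) := by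
    refine Tendsto.mul ((Real.continuous_exp.tendsto _).comp ?_) ?_
    · exact ((hp.const_sub 1).const_mul _).neg
    · exact (hp.const_mul _).const_sub 1
  have hK : Tendsto (fun n : ℕ => (40 * c * (3 + 28 * c)) / (n : ℝ)) atTop (nhds 0) :=
    tendsto_const_div_atTop_nhds_zero_nat _
  have h2 : Tendsto (fun n : ℕ => Ex n ⌊c * (n : ℝ)⌋₊ (fun σ => z ^ fixCount σ) -
      Real.exp (-((1 - z) * (1 - (1 - 2 / (n : ℝ)) ^ ⌊c * (n : ℝ)⌋₊))) *
      (1 - (1 - z) * (1 - 2 / (n : ℝ)) ^ ⌊c * (n : ℝ)⌋₊)) atTop (nhds 0) := by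
    refine squeeze_zero_norm' ?_ hK
    filter_upwards [eventually_ge_atTop 4] with n hn
    have hn' : (4 : ℝ) ≤ n := by exact_mod_cast hn
    have ht : (⌊c * (n : ℝ)⌋₊ : ℝ) ≤ c * n := Nat.floor_le (by positivity)
    set t := ⌊c * (n : ℝ)⌋₊
    have hnn : (n : ℝ) / (n - 1) ≤ 2 := by rw [div_le_iff₀ (by linarith)]; linarith
    have hn1 : (0 : ℝ) < n - 1 := by linarith
    have h3 := Ex_pow hn (3 + 28 * c) t (fun s hs => (Ex_V hn s).trans (by
      have hs' : (s : ℝ) ≤ c * n := le_trans (by exact_mod_cast hs) ht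
      calc 3 + (s : ℝ) * (14 / (n - 1)) ≤ 3 + c * n * (14 / (n - 1)) := by gcongr
        _ = 3 + 14 * c * (n / (n - 1)) := by ring
        _ ≤ 3 + 14 * c * 2 := by gcongr
        _ = _ := by ring)) z hz hz1
    rw [Real.norm_eq_abs]
    refine h3.trans ?_
    calc (t : ℝ) * (20 / (n * (n - 1)) * (3 + 28 * c)) ≤ c * n * (20 / (n * (n - 1)) * (3 + 28 * c)) := by
          gcongr
      _ = 20 * c * (3 + 28 * c) / n * (n / (n - 1)) := by field_simp
      _ ≤ 20 * c * (3 + 28 * c) / n * 2 := by gcongr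
      _ = _ := by ring
  simpa using h2.add h1

lemma fixCount_le {n : ℕ} (σ : Perm (Fin n)) : fixCount σ ≤ n := by
  have := fixCount_add n σ; omega

end FixWalk

/-- After a random `(n-1)`-cycle and `⌊cn⌋` random transpositions, the probability of
having exactly `j` fixed points converges to
`Σ_{i≥j} (-1)^{i-j} C(i,j) (1 + i e^{-2c}/(1-e^{-2c})) (1-e^{-2c})^i / i!`. -/
theorem fixCount_eq_prob_tendsto (c : ℝ) (hc : 0 < c) (j : ℕ) :
    Filter.Tendsto
      (fun n : ℕ => ∑ σ ∈ Finset.univ.filter (fun σ : Equiv.Perm (Fin n) => fixCount σ = j),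
        walk n 1 ⌊c * (n : ℝ)⌋₊ σ)
      Filter.atTop
      (nhds (∑' i : ℕ, if j ≤ i then
        (-1 : ℝ) ^ (i - j) * (i.choose j) *
          (1 + (i : ℝ) * Real.exp (-2 * c) / (1 - Real.exp (-2 * c))) *
          (1 - Real.exp (-2 * c)) ^ i / (Nat.factorial i) else 0)) := by
  have hr1 : Real.exp (-2 * c) < 1 := by rw [Real.exp_lt_one_iff]; linarith
  have hr0 := Real.exp_pos (-2 * c)
  have hG := fun z h0 h1 => FixWalk.Ex_gf_tendsto hc (z := z) h0 h1
  set r := Real.exp (-2 * c)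
  have hq : 0 < 1 - r := by linarith
  have hrq : r = 1 - (1 - r) := by ring
  rw [FixWalk.L_eq hq hrq j]
  set p : ℕ → ℕ → ℝ := fun n k =>
    ∑ σ ∈ Finset.univ.filter (fun σ : Equiv.Perm (Fin n) => fixCount σ = k),
        walk n 1 ⌊c * (n : ℝ)⌋₊ σ with hp
  have hgf : ∀ n, ∀ z : ℝ, HasSum (fun k => p n k * z ^ k)
      (FixWalk.Ex n ⌊c * (n : ℝ)⌋₊ (fun σ => z ^ fixCount σ)) := by
    intro n z
    have h1 : FixWalk.Ex n ⌊c * (n : ℝ)⌋₊ (fun σ => z ^ fixCount σ)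
        = ∑ k ∈ Finset.range (n + 1), p n k * z ^ k := by
      unfold FixWalk.Ex
      rw [← Finset.sum_fiberwise_of_maps_to (t := Finset.range (n + 1)) (g := fixCount)
        (fun σ _ => Finset.mem_range.2 (Nat.lt_succ_of_le (FixWalk.fixCount_le σ)))]
      refine Finset.sum_congr rfl fun k _ => ?_
      rw [hp, Finset.sum_mul]
      refine Finset.sum_congr rfl fun σ hσ => ?_
      simp only [(Finset.mem_filter.1 hσ).2]
    rw [h1]
    refine hasSum_sum_of_ne_finset_zero fun k hk => ?_
    have : p n k = 0 := by
      rw [hp]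
      refine Finset.sum_eq_zero fun σ hσ => ?_
      exfalso
      have h2 := (Finset.mem_filter.1 hσ).2
      have h3 := FixWalk.fixCount_le σ
      exact hk (Finset.mem_range.2 (by omega))
    rw [this, zero_mul]
  have hpb : ∀ n, 4 ≤ n → ∀ k, |p n k| ≤ 1 := by
    intro n hn k
    have h0 : 0 ≤ p n k := Finset.sum_nonneg fun σ _ => FixWalk.walk_nonneg _ _ _
    rw [abs_of_nonneg h0, ← FixWalk.Ex_const hn ⌊c * (n : ℝ)⌋₊ 1]
    unfold FixWalk.Ex
    simp only [mul_one]
    exact Finset.sum_le_sum_of_subset_of_nonneg (Finset.filter_subset _ _)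
      fun σ _ _ => FixWalk.walk_nonneg _ _ _
  change Tendsto (fun n => p n j) atTop _
  rw [← tendsto_add_atTop_iff_nat 4]
  have key := FixWalk.coeff_tendsto (fun n k => p (n + 4) k - FixWalk.L (1 - r) r k)
    (1 + ((1 - r) + r / (1 - r))) (fun n k => (abs_sub _ _).trans
      (add_le_add (hpb _ (by omega) k) (FixWalk.L_bound hq (by linarith) hrq k))) ?_ j
  · simpa using key.add_const (FixWalk.L (1 - r) r j)
  · intro z h0 h1
    have h2 : ∀ n, ∑' k, (p (n + 4) k - FixWalk.L (1 - r) r k) * z ^ k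
        = FixWalk.Ex (n + 4) ⌊c * ((n + 4 : ℕ) : ℝ)⌋₊ (fun σ => z ^ fixCount σ) -
          Real.exp (-((1 - z) * (1 - r))) * (1 - (1 - z) * r) := by
      intro n
      simp only [sub_mul]
      simpa only [sub_mul] using ((hgf (n + 4) z).sub (FixWalk.L_gf hq hrq z)).tsum_eq
    simp only [h2]
    have h3 := ((tendsto_add_atTop_iff_nat 4).2 (hG z h0.le h1.le)).sub_const
      (Real.exp (-((1 - z) * (1 - r))) * (1 - (1 - z) * r))
    simpa using h3
end

section
/- Fix a real number c > 0 and for each n set t_n = ⌊cn⌋. Then lim_{n→∞} μ_{t_n+1}({σ ∈ S_n : fix(σ) = 0}) = e^{e^{−2c}−1}·(1 − e^{−2c}). -/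
-- Common setup for the random (n-k)-cycle to transpositions walk on the symmetric group.
open Finset Filter Real

open Classical in
/-- cycles agreeing with `φ` on `S` -/
noncomputable def agr {n : ℕ} (φ : Fin n → Fin n) (S : Finset (Fin n)) :
    Finset (Equiv.Perm (Fin n)) :=
  (cycles n 1).filter fun γ => ∀ s ∈ S, γ s = φ s

lemma mem_cycles {n : ℕ} {γ : Equiv.Perm (Fin n)} :
    γ ∈ cycles n 1 ↔ γ.IsCycle ∧ γ.support.card = n - 1 := by
  simp [cycles]

lemma mem_agr {n : ℕ} {φ : Fin n → Fin n} {S : Finset (Fin n)} {γ : Equiv.Perm (Fin n)} :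
    γ ∈ agr φ S ↔ γ ∈ cycles n 1 ∧ ∀ s ∈ S, γ s = φ s := by
  simp [agr]

lemma agr_empty {n : ℕ} (φ : Fin n → Fin n) : agr φ ∅ = cycles n 1 := by
  ext γ; simp [mem_agr]

lemma conj_mem_cycles {n : ℕ} {γ : Equiv.Perm (Fin n)} (h : γ ∈ cycles n 1) (y z : Fin n) :
    Equiv.swap y z * γ * Equiv.swap y z ∈ cycles n 1 := by
  rw [mem_cycles] at h ⊢
  have e : Equiv.swap y z * γ * Equiv.swap y z
      = Equiv.swap y z * γ * (Equiv.swap y z)⁻¹ := by simp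
  rw [e, Equiv.Perm.card_support_conj]
  exact ⟨h.1.conj, h.2⟩

lemma conj_conj {n : ℕ} (γ : Equiv.Perm (Fin n)) (y z : Fin n) :
    Equiv.swap y z * (Equiv.swap y z * γ * Equiv.swap y z) * Equiv.swap y z = γ := by
  ext x; simp

lemma cycles_fixed_unique {n : ℕ} (hn : 1 ≤ n) {γ : Equiv.Perm (Fin n)} (h : γ ∈ cycles n 1) {a b : Fin n}
    (ha : γ a = a) (hb : γ b = b) : a = b := by
  rw [mem_cycles] at h
  have h2 : (γ.supportᶜ).card = 1 := by
    rw [Finset.card_compl, h.2, Fintype.card_fin]; omega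
  rw [Finset.card_eq_one] at h2
  obtain ⟨c, hc⟩ := h2
  have h1 : a ∈ γ.supportᶜ := by simp [ha]
  have h3 : b ∈ γ.supportᶜ := by simp [hb]
  rw [hc] at h1 h3
  simp at h1 h3
  rw [h1, h3]

lemma cycles_fixed_exists {n : ℕ} (hn : 1 ≤ n) {γ : Equiv.Perm (Fin n)} (h : γ ∈ cycles n 1) :
    ∃ a, γ a = a := by
  rw [mem_cycles] at h
  have h2 : (γ.supportᶜ).card = 1 := by
    rw [Finset.card_compl, h.2, Fintype.card_fin]; omega
  rw [Finset.card_eq_one] at h2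
  obtain ⟨c, hc⟩ := h2
  have h1 : c ∈ γ.supportᶜ := by rw [hc]; simp
  exact ⟨c, by simpa using h1⟩

lemma cycles_nonempty {n : ℕ} (hn : 3 ≤ n) : 0 < (cycles n 1).card := by
  obtain ⟨m, rfl⟩ : ∃ m, n = m + 3 := ⟨n - 3, by omega⟩
  rw [Finset.card_pos]
  let i : Fin (m+3) := ⟨m+1, by omega⟩
  have hi : i ≠ 0 := by simp [i, Fin.ext_iff]
  refine ⟨Fin.cycleRange i, mem_cycles.2 ⟨Fin.isCycle_cycleRange hi, ?_⟩⟩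
  have := Fin.cycleType_cycleRange hi
  rw [← Equiv.Perm.sum_cycleType, this]
  simp [i]

/-- an invariant set without fixed points is large -/
lemma invariant_large {n : ℕ} {γ : Equiv.Perm (Fin n)} (h : γ ∈ cycles n 1) (S : Finset (Fin n))
    (hS : S.Nonempty) (hinv : ∀ s ∈ S, γ s ∈ S ∧ γ s ≠ s) : n - 1 ≤ S.card := by
  rw [mem_cycles] at h
  obtain ⟨x, hx⟩ := hS
  rw [← h.2]
  apply Finset.card_le_card
  intro y hy
  have hxs := (hinv x hx).2
  obtain ⟨i, hi⟩ := (h.1.sameCycle hxs (Equiv.Perm.mem_support.1 hy)).exists_nat_pow_eq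
  rw [← hi]
  clear hi
  induction i with
  | zero => simpa using hx
  | succ i ih =>
    rw [pow_succ', Equiv.Perm.mul_apply]
    exact (hinv _ ih).1

/-- the switching map -/
lemma switch_mem {n : ℕ} {φ : Fin n → Fin n} {S : Finset (Fin n)} {x z : Fin n}
    (hx : x ∈ S) (hinj : Set.InjOn φ S)
    (hy : φ x = x ∨ φ x ∉ S) (hz : z ∉ S ∪ S.image φ) {γ : Equiv.Perm (Fin n)}
    (h : γ ∈ cycles n 1) (hag : ∀ s ∈ S.erase x, γ s = φ s) :
    Equiv.swap (φ x) z * γ * Equiv.swap (φ x) z ∈ agr φ (S.erase x) := by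
  rw [mem_agr]
  refine ⟨conj_mem_cycles h _ _, ?_⟩
  intro s hs
  have hs' := Finset.mem_erase.1 hs
  simp only [Finset.mem_union, Finset.mem_image, not_or, not_exists, not_and] at hz
  have h1 : s ≠ φ x := by
    rcases hy with hy | hy
    · rw [hy]; exact hs'.1
    · rintro rfl; exact hy hs'.2
  have h2 : s ≠ z := by rintro rfl; exact hz.1 hs'.2
  have h3 : φ s ≠ φ x := fun e => hs'.1 (hinj hs'.2 hx e)
  have h4 : φ s ≠ z := hz.2 s hs'.2
  simp only [Equiv.Perm.mul_apply]
  rw [Equiv.swap_apply_of_ne_of_ne h1 h2, hag s hs, Equiv.swap_apply_of_ne_of_ne h3 h4]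

open Classical in
lemma switch_le {n : ℕ} (hn : 1 ≤ n) {φ : Fin n → Fin n} {S : Finset (Fin n)} {x : Fin n}
    (hx : x ∈ S) (hinj : Set.InjOn φ S) (hy : φ x = x ∨ φ x ∉ S) :
    (agr φ S).card * ((S ∪ S.image φ)ᶜ).card ≤ (agr φ (S.erase x)).card := by
  rw [← Finset.card_product]
  apply Finset.card_le_card_of_injOn
    (fun q => Equiv.swap (φ x) q.2 * q.1 * Equiv.swap (φ x) q.2)
  · rintro ⟨γ, z⟩ hq
    simp only [Finset.coe_product, Set.mem_prod, Finset.mem_coe] at hq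
    have h1 := mem_agr.1 hq.1
    exact switch_mem hx hinj hy (by simpa using hq.2) h1.1
      (fun s hs => h1.2 s (Finset.mem_of_mem_erase hs))
  · rintro ⟨γ, z⟩ hq ⟨γ', z'⟩ hq' he
    simp only [Finset.coe_product, Set.mem_prod, Finset.mem_coe] at hq hq' he
    have h1 := mem_agr.1 hq.1
    have h1' := mem_agr.1 hq'.1
    have hzz : z = z' := by
      rcases hy with hy | hy
      · have e1 : (Equiv.swap (φ x) z * γ * Equiv.swap (φ x) z) z = z := by
          simp [h1.2 x hx, hy]
        have e2 : (Equiv.swap (φ x) z' * γ' * Equiv.swap (φ x) z') z' = z' := by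
          simp [h1'.2 x hx, hy]
        rw [← he] at e2
        exact cycles_fixed_unique hn (conj_mem_cycles h1.1 _ _) e1 e2
      · have hxy : x ≠ φ x := fun e => hy (e ▸ hx)
        have hxz : x ≠ z := by rintro rfl; have h := hq.2; simp [hx] at h
        have hxz' : x ≠ z' := by rintro rfl; have h := hq'.2; simp [hx] at h
        have e1 : (Equiv.swap (φ x) z * γ * Equiv.swap (φ x) z) x = z := by
          simp [h1.2 x hx, Equiv.swap_apply_of_ne_of_ne hxy hxz]
        have e2 : (Equiv.swap (φ x) z' * γ' * Equiv.swap (φ x) z') x = z' := by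
          simp [h1'.2 x hx, Equiv.swap_apply_of_ne_of_ne hxy hxz']
        rw [← e1, he, e2]
    subst hzz
    have := congrArg (fun g => Equiv.swap (φ x) z * g * Equiv.swap (φ x) z) he
    simp only [conj_conj] at this
    rw [this]

open Classical in
lemma switch_ge {n : ℕ} {φ : Fin n → Fin n} {S : Finset (Fin n)} {x : Fin n}
    (hx : x ∈ S) (hinj : Set.InjOn φ S) (hy : φ x ∉ S) :
    (agr φ (S.erase x)).card ≤ (agr φ S).card * ((S ∪ S.image φ)ᶜ).card
      + ∑ w ∈ S ∪ S.image φ, (agr (Function.update φ x w) S).card := by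
  have hsplit : (agr φ (S.erase x)) ⊆
      ((agr φ S ×ˢ (S ∪ S.image φ)ᶜ).image
        (fun q => Equiv.swap (φ x) q.2 * q.1 * Equiv.swap (φ x) q.2)) ∪
      (S ∪ S.image φ).biUnion (fun w => agr (Function.update φ x w) S) := by
    intro γ hγ
    have h1 := mem_agr.1 hγ
    rw [Finset.mem_union]
    by_cases hw : γ x ∈ S ∪ S.image φ
    · right
      rw [Finset.mem_biUnion]
      refine ⟨γ x, hw, mem_agr.2 ⟨h1.1, ?_⟩⟩
      intro s hs
      by_cases hsx : s = x
      · subst hsx; simp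
      · rw [Function.update_of_ne hsx]; exact h1.2 s (Finset.mem_erase.2 ⟨hsx, hs⟩)
    · left
      rw [Finset.mem_image]
      refine ⟨(Equiv.swap (φ x) (γ x) * γ * Equiv.swap (φ x) (γ x), γ x), ?_, conj_conj _ _ _⟩
      rw [Finset.mem_product]
      refine ⟨?_, by simpa using hw⟩
      have h2 := switch_mem hx hinj (Or.inr hy) hw h1.1 h1.2
      have h3 := mem_agr.1 h2
      refine mem_agr.2 ⟨h3.1, ?_⟩
      intro s hs
      by_cases hsx : s = x
      · subst hsx
        have hxy : s ≠ φ s := fun e => hy (e ▸ hx)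
        have hxz : s ≠ γ s := by intro e; exact hw (Finset.mem_union_left _ (e ▸ hx))
        simp [Equiv.swap_apply_of_ne_of_ne hxy hxz]
      · exact h3.2 s (Finset.mem_erase.2 ⟨hsx, hs⟩)
  refine (Finset.card_le_card hsplit).trans ((Finset.card_union_le _ _).trans ?_)
  gcongr
  · exact Finset.card_image_le.trans (by rw [Finset.card_product])
  · exact Finset.card_biUnion_le

lemma card_U_le {n : ℕ} (φ : Fin n → Fin n) (S : Finset (Fin n)) :
    (S ∪ S.image φ).card ≤ 2 * S.card := by
  have := Finset.card_union_le S (S.image φ)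
  have := Finset.card_image_le (s := S) (f := φ)
  omega

lemma agr_ub {n : ℕ} (hn : 1 ≤ n) (k : ℕ) : ∀ (j : ℕ) (φ : Fin n → Fin n) (S : Finset (Fin n)),
    S.card = j → j ≤ k → (agr φ S).card * (n - 2 * k) ^ j ≤ (cycles n 1).card := by
  intro j
  induction j with
  | zero =>
    intro φ S hS _
    rw [Finset.card_eq_zero] at hS
    subst hS
    simp [agr_empty]
  | succ j ih =>
    intro φ S hS hjk
    rcases Nat.lt_or_ge (2 * k) n with hk | hk
    swap
    · have : n - 2 * k = 0 := by omega
      simp [this]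
    rcases (agr φ S).eq_empty_or_nonempty with he | ⟨γ, hγ⟩
    · simp [he]
    have h1 := mem_agr.1 hγ
    have hinj : Set.InjOn φ S := by
      intro a ha b hb hab
      apply γ.injective
      rw [h1.2 a ha, h1.2 b hb, hab]
    obtain ⟨x, hx, hy⟩ : ∃ x ∈ S, φ x = x ∨ φ x ∉ S := by
      by_contra hcon
      push Not at hcon
      have := invariant_large h1.1 S (Finset.card_pos.1 (by omega)) (by
        intro s hs
        rw [h1.2 s hs]
        exact ⟨(hcon s hs).2, (hcon s hs).1⟩)
      omega
    have h2 := switch_le hn hx hinj hy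
    have h3 := ih φ (S.erase x) (by rw [Finset.card_erase_of_mem hx]; omega) (by omega)
    have h4 : n - 2 * k ≤ ((S ∪ S.image φ)ᶜ).card := by
      rw [Finset.card_compl, Fintype.card_fin]
      have := card_U_le φ S
      omega
    calc (agr φ S).card * (n - 2 * k) ^ (j+1)
        = ((agr φ S).card * (n - 2*k)) * (n - 2 * k)^j := by ring
      _ ≤ ((agr φ S).card * ((S ∪ S.image φ)ᶜ).card) * (n - 2 * k)^j := by gcongr
      _ ≤ (agr φ (S.erase x)).card * (n - 2 * k)^j := by gcongr
      _ ≤ _ := h3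

lemma agr_single {n : ℕ} (hn : 1 ≤ n) (φ : Fin n → Fin n) (x : Fin n) (hx : φ x = x) :
    (cycles n 1).card ≤ (agr φ {x}).card * n := by
  have hsub : cycles n 1 ⊆ ((agr φ {x}) ×ˢ (Finset.univ : Finset (Fin n))).image
        (fun q => Equiv.swap x q.2 * q.1 * Equiv.swap x q.2) := by
    intro γ hγ
    obtain ⟨z, hz⟩ := cycles_fixed_exists hn hγ
    rw [Finset.mem_image]
    refine ⟨(Equiv.swap x z * γ * Equiv.swap x z, z), ?_, conj_conj _ _ _⟩
    rw [Finset.mem_product]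
    refine ⟨mem_agr.2 ⟨conj_mem_cycles hγ _ _, ?_⟩, Finset.mem_univ _⟩
    intro s hs
    rw [Finset.mem_singleton] at hs
    subst hs
    simp [hz, hx]
  refine (Finset.card_le_card hsub).trans (Finset.card_image_le.trans ?_)
  rw [Finset.card_product]; simp

/-- probability of agreement -/
noncomputable def pr {n : ℕ} (φ : Fin n → Fin n) (S : Finset (Fin n)) : ℝ :=
  ((agr φ S).card : ℝ) / ((cycles n 1).card : ℝ)

/-- generic sets -/
def Gen {n : ℕ} (φ : Fin n → Fin n) (S : Finset (Fin n)) : Prop :=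
  Set.InjOn φ S ∧ (∀ x ∈ S, φ x = x ∨ φ x ∉ S) ∧
    (∀ x ∈ S, ∀ y ∈ S, φ x = x → φ y = y → x = y)

lemma Gen.erase {n : ℕ} {φ : Fin n → Fin n} {S : Finset (Fin n)} (h : Gen φ S) (x : Fin n) :
    Gen φ (S.erase x) := by
  refine ⟨h.1.mono (by simp), ?_, ?_⟩
  · intro y hy
    rcases h.2.1 y (Finset.mem_of_mem_erase hy) with h1 | h1
    · exact Or.inl h1
    · exact Or.inr fun h2 => h1 (Finset.mem_of_mem_erase h2)
  · intro a ha b hb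
    exact h.2.2 a (Finset.mem_of_mem_erase ha) b (Finset.mem_of_mem_erase hb)

lemma pr_nonneg {n : ℕ} (φ : Fin n → Fin n) (S : Finset (Fin n)) : 0 ≤ pr φ S := by
  unfold pr; positivity

lemma pr_ub {n : ℕ} (hn : 3 ≤ n) (k : ℕ) (hk : 2 * k < n) (φ : Fin n → Fin n)
    (S : Finset (Fin n)) (hS : S.card ≤ k) : pr φ S * ((n:ℝ) - 2 * k) ^ S.card ≤ 1 := by
  have h := agr_ub (by omega : 1 ≤ n) k S.card φ S rfl hS
  have hc := cycles_nonempty hn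
  have h' : ((agr φ S).card : ℝ) * ((n:ℝ) - 2 * k) ^ S.card ≤ (cycles n 1).card := by
    have h2 : (((agr φ S).card * (n - 2 * k) ^ S.card : ℕ) : ℝ) ≤ ((cycles n 1).card : ℝ) := by
      exact_mod_cast h
    push_cast [Nat.cast_sub hk.le] at h2
    exact h2
  unfold pr
  rw [div_mul_eq_mul_div, div_le_one (by exact_mod_cast hc)]
  exact h'

lemma pr_empty {n : ℕ} (hn : 3 ≤ n) (φ : Fin n → Fin n) : pr φ ∅ = 1 := by
  have hc := cycles_nonempty hn
  unfold pr
  rw [agr_empty, div_self]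
  exact_mod_cast hc.ne'

lemma pr_step {n : ℕ} (hn : 3 ≤ n) (k : ℕ) (hk : 4 * k ≤ n) {φ : Fin n → Fin n}
    {S : Finset (Fin n)} (hS : S.card ≤ k) {x : Fin n}
    (hx : x ∈ S) (hinj : Set.InjOn φ S) (hy : φ x ∉ S) :
    pr φ (S.erase x) ≤ pr φ S * n + 2 * k * (2 / n) ^ S.card := by
  have hc := cycles_nonempty hn
  have hc' : (0:ℝ) < (cycles n 1).card := by exact_mod_cast hc
  have h := switch_ge hx hinj hy
  have hn0 : (0:ℝ) < n := by exact_mod_cast (by omega : 0 < n)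
  have hkn : (4 * k : ℝ) ≤ n := by exact_mod_cast hk
  have h1 : ∀ w, pr (Function.update φ x w) S ≤ (2 / (n:ℝ)) ^ S.card := by
    intro w
    have := pr_ub hn k (by omega) (Function.update φ x w) S hS
    have h2 : ((n:ℝ)/2) ^ S.card ≤ ((n:ℝ) - 2 * k)^S.card := by
      gcongr; linarith
    have h3 : pr (Function.update φ x w) S * ((n:ℝ)/2) ^ S.card ≤ 1 :=
      le_trans (mul_le_mul_of_nonneg_left h2 (pr_nonneg _ _)) this
    rw [← le_div_iff₀ (by positivity)] at h3
    refine h3.trans_eq ?_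
    rw [div_pow, div_pow, one_div_div]
  have h4 : pr φ (S.erase x) ≤ pr φ S * ((S ∪ S.image φ)ᶜ).card
      + ∑ w ∈ S ∪ S.image φ, pr (Function.update φ x w) S := by
    unfold pr
    rw [← Finset.sum_div, div_mul_eq_mul_div, ← add_div]
    gcongr
    exact_mod_cast h
  refine h4.trans ?_
  gcongr
  · exact pr_nonneg _ _
  · have := Finset.card_le_univ ((S ∪ S.image φ)ᶜ)
    simpa using this
  · refine (Finset.sum_le_card_nsmul _ _ _ (fun w _ => h1 w)).trans ?_
    rw [nsmul_eq_mul]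
    gcongr
    have := card_U_le φ S
    exact_mod_cast (by omega : (S ∪ S.image φ).card ≤ 2 * k)

lemma pr_lb {n : ℕ} (hn : 3 ≤ n) (k : ℕ) (hk : 4 * k ≤ n) {φ : Fin n → Fin n} : ∀ (j : ℕ)
    (S : Finset (Fin n)), S.card = j → j ≤ k → Gen φ S →
    1 - j * (2 * k * 2 ^ k / n) ≤ pr φ S * (n:ℝ) ^ j := by
  have hc := cycles_nonempty hn
  have hc' : (0:ℝ) < (cycles n 1).card := by exact_mod_cast hc
  have hn0 : (0:ℝ) < n := by exact_mod_cast (by omega : 0 < n)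
  intro j
  induction j with
  | zero =>
    intro S hS _ _
    rw [Finset.card_eq_zero] at hS
    subst hS
    simp [pr_empty hn]
  | succ j ih =>
    intro S hS hj hg
    by_cases hex : ∃ x ∈ S, φ x ≠ x
    · obtain ⟨x, hx, hxx⟩ := hex
      have hy := (hg.2.1 x hx).resolve_left hxx
      have h1 := pr_step hn k hk (by omega) hx hg.1 hy
      have h2 := ih (S.erase x) (by rw [Finset.card_erase_of_mem hx]; omega) (by omega) (hg.erase x)
      rw [hS] at h1
      have h3 : pr φ (S.erase x) * (n:ℝ)^j ≤ (pr φ S * n + 2 * k * (2 / n) ^ (j+1)) * (n:ℝ)^j := by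
        gcongr
      have h4 : (2 * k * (2 / (n:ℝ)) ^ (j+1)) * (n:ℝ)^j = 2 * k * 2^(j+1) / n := by
        rw [div_pow, pow_succ (n:ℝ) j]; field_simp
      have h5 : (2 * k * 2^(j+1) / n : ℝ) ≤ 2 * k * 2^k / n := by
        gcongr
        norm_num
      have h6 : (pr φ S * n + 2 * k * (2 / n) ^ (j+1)) * (n:ℝ)^j
        = pr φ S * (n:ℝ)^(j+1) + (2 * k * (2 / (n:ℝ)) ^ (j+1)) * (n:ℝ)^j := by ring
      push_cast
      linarith
    · push Not at hex
      have hle : S.card ≤ 1 := Finset.card_le_one.2 fun a ha b hb =>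
        hg.2.2 a ha b hb (hex a ha) (hex b hb)
      have hj0 : j = 0 := by omega
      subst hj0
      obtain ⟨x, rfl⟩ := Finset.card_eq_one.1 hS
      have h1 := agr_single (by omega) φ x (hex x (by simp))
      have h2 : 1 ≤ pr φ {x} * (n:ℝ) ^ (0+1) := by
        unfold pr
        rw [div_mul_eq_mul_div, le_div_iff₀ hc']
        simp only [one_mul, zero_add, pow_one]
        exact_mod_cast h1
      have h3 : (0:ℝ) ≤ ((0+1 : ℕ):ℝ) * (2 * k * 2 ^ k / n) := by positivity
      exact le_trans (sub_le_self _ h3) h2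

lemma pr_key (k : ℕ) (ε : ℝ) (hε : 0 < ε) : ∀ᶠ n : ℕ in atTop, ∀ (φ : Fin n → Fin n)
    (S : Finset (Fin n)), S.card = k → pr φ S * (n:ℝ)^k ≤ 1 + ε ∧
      (Gen φ S → 1 - ε ≤ pr φ S * (n:ℝ)^k) := by
  have hinv : Tendsto (fun n : ℕ => 1 / (n:ℝ)) atTop (nhds 0) := tendsto_one_div_atTop_nhds_zero_nat
  have t1 : Tendsto (fun n : ℕ => (1 - 2 * k * (1 / (n:ℝ)))^k * (1 + ε)) atTop
      (nhds ((1 - 2 * k * 0)^k * (1 + ε))) :=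
    ((tendsto_const_nhds.sub (hinv.const_mul _)).pow k).mul_const _
  have t2 : Tendsto (fun n : ℕ => k * (2 * k * 2^k) * (1 / (n:ℝ))) atTop
      (nhds (k * (2 * k * 2^k) * 0)) := hinv.const_mul _
  have e1 := t1.eventually (eventually_gt_nhds (b := 1) (by simp; exact hε))
  have e2 := t2.eventually (eventually_lt_nhds (b := ε) (by simpa using hε))
  filter_upwards [e1, e2, eventually_ge_atTop (4 * k + 3)] with n h1 h2 h3
  have hn0 : (0:ℝ) < n := by exact_mod_cast (by omega : 0 < n)
  intro φ S hS
  constructor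
  · have h := pr_ub (by omega) k (by omega) φ S hS.le
    rw [hS] at h
    have hk : (4 * k : ℝ) ≤ n := by exact_mod_cast (by omega : 4 * k ≤ n)
    have h4 : ((n:ℝ) - 2 * k)^k = (1 - 2 * k * (1 / (n:ℝ)))^k * (n:ℝ)^k := by
      rw [← mul_pow]; congr 1; field_simp
    set A := (1 - 2 * k * (1 / (n:ℝ)))^k with hA
    have hA0 : 0 < A := by
      by_contra hcon
      push Not at hcon
      nlinarith
    rw [h4] at h
    by_contra hcon
    push Not at hcon
    have : A * (1 + ε) < A * (pr φ S * (n:ℝ)^k) := by gcongr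
    nlinarith
  · intro hg
    have := pr_lb (by omega) k (by omega) k S hS le_rfl hg
    have h5 : k * (2 * k * 2^k) * (1 / (n:ℝ)) = k * (2 * k * 2 ^ k / n) := by ring
    linarith

/-- limiting binomial moments -/
noncomputable def LL : ℕ → ℝ → ℝ
  | 0, _ => 1
  | j + 1, u => (1 - u) ^ (j+1) / (j+1).factorial + u * ((1 - u) ^ j / j.factorial)

lemma choose_approx {n a : ℕ} (hn : 0 < n) (ha : a ≤ n) (k : ℕ) :
    |(a.choose k : ℝ) / (n:ℝ)^k - ((a:ℝ)/n)^k / k.factorial| ≤ (k:ℝ)^2 / n := by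
  have hn0 : (0:ℝ) < n := by exact_mod_cast hn
  have ha' : (a:ℝ) ≤ n := by exact_mod_cast ha
  have main : ∀ k : ℕ, (a.descFactorial k : ℝ) ≤ (a:ℝ)^k ∧
      ((a:ℝ)^k - a.descFactorial k) * n ≤ (k:ℝ)^2 * (n:ℝ)^k := by
    intro k
    induction k with
    | zero => simp
    | succ k ih =>
      have hd : (a.descFactorial (k+1) : ℝ) = ((a:ℝ) - k) * a.descFactorial k := by
        rw [Nat.descFactorial_succ]
        rcases Nat.lt_or_ge a k with h | h
        · rw [Nat.descFactorial_eq_zero_iff_lt.2 h]; simp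
        · push_cast [Nat.cast_sub h]; ring
      have hdn : (0:ℝ) ≤ a.descFactorial k := by positivity
      have hkn : (0:ℝ) ≤ k := by positivity
      have han : (0:ℝ) ≤ a := by positivity
      obtain ⟨i1, i2⟩ := ih
      have hp : (a:ℝ)^k ≤ (n:ℝ)^k := by gcongr
      rw [hd]
      constructor
      · rw [pow_succ]
        nlinarith [mul_nonneg hkn hdn, mul_nonneg han (sub_nonneg.2 i1)]
      · have e : ((a:ℝ)^(k+1) - (a - k) * a.descFactorial k) * n
          = a * (((a:ℝ)^k - a.descFactorial k) * n) + k * a.descFactorial k * n := by ring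
        rw [e]
        have s1 : a * (((a:ℝ)^k - a.descFactorial k) * n) ≤ n * ((k:ℝ)^2 * (n:ℝ)^k) := by
          have h0 : 0 ≤ (((a:ℝ)^k - a.descFactorial k) * n) :=
            mul_nonneg (sub_nonneg.2 i1) hn0.le
          gcongr
        have s2 : k * (a.descFactorial k : ℝ) * n ≤ k * (n:ℝ)^k * n := by
          gcongr; exact i1.trans hp
        have s3 : 0 ≤ ((k:ℝ) + 1) * ((n:ℝ)^k * n) := by positivity
        push_cast
        rw [pow_succ (n:ℝ)]
        nlinarith
  obtain ⟨m1, m2⟩ := main k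
  have hf : (a.descFactorial k : ℝ) = k.factorial * a.choose k := by
    exact_mod_cast Nat.descFactorial_eq_factorial_mul_choose a k
  have hk : (1:ℝ) ≤ k.factorial := by exact_mod_cast Nat.factorial_pos k
  have e : (a.choose k : ℝ) / (n:ℝ)^k - ((a:ℝ)/n)^k / k.factorial
      = - (((a:ℝ)^k - a.descFactorial k) / ((n:ℝ)^k * k.factorial)) := by
    rw [hf, div_pow]; field_simp; ring
  rw [e, abs_neg, abs_of_nonneg (div_nonneg (sub_nonneg.2 m1) (by positivity)),
    div_le_div_iff₀ (by positivity) hn0]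
  refine m2.trans ?_
  have : (n:ℝ)^k ≤ (n:ℝ)^k * k.factorial := le_mul_of_one_le_right (by positivity) hk
  gcongr

lemma count_le_one {n : ℕ} (F : Finset (Fin n)) (j : ℕ) :
    ((Finset.powersetCard (j+1) Finset.univ).filter
      (fun S : Finset (Fin n) => (S ∩ F).card ≤ 1)).card
    = (n - F.card).choose (j+1) + F.card * (n - F.card).choose j := by
  have e : ((Finset.powersetCard (j+1) Finset.univ).filter
      (fun S : Finset (Fin n) => (S ∩ F).card ≤ 1))
      = Finset.powersetCard (j+1) Fᶜ ∪
        (F ×ˢ Finset.powersetCard j Fᶜ).image (fun q => insert q.1 q.2) := by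
    ext S
    simp only [Finset.mem_filter, Finset.mem_powersetCard, Finset.subset_univ, true_and,
      Finset.mem_union, Finset.mem_image, Finset.mem_product, Prod.exists]
    constructor
    · rintro ⟨hS, h1⟩
      by_cases h0 : (S ∩ F) = ∅
      · left
        refine ⟨?_, hS⟩
        intro x hx
        rw [Finset.mem_compl]
        intro hxF
        have : x ∈ S ∩ F := Finset.mem_inter.2 ⟨hx, hxF⟩
        simp [h0] at this
      · right
        have : (S ∩ F).card = 1 := by
          have := Finset.card_pos.2 (Finset.nonempty_iff_ne_empty.2 h0)
          omega
        obtain ⟨x, hx⟩ := Finset.card_eq_one.1 this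
        have hxm : x ∈ S ∩ F := by simp [hx]
        have hxm' := Finset.mem_inter.1 hxm
        refine ⟨x, S.erase x, ⟨hxm'.2, ?_, ?_⟩, Finset.insert_erase hxm'.1⟩
        · intro y hy
          rw [Finset.mem_compl]
          intro hyF
          have hy' := Finset.mem_erase.1 hy
          have : y ∈ S ∩ F := Finset.mem_inter.2 ⟨hy'.2, hyF⟩
          rw [hx, Finset.mem_singleton] at this
          exact hy'.1 this
        · rw [Finset.card_erase_of_mem hxm'.1]; omega
    · rintro (⟨h1, h2⟩ | ⟨x, T, ⟨hx, hT, hTc⟩, rfl⟩)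
      · refine ⟨h2, ?_⟩
        have : S ∩ F = ∅ := by
          rw [← Finset.disjoint_iff_inter_eq_empty]
          exact Finset.disjoint_left.2 fun a ha hb => Finset.mem_compl.1 (h1 ha) hb
        simp [this]
      · have hxT : x ∉ T := fun h => Finset.mem_compl.1 (hT h) hx
        refine ⟨by rw [Finset.card_insert_of_notMem hxT, hTc], ?_⟩
        have : insert x T ∩ F ⊆ {x} := by
          intro y hy
          rw [Finset.mem_inter, Finset.mem_insert] at hy
          rcases hy.1 with h | h
          · simp [h]
          · exact absurd hy.2 (Finset.mem_compl.1 (hT h))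
        exact (Finset.card_le_card this).trans (by simp)
  rw [e, Finset.card_union_of_disjoint, Finset.card_image_of_injOn, Finset.card_product]
  · simp [Finset.card_compl]
  · rintro ⟨x, T⟩ h ⟨x', T'⟩ h' he
    simp only [Finset.coe_product, Set.mem_prod, Finset.mem_coe, Finset.mem_powersetCard] at h h' he
    have hxT : ∀ y ∈ F, y ∉ T := fun y hy hh => Finset.mem_compl.1 (h.2.1 hh) hy
    have hxT' : ∀ y ∈ F, y ∉ T' := fun y hy hh => Finset.mem_compl.1 (h'.2.1 hh) hy
    have hxx : x = x' := by
      have : x ∈ insert x' T' := by rw [← he]; simp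
      rw [Finset.mem_insert] at this
      exact this.resolve_right (hxT' x h.1)
    subst hxx
    have : T = T' := by
      rw [← Finset.erase_insert (hxT x h.1), he, Finset.erase_insert (hxT' x h.1)]
    rw [this]
  · rw [Finset.disjoint_left]
    intro S hS hS'
    simp only [Finset.mem_powersetCard, Finset.mem_image, Finset.mem_product, Prod.exists] at hS hS'
    obtain ⟨x, T, ⟨hx, _⟩, rfl⟩ := hS'
    exact Finset.mem_compl.1 (hS.1 (Finset.mem_insert_self x T)) hx

open Classical in
lemma count_bad {n : ℕ} (hn : 1 ≤ n) (ρ : Equiv.Perm (Fin n)) (k : ℕ) :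
    (((Finset.powersetCard k Finset.univ).filter
      (fun S : Finset (Fin n) => ∃ x ∈ S, ρ x ∈ S ∧ ρ x ≠ x)).card : ℝ) / (n:ℝ)^k ≤ 1 / n := by
  have hn0 : (0:ℝ) < n := by exact_mod_cast hn
  rcases Nat.lt_or_ge k 2 with hk | hk
  · have : ((Finset.powersetCard k Finset.univ).filter
      (fun S : Finset (Fin n) => ∃ x ∈ S, ρ x ∈ S ∧ ρ x ≠ x)) = ∅ := by
      apply Finset.filter_eq_empty_iff.2
      rintro S hS ⟨x, hx, h1, h2⟩
      rw [Finset.mem_powersetCard] at hS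
      exact h2 (Finset.card_le_one.1 (by omega) _ h1 _ hx)
    rw [this]; simp
  · obtain ⟨j, rfl⟩ : ∃ j, k = j + 2 := ⟨k - 2, by omega⟩
    have hsub : ((Finset.powersetCard (j+2) Finset.univ).filter
      (fun S : Finset (Fin n) => ∃ x ∈ S, ρ x ∈ S ∧ ρ x ≠ x)) ⊆
      ((Finset.univ : Finset (Fin n)) ×ˢ Finset.powersetCard j Finset.univ).image
        (fun q => insert q.1 (insert (ρ q.1) q.2)) := by
      intro S hS
      simp only [Finset.mem_filter, Finset.mem_powersetCard] at hS
      obtain ⟨⟨_, hc⟩, x, hx, h1, h2⟩ := hS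
      rw [Finset.mem_image]
      have h3 : ρ x ∈ S.erase x := Finset.mem_erase.2 ⟨h2, h1⟩
      refine ⟨(x, (S.erase x).erase (ρ x)), ?_, ?_⟩
      · simp only [Finset.mem_product, Finset.mem_univ, true_and, Finset.mem_powersetCard,
          Finset.subset_univ]
        rw [Finset.card_erase_of_mem h3, Finset.card_erase_of_mem hx]; omega
      · simp only
        rw [Finset.insert_erase h3, Finset.insert_erase hx]
    have h1 := (Finset.card_le_card hsub).trans Finset.card_image_le
    rw [Finset.card_product, Finset.card_powersetCard, Finset.card_univ, Fintype.card_fin] at h1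
    have h2 := Nat.choose_le_pow n j
    have h3 : ((Finset.powersetCard (j+2) Finset.univ).filter
      (fun S : Finset (Fin n) => ∃ x ∈ S, ρ x ∈ S ∧ ρ x ≠ x)).card ≤ n * n ^ j :=
      h1.trans (Nat.mul_le_mul_left _ h2)
    rw [div_le_div_iff₀ (by positivity) hn0]
    calc _ ≤ ((n * n ^ j : ℕ) : ℝ) * n := by gcongr
      _ = _ := by push_cast; ring

lemma fixCount_le {n : ℕ} (ρ : Equiv.Perm (Fin n)) : fixCount ρ ≤ n := by
  unfold fixCount
  exact (Finset.card_le_univ _).trans (by simp)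

lemma count_approx {n f j : ℕ} (hn : 0 < n) (hf : f ≤ n) :
    |(((n - f).choose (j+1) + f * (n - f).choose j : ℕ) : ℝ) / (n:ℝ)^(j+1) - LL (j+1) ((f:ℝ)/n)|
      ≤ (((j:ℝ)+1)^2 + (j:ℝ)^2) / n := by
  have hn0 : (0:ℝ) < n := by exact_mod_cast hn
  have hf' : (f:ℝ) ≤ n := by exact_mod_cast hf
  have h1 := choose_approx hn (Nat.sub_le n f) (j+1)
  have h2 := choose_approx hn (Nat.sub_le n f) j
  have e : ((n - f : ℕ) : ℝ) / n = 1 - (f:ℝ)/n := by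
    push_cast [Nat.cast_sub hf]; field_simp
  rw [e] at h1 h2
  have hfn : (f:ℝ)/n ≤ 1 := by rw [div_le_one hn0]; exact hf'
  have hfn0 : 0 ≤ (f:ℝ)/n := by positivity
  have e2 : (((n - f).choose (j+1) + f * (n - f).choose j : ℕ) : ℝ) / (n:ℝ)^(j+1) - LL (j+1) ((f:ℝ)/n)
    = (((n - f).choose (j+1) : ℝ) / (n:ℝ)^(j+1) - (1 - (f:ℝ)/n)^(j+1) / (j+1).factorial) +
      (f:ℝ)/n * (((n - f).choose j : ℝ) / (n:ℝ)^j - (1 - (f:ℝ)/n)^j / j.factorial) := by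
    simp only [LL]
    push_cast
    rw [add_div, pow_succ (n:ℝ) j]
    have : (f:ℝ) * ((n - f).choose j : ℝ) / ((n:ℝ)^j * n)
      = (f:ℝ)/n * (((n - f).choose j : ℝ) / (n:ℝ)^j) := by
      rw [div_mul_div_comm, mul_comm (n:ℝ)]
    rw [this]; ring
  rw [e2]
  refine (abs_add_le _ _).trans ?_
  rw [abs_mul, abs_of_nonneg hfn0, add_div]
  push_cast at h1
  refine add_le_add h1 ?_
  calc _ ≤ 1 * ((j:ℝ)^2/n) := by gcongr
    _ = _ := one_mul _

lemma pr_two_fixed {n : ℕ} (hn : 1 ≤ n) (ρ : Equiv.Perm (Fin n)) (S : Finset (Fin n))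
    {a b : Fin n} (ha : a ∈ S) (hb : b ∈ S) (hab : a ≠ b) (ha' : ρ a = a) (hb' : ρ b = b) :
    pr ρ S = 0 := by
  have : agr ρ S = ∅ := by
    rw [Finset.eq_empty_iff_forall_notMem]
    intro γ hγ
    have h := mem_agr.1 hγ
    exact hab (cycles_fixed_unique hn h.1 ((h.2 a ha).trans ha') ((h.2 b hb).trans hb'))
  unfold pr
  simp [this]

open Classical in
lemma moment_approx (k : ℕ) (ε : ℝ) (hε : 0 < ε) : ∀ᶠ n : ℕ in atTop, ∀ ρ : Equiv.Perm (Fin n),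
    |∑ S ∈ Finset.powersetCard k Finset.univ, pr ρ S - LL k ((fixCount ρ : ℝ) / n)| ≤ ε := by
  cases k with
  | zero =>
    filter_upwards [eventually_ge_atTop 3] with n hn ρ
    simp [LL, pr_empty hn, hε.le]
  | succ j =>
  set δ : ℝ := min 1 (ε / 3) with hδ
  have hδ0 : 0 < δ := by positivity
  have hδ1 : δ ≤ 1 := min_le_left _ _
  have hδε : δ ≤ ε / 3 := min_le_right _ _
  have hinv : Tendsto (fun n : ℕ => 1 / (n:ℝ)) atTop (nhds 0) := tendsto_one_div_atTop_nhds_zero_nat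
  have t2 : Tendsto (fun n : ℕ => (((j:ℝ)+1)^2 + (j:ℝ)^2 + 2) * (1 / (n:ℝ))) atTop
      (nhds ((((j:ℝ)+1)^2 + (j:ℝ)^2 + 2) * 0)) := hinv.const_mul _
  have e2 := t2.eventually (eventually_lt_nhds (b := ε / 3) (by simpa using hε))
  filter_upwards [pr_key (j+1) δ hδ0, e2, eventually_ge_atTop 3] with n hkey hn2 hn ρ
  have hn0 : (0:ℝ) < n := by exact_mod_cast (by omega : 0 < n)
  have hp0 : (0:ℝ) < (n:ℝ)^(j+1) := by positivity
  set F : Finset (Fin n) := Finset.univ.filter (fun i => ρ i = i) with hF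
  have hFc : F.card = fixCount ρ := rfl
  set P := Finset.powersetCard (j+1) (Finset.univ : Finset (Fin n)) with hP
  have hpt : ∀ S ∈ P, |pr ρ S - (if (S ∩ F).card ≤ 1 then 1 else 0) / (n:ℝ)^(j+1)| ≤
      (δ + 2 * (if (∃ x ∈ S, ρ x ∈ S ∧ ρ x ≠ x) then 1 else 0)) / (n:ℝ)^(j+1) := by
    intro S hS
    rw [hP, Finset.mem_powersetCard] at hS
    obtain ⟨k1, k2⟩ := hkey ρ S hS.2
    have k0 := mul_nonneg (pr_nonneg ρ S) hp0.le
    split_ifs with h1 h2 h2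
    · rw [le_div_iff₀ hp0, ← abs_of_pos hp0, ← abs_mul, abs_of_pos hp0, sub_mul,
        div_mul_cancel₀ _ hp0.ne', abs_le]
      constructor <;> linarith
    · have hg : Gen ρ S := by
        refine ⟨ρ.injective.injOn, ?_, ?_⟩
        · intro x hx
          by_contra hcon
          push Not at hcon
          exact h2 ⟨x, hx, hcon.2, hcon.1⟩
        · intro x hx y hy hx' hy'
          refine Finset.card_le_one.1 h1 x ?_ y ?_
          · simp [hF, hx, hx']
          · simp [hF, hy, hy']
      have k3 := k2 hg
      rw [le_div_iff₀ hp0, ← abs_of_pos hp0, ← abs_mul, abs_of_pos hp0, sub_mul,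
        div_mul_cancel₀ _ hp0.ne', abs_le]
      constructor <;> linarith
    all_goals
      have h3 : pr ρ S = 0 := by
        push Not at h1
        obtain ⟨a, ha, b, hb, hab⟩ := Finset.one_lt_card.1 h1
        simp only [Finset.mem_inter, hF, Finset.mem_filter, Finset.mem_univ, true_and] at ha hb
        exact pr_two_fixed (by omega) ρ S ha.1 hb.1 hab ha.2 hb.2
      rw [h3]
      simp
      positivity
  have hsum : |∑ S ∈ P, pr ρ S - ((P.filter (fun S => (S ∩ F).card ≤ 1)).card : ℝ) / (n:ℝ)^(j+1)|
      ≤ δ + 2 * (1 / n) := by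
    have e1 : ((P.filter (fun S => (S ∩ F).card ≤ 1)).card : ℝ) / (n:ℝ)^(j+1)
        = ∑ S ∈ P, (if (S ∩ F).card ≤ 1 then 1 else 0) / (n:ℝ)^(j+1) := by
      rw [← Finset.sum_div, Finset.sum_boole]
    rw [e1, ← Finset.sum_sub_distrib]
    refine (Finset.abs_sum_le_sum_abs _ _).trans ((Finset.sum_le_sum hpt).trans ?_)
    rw [← Finset.sum_div, Finset.sum_add_distrib, ← Finset.mul_sum, Finset.sum_boole, add_div,
      Finset.sum_const, nsmul_eq_mul]
    have h1 := count_bad (by omega) ρ (j+1)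
    have h2 : (P.card : ℝ) ≤ (n:ℝ)^(j+1) := by
      rw [hP, Finset.card_powersetCard, Finset.card_univ, Fintype.card_fin]
      exact_mod_cast Nat.choose_le_pow n (j+1)
    refine add_le_add ?_ ?_
    · rw [div_le_iff₀ hp0, mul_comm]
      gcongr
    · rw [mul_div_assoc]
      gcongr
  rw [hP, count_le_one F j, ← hP, hFc] at hsum
  have hca := count_approx (j := j) (by omega : 0 < n) (fixCount_le ρ)
  have := abs_sub_le (∑ S ∈ P, pr ρ S) ((((n - fixCount ρ).choose (j+1) + fixCount ρ * (n - fixCount ρ).choose j : ℕ) : ℝ) / (n:ℝ)^(j+1)) (LL (j+1) ((fixCount ρ:ℝ)/n))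
  have e3 : (((j:ℝ)+1)^2 + (j:ℝ)^2 + 2) * (1 / (n:ℝ)) = (((j:ℝ)+1)^2 + (j:ℝ)^2) / n + 2 * (1 / n) := by ring
  linarith

lemma mem_T {n : ℕ} {h : Equiv.Perm (Fin n)} : h ∈ transpositions n ↔ h.IsSwap := by
  simp [transpositions]

lemma T_map {n : ℕ} {x y : Fin n} (hxy : x ≠ y) :
    ((transpositions n).filter (fun h => h x = y)).card = 1 := by
  rw [Finset.card_eq_one]
  refine ⟨Equiv.swap x y, ?_⟩
  ext h
  rw [Finset.mem_filter, mem_T, Finset.mem_singleton]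
  constructor
  · rintro ⟨⟨a, b, hab, rfl⟩, h2⟩
    rw [Equiv.swap_apply_def] at h2
    split_ifs at h2 with h3 h4
    · rw [h3, h2]
    · rw [h4, h2, Equiv.swap_comm]
    · exact absurd h2 hxy
  · rintro rfl
    exact ⟨⟨x, y, hxy, rfl⟩, by simp⟩

lemma T_fix {n : ℕ} (x : Fin n) :
    (((transpositions n).filter (fun h => h x = x)).card : ℝ)
      = (transpositions n).card - ((n:ℝ) - 1) := by
  have h := Finset.card_eq_sum_card_fiberwise (s := transpositions n) (t := Finset.univ)
    (f := fun h => h x) (fun _ _ => Finset.mem_coe.2 (Finset.mem_univ _))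
  rw [← Finset.add_sum_erase _ _ (Finset.mem_univ x)] at h
  have h2 : ∑ y ∈ Finset.univ.erase x, ((transpositions n).filter (fun h => h x = y)).card
      = n - 1 := by
    rw [Finset.sum_congr rfl (fun y hy => T_map (Finset.ne_of_mem_erase hy).symm)]
    simp [Finset.card_erase_of_mem]
  rw [h2] at h
  have hn : 1 ≤ n := Nat.one_le_of_lt x.pos
  rw [h]
  push_cast [Nat.cast_sub hn]
  ring

lemma fixCount_sum {n : ℕ} (g : Equiv.Perm (Fin n)) :
    (fixCount g : ℝ) = ∑ x, if g x = x then (1:ℝ) else 0 := by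
  rw [Finset.sum_boole]; rfl

lemma T_step {n : ℕ} (g : Equiv.Perm (Fin n)) :
    ∑ h ∈ transpositions n, (fixCount (g * h) : ℝ)
      = fixCount g * ((transpositions n).card - ((n:ℝ) - 1)) + (n - fixCount g) := by
  simp_rw [fixCount_sum (g * _)]
  rw [Finset.sum_comm]
  have h1 : ∀ x : Fin n, ∑ h ∈ transpositions n, (if (g * h) x = x then (1:ℝ) else 0)
      = (if g x = x then (1:ℝ) else 0) * ((transpositions n).card - ((n:ℝ) - 1) - 1) + 1 := by
    intro x
    rw [Finset.sum_boole]
    have e : (transpositions n).filter (fun h => (g * h) x = x)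
        = (transpositions n).filter (fun h => h x = g⁻¹ x) := by
      apply Finset.filter_congr
      intro h _
      rw [Equiv.Perm.mul_apply, Equiv.Perm.eq_inv_iff_eq]
    rw [e]
    split_ifs with hx
    · have : g⁻¹ x = x := by rw [Equiv.Perm.inv_eq_iff_eq, hx]
      rw [this, T_fix]; ring
    · rw [T_map]
      · simp
      · intro h; apply hx; rw [Equiv.Perm.eq_inv_iff_eq] at h; exact h
  rw [Finset.sum_congr rfl (fun x _ => h1 x), Finset.sum_add_distrib, ← Finset.sum_mul,
    ← fixCount_sum]
  simp
  ring

lemma fixCount_swap {n : ℕ} {h : Equiv.Perm (Fin n)} (hh : h.IsSwap) : fixCount h + 2 = n := by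
  have h1 := Equiv.Perm.card_support_eq_two.2 hh
  have h2 : (Finset.univ.filter (fun i => h i = i)) = h.supportᶜ := by
    ext x; simp
  unfold fixCount
  have h3 := Finset.card_le_univ h.support
  rw [h2, Finset.card_compl, h1]
  simp at h3 ⊢
  omega

lemma T_card {n : ℕ} : 2 * ((transpositions n).card : ℝ) = n * ((n:ℝ) - 1) := by
  have h := T_step (1 : Equiv.Perm (Fin n))
  have h1 : ∀ x ∈ transpositions n, (fixCount (1 * x) : ℝ) = (n:ℝ) - 2 := by
    intro x hx
    rw [one_mul]
    have := fixCount_swap (mem_T.1 hx)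
    have h2 : ((fixCount x : ℝ)) + 2 = n := by exact_mod_cast this
    linarith
  have h2 : (fixCount (1 : Equiv.Perm (Fin n)) : ℝ) = n := by simp [fixCount]
  rw [Finset.sum_congr rfl h1, h2, Finset.sum_const, nsmul_eq_mul] at h
  linarith

lemma fix_diff {n : ℕ} (g : Equiv.Perm (Fin n)) {h : Equiv.Perm (Fin n)} (hh : h.IsSwap) :
    |(fixCount (g * h) : ℝ) - fixCount g| ≤ 2 := by
  have hs := Equiv.Perm.card_support_eq_two.2 hh
  have key : ∀ a b : Equiv.Perm (Fin n), (∀ x, x ∉ h.support → a x = b x) →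
      fixCount a ≤ fixCount b + 2 := by
    intro a b hab
    rw [← hs]
    unfold fixCount
    refine le_trans (Finset.card_le_card ?_) (Finset.card_union_le _ _)
    intro x hx
    rw [Finset.mem_union]
    by_cases hxs : x ∈ h.support
    · exact Or.inr hxs
    · left
      simp only [Finset.mem_filter, Finset.mem_univ, true_and] at hx ⊢
      rw [← hab x hxs, hx]
  have h1 := key (g * h) g (fun x hx => by simp [Equiv.Perm.notMem_support.1 hx])
  have h2 := key g (g * h) (fun x hx => by simp [Equiv.Perm.notMem_support.1 hx])
  have h1' : (fixCount (g * h) : ℝ) ≤ fixCount g + 2 := by exact_mod_cast h1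
  have h2' : (fixCount g : ℝ) ≤ fixCount (g * h) + 2 := by exact_mod_cast h2
  rw [abs_le]; constructor <;> linarith

lemma sum_conv {n : ℕ} (μ ν F : Equiv.Perm (Fin n) → ℝ) :
    ∑ g, conv μ ν g * F g = ∑ h, ν h * ∑ g, μ g * F (g * h) := by
  unfold conv
  simp_rw [Finset.sum_mul]
  rw [Finset.sum_comm]
  refine Finset.sum_congr rfl fun h _ => ?_
  rw [Finset.mul_sum, ← Equiv.sum_comp (Equiv.mulRight h)]
  refine Finset.sum_congr rfl fun g _ => ?_
  simp only [Equiv.coe_mulRight, mul_inv_cancel_right]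
  ring

lemma sum_conv' {n : ℕ} (μ ν F : Equiv.Perm (Fin n) → ℝ) :
    ∑ g, conv μ ν g * F g = ∑ g, μ g * ∑ h, ν h * F (g * h) := by
  rw [sum_conv]
  simp_rw [Finset.mul_sum]
  rw [Finset.sum_comm]
  refine Finset.sum_congr rfl fun g _ => Finset.sum_congr rfl fun h _ => by ring

lemma sum_unif {n : ℕ} (S : Finset (Equiv.Perm (Fin n))) (F : Equiv.Perm (Fin n) → ℝ) :
    ∑ h, unifOn S h * F h = (∑ h ∈ S, F h) / S.card := by
  unfold unifOn
  simp_rw [ite_mul, zero_mul]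
  rw [Finset.sum_ite_mem, Finset.univ_inter, Finset.sum_div]
  refine Finset.sum_congr rfl fun h _ => by ring

lemma unif_nonneg {n : ℕ} (S : Finset (Equiv.Perm (Fin n))) (g) : 0 ≤ unifOn S g := by
  unfold unifOn; split_ifs <;> positivity

/-- law of product of `t` transpositions -/
noncomputable def ww (n t : ℕ) : Equiv.Perm (Fin n) → ℝ := convPow (unifOn (transpositions n)) t

lemma ww_nonneg {n : ℕ} (t : ℕ) (g : Equiv.Perm (Fin n)) : 0 ≤ ww n t g := by
  unfold ww
  induction t generalizing g with
  | zero => simp only [convPow]; split_ifs <;> simp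
  | succ t ih =>
    simp only [convPow, conv]
    exact Finset.sum_nonneg fun h _ => mul_nonneg (ih _) (unif_nonneg _ _)

lemma ww_zero {n : ℕ} (F : Equiv.Perm (Fin n) → ℝ) : ∑ g, ww n 0 g * F g = F 1 := by
  simp [ww, convPow]

lemma ww_succ {n : ℕ} (t : ℕ) (F : Equiv.Perm (Fin n) → ℝ) :
    ∑ g, ww n (t+1) g * F g
      = ∑ g, ww n t g * ((∑ h ∈ transpositions n, F (g * h)) / (transpositions n).card) := by
  have : ww n (t+1) = conv (ww n t) (unifOn (transpositions n)) := rfl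
  rw [this, sum_conv']
  simp_rw [sum_unif]

lemma T_pos {n : ℕ} (hn : 3 ≤ n) : (0:ℝ) < (transpositions n).card := by
  have := @T_card n
  have h3 : (3:ℝ) ≤ n := by exact_mod_cast hn
  nlinarith

lemma ww_sum {n : ℕ} (hn : 3 ≤ n) (t : ℕ) : ∑ g, ww n t g = 1 := by
  induction t with
  | zero => simpa using ww_zero (n := n) (fun _ => 1)
  | succ t ih =>
    have := ww_succ (n := n) t (fun _ => 1)
    have hT := T_pos hn
    simp only [mul_one, Finset.sum_const, nsmul_eq_mul, div_self hT.ne'] at this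
    rw [this, ih]

lemma var_bound {n : ℕ} (hn : 3 ≤ n) (t : ℕ) :
    ∑ g, ww n t g * ((fixCount g : ℝ) - 1 - ((n:ℝ) - 1) * (1 - 2 / ((n:ℝ) - 1)) ^ t) ^ 2
      ≤ 4 * (t:ℝ) := by
  have h3 : (3:ℝ) ≤ n := by exact_mod_cast hn
  have hT := T_pos hn
  have hTc := @T_card n
  set r : ℝ := 1 - 2 / ((n:ℝ) - 1) with hr
  have hn1 : (0:ℝ) < (n:ℝ) - 1 := by linarith
  have hr1 : r ≤ 1 := by
    have : 0 ≤ 2 / ((n:ℝ) - 1) := by positivity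
    linarith
  have hr0 : 0 ≤ r := by
    have : 2 / ((n:ℝ) - 1) ≤ 1 := by rw [div_le_one hn1]; linarith
    linarith
  induction t with
  | zero =>
    rw [ww_zero (fun g => ((fixCount g : ℝ) - 1 - ((n:ℝ) - 1) * r ^ 0) ^ 2)]
    have h2 : (fixCount (1 : Equiv.Perm (Fin n)) : ℝ) = n := by simp [fixCount]
    rw [h2]; simp
  | succ t ih =>
    rw [ww_succ t (fun g => ((fixCount g : ℝ) - 1 - ((n:ℝ) - 1) * r ^ (t+1)) ^ 2)]
    have step : ∀ g : Equiv.Perm (Fin n),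
        (∑ h ∈ transpositions n, ((fixCount (g * h) : ℝ) - 1 - ((n:ℝ) - 1) * r ^ (t+1)) ^ 2)
          / (transpositions n).card
        ≤ 4 + ((fixCount g : ℝ) - 1 - ((n:ℝ) - 1) * r ^ t) ^ 2 := by
      intro g
      set m := ((n:ℝ) - 1) * r ^ t with hm
      have hm1 : ((n:ℝ) - 1) * r ^ (t+1) = r * m := by rw [hm]; ring
      rw [hm1]
      set u := (fixCount g : ℝ) - 1 with hu
      set N := ((transpositions n).card : ℝ) with hN
      have hmean : ∑ h ∈ transpositions n, ((fixCount (g * h) : ℝ) - fixCount g) = N * ((r - 1) * u) := by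
        rw [Finset.sum_sub_distrib, T_step, Finset.sum_const, nsmul_eq_mul]
        have hNe : N = n * ((n:ℝ) - 1) / 2 := by linarith
        rw [← hN, hNe, hr, hu]
        field_simp
        ring
      have hb : ∀ h ∈ transpositions n, ((fixCount (g * h) : ℝ) - 1 - r * m) ^ 2
          ≤ 4 + 2 * (u - r * m) * ((fixCount (g * h) : ℝ) - fixCount g) + (u - r * m)^2 := by
        intro h hh
        have := fix_diff g (mem_T.1 hh)
        have h4 : ((fixCount (g * h) : ℝ) - fixCount g)^2 ≤ 2^2 := sq_le_sq' (abs_le.1 this).1 (abs_le.1 this).2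
        rw [hu]
        nlinarith
      rw [div_le_iff₀ hT]
      refine (Finset.sum_le_sum hb).trans ?_
      rw [Finset.sum_add_distrib, Finset.sum_add_distrib, ← Finset.mul_sum, hmean, Finset.sum_const,
        Finset.sum_const, nsmul_eq_mul, nsmul_eq_mul, ← hN]
      have hfin : 4 + 2 * (u - r * m) * ((r - 1) * u) + (u - r * m)^2 ≤ 4 + (u - m)^2 := by
        have e : 4 + 2 * (u - r * m) * ((r - 1) * u) + (u - r * m)^2
          = 4 + r^2 * (u - m)^2 - ((r-1) * u)^2 := by ring
        have h5 : r^2 * (u - m)^2 ≤ 1 * (u - m)^2 := by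
          gcongr
          nlinarith
        have h6 := sq_nonneg ((r-1) * u)
        linarith
      calc _ = (4 + 2 * (u - r * m) * ((r - 1) * u) + (u - r * m)^2) * N := by ring
        _ ≤ _ := by gcongr
    calc _ ≤ ∑ g, ww n t g * (4 + ((fixCount g : ℝ) - 1 - ((n:ℝ) - 1) * r ^ t) ^ 2) := by
          gcongr with g _
          · exact ww_nonneg t g
          · exact step g
      _ = 4 + ∑ g, ww n t g * ((fixCount g : ℝ) - 1 - ((n:ℝ) - 1) * r ^ t) ^ 2 := by
          simp_rw [mul_add]
          rw [Finset.sum_add_distrib, ← Finset.sum_mul, ww_sum hn, one_mul]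
      _ ≤ _ := by push_cast; linarith

lemma pow_limit (c : ℝ) (hc : 0 < c) :
    Tendsto (fun n : ℕ => (1 - 2 / ((n:ℝ) - 1)) ^ ⌊c * (n:ℝ)⌋₊) atTop (nhds (Real.exp (-2 * c))) := by
  have t1 : Tendsto (fun n : ℕ => (⌊c * (n:ℝ)⌋₊ : ℝ) / n) atTop (nhds c) :=
    (tendsto_nat_floor_mul_div_atTop hc.le).comp tendsto_natCast_atTop_atTop
  have hinv : Tendsto (fun n : ℕ => 1 / (n:ℝ)) atTop (nhds 0) := tendsto_one_div_atTop_nhds_zero_nat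
  have t2 : Tendsto (fun x : ℝ => x * (-2 / (x - 1))) atTop (nhds (-2)) := by
    have h1 : Tendsto (fun x : ℝ => -2 / (1 - x⁻¹)) atTop (nhds (-2 / (1 - 0))) :=
      tendsto_const_nhds.div (tendsto_const_nhds.sub tendsto_inv_atTop_zero) (by norm_num)
    simp only [sub_zero, div_one] at h1
    refine h1.congr' ?_
    filter_upwards [eventually_gt_atTop 1] with x hx
    have h0 : x - 1 ≠ 0 := by linarith
    have h0' : x ≠ 0 := by linarith
    field_simp
  have t3 := (Real.tendsto_mul_log_one_add_of_tendsto t2).comp tendsto_natCast_atTop_atTop (α := ℕ)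
  have t4 := (Real.continuous_exp.tendsto _).comp (t1.mul t3)
  rw [mul_comm c] at t4
  refine t4.congr' ?_
  filter_upwards [eventually_ge_atTop 4] with n hn
  have hn4 : (4:ℝ) ≤ n := by exact_mod_cast hn
  have hlt : 2 / ((n:ℝ) - 1) < 1 := by rw [div_lt_one (by linarith)]; linarith
  simp only [Function.comp]
  have e : 1 + -2 / ((n:ℝ) - 1) = 1 - 2 / ((n:ℝ) - 1) := by ring
  rw [e, ← mul_assoc, div_mul_cancel₀ _ (by linarith), Real.exp_nat_mul, Real.exp_log (by linarith)]

lemma fix_conc (c : ℝ) (hc : 0 < c) :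
    Tendsto (fun n : ℕ => ∑ g, ww n ⌊c * (n:ℝ)⌋₊ g *
      ((fixCount g : ℝ) / n - Real.exp (-2 * c)) ^ 2) atTop (nhds 0) := by
  have hinv : Tendsto (fun n : ℕ => 1 / (n:ℝ)) atTop (nhds 0) := tendsto_one_div_atTop_nhds_zero_nat
  set p := Real.exp (-2 * c) with hp
  set M : ℕ → ℝ := fun n => (1 - 2 / ((n:ℝ) - 1)) ^ ⌊c * (n:ℝ)⌋₊ with hM
  have tM : Tendsto M atTop (nhds p) := pow_limit c hc
  have tb : Tendsto (fun n : ℕ => 2 * (4 * c * (1 / (n:ℝ))) +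
      2 * (1 / (n:ℝ) + (1 - 1 / (n:ℝ)) * M n - p)^2) atTop
      (nhds (2 * (4 * c * 0) + 2 * (0 + (1 - 0) * p - p)^2)) :=
    ((hinv.const_mul _).const_mul _).add
      ((((hinv.add ((tendsto_const_nhds.sub hinv).mul tM)).sub_const p).pow 2).const_mul _)
  have e0 : 2 * (4 * c * 0) + 2 * (0 + (1 - 0) * p - p)^2 = 0 := by ring
  rw [e0] at tb
  refine squeeze_zero' (Eventually.of_forall fun n => Finset.sum_nonneg fun g _ =>
    mul_nonneg (ww_nonneg _ _) (sq_nonneg _)) ?_ tb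
  filter_upwards [eventually_ge_atTop 3] with n hn
  have h3 : (3:ℝ) ≤ n := by exact_mod_cast hn
  have hn0 : (0:ℝ) < n := by linarith
  set t := ⌊c * (n:ℝ)⌋₊ with ht
  have htl : (t:ℝ) ≤ c * n := Nat.floor_le (by positivity)
  have hv := var_bound hn t
  have hMn : (1 - 2 / ((n:ℝ) - 1)) ^ t = M n := rfl
  rw [hMn] at hv
  have hpt : ∀ g : Equiv.Perm (Fin n), ((fixCount g : ℝ) / n - p) ^ 2 ≤
      2 * (((fixCount g : ℝ) - 1 - ((n:ℝ) - 1) * M n) ^ 2 / (n:ℝ)^2) +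
      2 * (1 / (n:ℝ) + (1 - 1 / (n:ℝ)) * M n - p)^2 := by
    intro g
    have e : (fixCount g : ℝ) / n - p = ((fixCount g : ℝ) - 1 - ((n:ℝ) - 1) * M n) / n
      + (1 / (n:ℝ) + (1 - 1 / (n:ℝ)) * M n - p) := by field_simp; ring
    rw [e, ← div_pow]
    generalize ((fixCount g : ℝ) - 1 - ((n:ℝ) - 1) * M n) / n = a
    generalize 1 / (n:ℝ) + (1 - 1 / (n:ℝ)) * M n - p = b
    nlinarith [sq_nonneg (a - b)]
  calc _ ≤ ∑ g, ww n t g * (2 * (((fixCount g : ℝ) - 1 - ((n:ℝ) - 1) * M n) ^ 2 / (n:ℝ)^2) +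
      2 * (1 / (n:ℝ) + (1 - 1 / (n:ℝ)) * M n - p)^2) := by
        gcongr with g _
        · exact ww_nonneg t g
        · exact hpt g
    _ = 2 * ((∑ g, ww n t g * ((fixCount g : ℝ) - 1 - ((n:ℝ) - 1) * M n) ^ 2) / (n:ℝ)^2) +
      2 * (1 / (n:ℝ) + (1 - 1 / (n:ℝ)) * M n - p)^2 := by
        simp_rw [mul_add]
        rw [Finset.sum_add_distrib, ← Finset.sum_mul, ww_sum hn, one_mul, Finset.sum_div,
          Finset.mul_sum]
        congr 1
        refine Finset.sum_congr rfl fun g _ => by ring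
    _ ≤ _ := by
        gcongr
        rw [div_le_iff₀ (by positivity)]
        refine hv.trans ?_
        have : 4 * c * (1 / (n:ℝ)) * (n:ℝ)^2 = 4 * (c * n) := by field_simp
        rw [this]; linarith

lemma bonf (w m : ℕ) :
    |(if w = 0 then (1:ℝ) else 0) - ∑ j ∈ Finset.range (m+1), (-1:ℝ)^j * w.choose j|
      ≤ w.choose (m+1) := by
  cases w with
  | zero =>
    rw [Finset.sum_range_succ']
    simp
  | succ w =>
    have h := @Int.alternating_sum_range_choose_eq_choose w m
    have h' : ∑ j ∈ Finset.range (m+1), (-1:ℝ)^j * ((w+1).choose j : ℝ) = (-1)^m * (w.choose m : ℝ) := by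
      exact_mod_cast h
    rw [h']
    simp only [Nat.add_eq_zero_iff, one_ne_zero, and_false, if_false, zero_sub, abs_neg, abs_mul,
      abs_pow, abs_one, one_pow, one_mul, Nat.abs_cast]
    rw [Nat.choose_succ_succ]
    push_cast
    linarith [(Nat.cast_nonneg (w.choose (m+1)) : (0:ℝ) ≤ _)]

/-- agreement set -/
def WW {n : ℕ} (φ : Fin n → Fin n) (γ : Equiv.Perm (Fin n)) : Finset (Fin n) :=
  Finset.univ.filter (fun y => γ y = φ y)

lemma moment_eq {n : ℕ} (φ : Fin n → Fin n) (k : ℕ) :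
    ∑ S ∈ Finset.powersetCard k Finset.univ, pr φ S
      = (∑ γ ∈ cycles n 1, ((WW φ γ).card.choose k : ℝ)) / (cycles n 1).card := by
  unfold pr
  rw [← Finset.sum_div]
  congr 1
  have h1 : ∀ S : Finset (Fin n), ((agr φ S).card : ℝ)
      = ∑ γ ∈ cycles n 1, if S ⊆ WW φ γ then (1:ℝ) else 0 := by
    intro S
    rw [Finset.sum_boole]
    congr 2
    ext γ
    simp [mem_agr, WW, Finset.subset_iff]
  rw [Finset.sum_congr rfl (fun S _ => h1 S), Finset.sum_comm]
  refine Finset.sum_congr rfl fun γ _ => ?_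
  rw [Finset.sum_boole, ← Finset.card_powersetCard]
  congr 2
  ext S
  simp [Finset.mem_powersetCard, and_comm]

lemma fixCount_mul_eq_zero {n : ℕ} (γ h : Equiv.Perm (Fin n)) :
    fixCount (γ * h) = 0 ↔ (WW (h⁻¹ : Equiv.Perm (Fin n)) γ).card = 0 := by
  unfold fixCount WW
  rw [Finset.card_eq_zero, Finset.card_eq_zero, Finset.filter_eq_empty_iff,
    Finset.filter_eq_empty_iff]
  constructor
  · intro H y _ hy
    apply H (Finset.mem_univ (h⁻¹ y))
    simp [hy]
  · intro H x _ hx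
    apply H (Finset.mem_univ (h x))
    simpa using hx

lemma fixCount_inv {n : ℕ} (h : Equiv.Perm (Fin n)) : fixCount h⁻¹ = fixCount h := by
  unfold fixCount
  congr 1
  ext x
  simp only [Finset.mem_filter, Finset.mem_univ, true_and]
  rw [Equiv.Perm.inv_eq_iff_eq]
  exact eq_comm

/-- conditional moment -/
noncomputable def MM {n : ℕ} (k : ℕ) (h : Equiv.Perm (Fin n)) : ℝ :=
  ∑ S ∈ Finset.powersetCard k Finset.univ, pr (h⁻¹ : Equiv.Perm (Fin n)) S

/-- conditional probability -/
noncomputable def qq {n : ℕ} (h : Equiv.Perm (Fin n)) : ℝ :=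
  (∑ γ ∈ cycles n 1, if fixCount (γ * h) = 0 then (1:ℝ) else 0) / (cycles n 1).card

lemma target_eq (n t : ℕ) :
    ∑ σ ∈ Finset.univ.filter (fun σ : Equiv.Perm (Fin n) => fixCount σ = 0), walk n 1 t σ
      = ∑ h, ww n t h * qq h := by
  rw [Finset.sum_filter]
  have : ∀ σ : Equiv.Perm (Fin n), (if fixCount σ = 0 then walk n 1 t σ else 0)
      = conv (unifOn (cycles n 1)) (ww n t) σ * (if fixCount σ = 0 then (1:ℝ) else 0) := by
    intro σ
    rw [mul_ite, mul_one, mul_zero]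
    rfl
  rw [Finset.sum_congr rfl (fun σ _ => this σ),
    sum_conv _ _ (fun σ => if fixCount σ = 0 then (1:ℝ) else 0)]
  refine Finset.sum_congr rfl fun h _ => ?_
  rw [sum_unif _ (fun g => if fixCount (g * h) = 0 then (1:ℝ) else 0)]
  rfl

lemma qq_bonf {n : ℕ} (hn : 3 ≤ n) (m : ℕ) (h : Equiv.Perm (Fin n)) :
    |qq h - ∑ j ∈ Finset.range (m+1), (-1:ℝ)^j * MM j h| ≤ MM (m+1) h := by
  have hc : (0:ℝ) < (cycles n 1).card := by exact_mod_cast cycles_nonempty hn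
  unfold qq MM
  simp_rw [moment_eq, ← mul_div_assoc]
  rw [← Finset.sum_div, ← sub_div, abs_div, abs_of_pos hc]
  gcongr
  simp_rw [Finset.mul_sum]
  rw [Finset.sum_comm, ← Finset.sum_sub_distrib]
  refine (Finset.abs_sum_le_sum_abs _ _).trans (Finset.sum_le_sum fun γ _ => ?_)
  have := bonf (WW (h⁻¹ : Equiv.Perm (Fin n)) γ).card m
  simp_rw [fixCount_mul_eq_zero]
  exact this

lemma LL_bound (k : ℕ) {u : ℝ} (h0 : 0 ≤ u) (h1 : u ≤ 1) : |LL k u| ≤ 2 := by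
  cases k with
  | zero => simp [LL]
  | succ j =>
    have key : ∀ i : ℕ, 0 ≤ (1 - u)^i / (i.factorial : ℝ) ∧ (1 - u)^i / (i.factorial : ℝ) ≤ 1 := by
      intro i
      have hf : (1:ℝ) ≤ i.factorial := by exact_mod_cast Nat.factorial_pos i
      have hp : 0 ≤ (1 - u)^i := pow_nonneg (by linarith) i
      have hp1 : (1 - u)^i ≤ 1 := pow_le_one₀ (by linarith) (by linarith)
      refine ⟨by positivity, ?_⟩
      rw [div_le_one (by linarith)]; linarith
    simp only [LL]
    obtain ⟨a1, a2⟩ := key (j+1)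
    obtain ⟨b1, b2⟩ := key j
    have c1 := mul_nonneg h0 b1
    have c2 := mul_le_one₀ h1 b1 b2
    rw [abs_le]; constructor <;> linarith

lemma LL_cont (k : ℕ) : Continuous (LL k) := by
  cases k with
  | zero => exact continuous_const
  | succ j =>
    have : LL (j+1) = fun u : ℝ => (1 - u) ^ (j+1) / ((j+1).factorial : ℝ) + u * ((1 - u) ^ j / (j.factorial : ℝ)) := by
      funext u; rfl
    rw [this]
    fun_prop

lemma moment_lim (c : ℝ) (hc : 0 < c) (k : ℕ) :
    Tendsto (fun n : ℕ => ∑ h, ww n ⌊c * (n:ℝ)⌋₊ h * MM k h) atTop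
      (nhds (LL k (Real.exp (-2 * c)))) := by
  set p := Real.exp (-2 * c) with hp
  have hp0 : 0 ≤ p := (Real.exp_pos _).le
  have hp1 : p ≤ 1 := Real.exp_le_one_iff.2 (by linarith)
  rw [Metric.tendsto_nhds]
  intro ε hε
  have hcont := Metric.continuous_iff.1 (LL_cont k) p (ε / 4) (by positivity)
  obtain ⟨δ, hδ, hcont⟩ := hcont
  have hconc := (fix_conc c hc).const_mul (4 / δ^2)
  rw [mul_zero] at hconc
  have e2 := hconc.eventually (eventually_lt_nhds (b := ε / 4) (by positivity))
  filter_upwards [moment_approx k (ε / 4) (by positivity), e2, eventually_ge_atTop 3] with n h1 h2 hn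
  have hn0 : (0:ℝ) < n := by exact_mod_cast (by omega : 0 < n)
  set t := ⌊c * (n:ℝ)⌋₊ with ht
  have hpt : ∀ h : Equiv.Perm (Fin n), |MM k h - LL k p| ≤
      ε / 2 + 4 / δ^2 * ((fixCount h : ℝ) / n - p)^2 := by
    intro h
    have a1 := h1 h⁻¹
    rw [fixCount_inv] at a1
    set u := (fixCount h : ℝ) / n with hu
    have hu0 : 0 ≤ u := by positivity
    have hu1 : u ≤ 1 := by
      rw [hu, div_le_one hn0]; exact_mod_cast fixCount_le h
    have a2 : |LL k u - LL k p| ≤ ε / 4 + 4 / δ^2 * (u - p)^2 := by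
      have hnn : 0 ≤ 4 / δ^2 * (u - p)^2 := by positivity
      by_cases hd : dist u p < δ
      · have := hcont u hd
        rw [Real.dist_eq] at this
        linarith
      · push Not at hd
        rw [Real.dist_eq] at hd
        have b1 := abs_sub (LL k u) (LL k p)
        have b2 := LL_bound k hu0 hu1
        have b3 := LL_bound k hp0 hp1
        have b4 : δ^2 ≤ (u - p)^2 := by
          rw [← sq_abs (u - p)]; gcongr
        have b5 : 4 ≤ 4 / δ^2 * (u - p)^2 := by
          rw [div_mul_eq_mul_div, le_div_iff₀ (by positivity)]
          gcongr
        linarith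
    have a3 := abs_sub_le (MM k h) (LL k u) (LL k p)
    have a4 : |MM k h - LL k u| ≤ ε / 4 := a1
    linarith
  rw [Real.dist_eq]
  have e : ∑ h, ww n t h * MM k h - LL k p = ∑ h, ww n t h * (MM k h - LL k p) := by
    simp_rw [mul_sub]
    rw [Finset.sum_sub_distrib, ← Finset.sum_mul, ww_sum hn, one_mul]
  rw [e]
  calc _ ≤ ∑ h, ww n t h * (ε / 2 + 4 / δ^2 * ((fixCount h : ℝ) / n - p)^2) := by
        refine (Finset.abs_sum_le_sum_abs _ _).trans (Finset.sum_le_sum fun h _ => ?_)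
        rw [abs_mul, abs_of_nonneg (ww_nonneg t h)]
        exact mul_le_mul_of_nonneg_left (hpt h) (ww_nonneg t h)
    _ = ε / 2 + 4 / δ^2 * ∑ h, ww n t h * ((fixCount h : ℝ) / n - p)^2 := by
        simp_rw [mul_add]
        rw [Finset.sum_add_distrib, ← Finset.sum_mul, ww_sum hn, one_mul, Finset.mul_sum]
        congr 1
        refine Finset.sum_congr rfl fun g _ => by ring
    _ < ε := by linarith

lemma LL_partial (p : ℝ) (m : ℕ) :
    ∑ j ∈ Finset.range (m+1), (-1:ℝ)^j * LL j p
      = ∑ j ∈ Finset.range (m+1), (p - 1)^j / j.factorial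
        - p * ∑ j ∈ Finset.range m, (p - 1)^j / j.factorial := by
  induction m with
  | zero => simp [LL]
  | succ m ih =>
    rw [Finset.sum_range_succ, ih, Finset.sum_range_succ _ (m+1), Finset.sum_range_succ _ m]
    simp only [LL]
    have e : ∀ i : ℕ, (p - 1)^i = (-1)^i * (1 - p)^i := by
      intro i; rw [← mul_pow]; congr 1; ring
    rw [e (m+1), e m, pow_succ (-1:ℝ) m]
    ring

lemma LL_series (p : ℝ) :
    Tendsto (fun m => ∑ j ∈ Finset.range (m+1), (-1:ℝ)^j * LL j p) atTop
      (nhds (Real.exp (p - 1) * (1 - p))) := by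
  have h : HasSum (fun j : ℕ => (p - 1)^j / (j.factorial : ℝ)) (Real.exp (p - 1)) := by
    rw [Real.exp_eq_exp_ℝ]
    exact NormedSpace.expSeries_div_hasSum_exp (p - 1)
  have t := h.tendsto_sum_nat
  simp_rw [LL_partial]
  have e : Real.exp (p - 1) * (1 - p) = Real.exp (p - 1) - p * Real.exp (p - 1) := by ring
  rw [e]
  exact (t.comp (tendsto_add_atTop_nat 1)).sub (t.const_mul p)

lemma LL_zero (p : ℝ) : Tendsto (fun m => LL (m+1) p) atTop (nhds 0) := by
  have h := FloorSemiring.tendsto_pow_div_factorial_atTop (1 - p)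
  have := (h.comp (tendsto_add_atTop_nat 1)).add (h.const_mul p)
  simp only [mul_zero, add_zero] at this
  exact this

/-- After a random `(n-1)`-cycle and `⌊cn⌋` random transpositions, the probability of
being fixed point free converges to `e^{e^{-2c}-1}(1 - e^{-2c})`. -/
theorem fixCount_eq_zero_prob_tendsto (c : ℝ) (hc : 0 < c) :
    Filter.Tendsto
      (fun n : ℕ => ∑ σ ∈ Finset.univ.filter (fun σ : Equiv.Perm (Fin n) => fixCount σ = 0),
        walk n 1 ⌊c * (n : ℝ)⌋₊ σ)
      Filter.atTop
      (nhds (Real.exp (Real.exp (-2 * c) - 1) * (1 - Real.exp (-2 * c)))) := by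
  simp_rw [target_eq]
  set p := Real.exp (-2 * c) with hp
  rw [Metric.tendsto_nhds]
  intro ε hε
  have e1 := (Metric.tendsto_nhds.1 (LL_series p)) (ε / 4) (by positivity)
  have e2 := (LL_zero p).eventually (eventually_lt_nhds (b := ε / 4) (by positivity))
  obtain ⟨m, h1, h2⟩ := (e1.and e2).exists
  have t1 : Tendsto (fun n : ℕ => ∑ j ∈ Finset.range (m+1), (-1:ℝ)^j *
      ∑ h, ww n ⌊c * (n:ℝ)⌋₊ h * MM j h) atTop
      (nhds (∑ j ∈ Finset.range (m+1), (-1:ℝ)^j * LL j p)) :=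
    tendsto_finsetSum _ fun j _ => (moment_lim c hc j).const_mul _
  have t2 := moment_lim c hc (m+1)
  have e3 := (Metric.tendsto_nhds.1 t1) (ε / 4) (by positivity)
  have e4 := t2.eventually (eventually_lt_nhds (b := ε / 4) h2)
  filter_upwards [e3, e4, eventually_ge_atTop 3] with n h3 h4 hn
  rw [Real.dist_eq] at h1 h3 ⊢
  set t := ⌊c * (n:ℝ)⌋₊ with ht
  have hb : |∑ h, ww n t h * qq h - ∑ j ∈ Finset.range (m+1), (-1:ℝ)^j * ∑ h, ww n t h * MM j h|
      ≤ ∑ h, ww n t h * MM (m+1) h := by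
    have e : ∑ j ∈ Finset.range (m+1), (-1:ℝ)^j * ∑ h, ww n t h * MM j h
        = ∑ h, ww n t h * ∑ j ∈ Finset.range (m+1), (-1:ℝ)^j * MM j h := by
      simp_rw [Finset.mul_sum]
      rw [Finset.sum_comm]
      refine Finset.sum_congr rfl fun h _ => Finset.sum_congr rfl fun j _ => by ring
    rw [e, ← Finset.sum_sub_distrib]
    refine (Finset.abs_sum_le_sum_abs _ _).trans (Finset.sum_le_sum fun h _ => ?_)
    rw [← mul_sub, abs_mul, abs_of_nonneg (ww_nonneg t h)]
    exact mul_le_mul_of_nonneg_left (qq_bonf hn m h) (ww_nonneg t h)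
  rw [abs_lt] at h1 h3 ⊢
  rw [abs_le] at hb
  constructor <;> linarith [h1.1, h1.2, h3.1, h3.2, hb.1, hb.2]
end

section
/- Fix a real number c > 0 and an integer r ≥ 1, and for each n set t_n = ⌊cn⌋. Then lim_{n→∞} E_{μ_{t_n+1}}[fix^r] = Σ_{i=1}^{r} S(r,i)·(1 + i·e^{−2c}/(1−e^{−2c}))·(1−e^{−2c})^{i}. -/
-- Common setup for the random (n-k)-cycle to transpositions walk on the symmetric group.
open Finset Filter Real

/-- Stirling numbers of the second kind: `stirling2 n k` is the number of partitions
of an `n`-element set into `k` nonempty blocks. -/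
def stirling2 : ℕ → ℕ → ℕ
  | 0, 0 => 1
  | 0, _ + 1 => 0
  | _ + 1, 0 => 0
  | n + 1, k + 1 => (k + 1) * stirling2 n (k + 1) + stirling2 n k

namespace FixMoment

open Equiv

noncomputable section

/-- Expectation of `φ` under `μ`. -/
def Ex {n : ℕ} (μ φ : Perm (Fin n) → ℝ) : ℝ := ∑ σ, φ σ * μ σ

lemma Ex_mono {n : ℕ} {μ φ ψ : Perm (Fin n) → ℝ} (hμ : ∀ σ, 0 ≤ μ σ) (h : ∀ σ, φ σ ≤ ψ σ) :
    Ex μ φ ≤ Ex μ ψ :=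
  Finset.sum_le_sum fun σ _ => mul_le_mul_of_nonneg_right (h σ) (hμ σ)

lemma Ex_add {n : ℕ} (μ φ ψ : Perm (Fin n) → ℝ) :
    Ex μ (fun σ => φ σ + ψ σ) = Ex μ φ + Ex μ ψ := by
  simp [Ex, add_mul, Finset.sum_add_distrib]

lemma Ex_smul {n : ℕ} (μ φ : Perm (Fin n) → ℝ) (a : ℝ) :
    Ex μ (fun σ => a * φ σ) = a * Ex μ φ := by
  simp [Ex, mul_assoc, Finset.mul_sum]

lemma Ex_abs_le {n : ℕ} {μ φ ψ : Perm (Fin n) → ℝ} (hμ : ∀ σ, 0 ≤ μ σ)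
    (h : ∀ σ, |φ σ| ≤ ψ σ) : |Ex μ φ| ≤ Ex μ ψ := by
  refine (Finset.abs_sum_le_sum_abs _ _).trans (Finset.sum_le_sum fun σ _ => ?_)
  rw [abs_mul, abs_of_nonneg (hμ σ)]
  exact mul_le_mul_of_nonneg_right (h σ) (hμ σ)

lemma Ex_conv {n : ℕ} (μ ν φ : Perm (Fin n) → ℝ) :
    Ex (conv μ ν) φ = Ex μ (fun σ => ∑ h, φ (σ * h) * ν h) := by
  unfold Ex conv
  simp_rw [Finset.mul_sum, Finset.sum_mul]
  rw [Finset.sum_comm]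
  conv_rhs => rw [Finset.sum_comm]
  refine Finset.sum_congr rfl fun h _ => ?_
  refine Fintype.sum_equiv (Equiv.mulRight h⁻¹) _ _ fun g => ?_
  simp
  ring

lemma conv_assoc {n : ℕ} (μ ν ρ : Perm (Fin n) → ℝ) :
    conv μ (conv ν ρ) = conv (conv μ ν) ρ := by
  funext g
  unfold conv
  simp_rw [Finset.mul_sum, Finset.sum_mul]
  rw [Finset.sum_comm]
  refine Finset.sum_congr rfl fun h _ => ?_
  refine Fintype.sum_equiv (Equiv.mulRight h⁻¹) _ _ fun k => ?_
  simp
  ring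

lemma walk_succ (n k t : ℕ) :
    walk n k (t + 1) = conv (walk n k t) (unifOn (transpositions n)) := by
  unfold walk
  rw [← conv_assoc]
  rfl

lemma walk_zero (n k : ℕ) : walk n k 0 = unifOn (cycles n k) := by
  funext g
  simp [walk, conv, convPow]

lemma unifOn_nonneg {n : ℕ} (S : Finset (Perm (Fin n))) (σ) : 0 ≤ unifOn S σ := by
  unfold unifOn; split_ifs <;> positivity

lemma walk_nonneg (n k t : ℕ) (σ) : 0 ≤ walk n k t σ := by
  induction t generalizing σ with
  | zero => rw [walk_zero]; exact unifOn_nonneg _ _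
  | succ t ih =>
    rw [walk_succ]
    exact Finset.sum_nonneg fun h _ => mul_nonneg (ih _) (unifOn_nonneg _ _)

lemma mem_transpositions {n : ℕ} (σ : Perm (Fin n)) : σ ∈ transpositions n ↔ σ.IsSwap := by
  simp [transpositions]

lemma mem_cycles {n k : ℕ} (σ : Perm (Fin n)) :
    σ ∈ cycles n k ↔ σ.IsCycle ∧ σ.support.card = n - k := by
  simp [cycles]

lemma swap_fiber {n : ℕ} (a b x y : Fin n) (hab : a ≠ b) (hxy : x ≠ y) :
    swap x y = swap a b ↔ (x = a ∧ y = b) ∨ (x = b ∧ y = a) := by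
  constructor
  · intro h
    have h1 : swap a b x = y := by rw [← h]; simp
    have h2 : swap a b y = x := by rw [← h]; simp
    rw [swap_apply_def] at h1 h2
    split_ifs at h1 h2 <;> grind
  · rintro (⟨rfl, rfl⟩ | ⟨rfl, rfl⟩)
    · rfl
    · exact swap_comm _ _

lemma sum_offDiag {n : ℕ} (ψ : Perm (Fin n) → ℝ) :
    ∑ p ∈ (univ : Finset (Fin n)).offDiag, ψ (swap p.1 p.2)
      = 2 * ∑ h ∈ transpositions n, ψ h := by
  rw [← Finset.sum_fiberwise_of_maps_to (t := transpositions n) (g := fun p => swap p.1 p.2),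
    Finset.mul_sum]
  · refine Finset.sum_congr rfl fun h hh => ?_
    obtain ⟨a, b, hab, rfl⟩ := (mem_transpositions h).1 hh
    have : {i ∈ (univ : Finset (Fin n)).offDiag | swap i.1 i.2 = swap a b}
        = {(a, b), (b, a)} := by
      ext ⟨x, y⟩
      simp only [Finset.mem_filter, Finset.mem_offDiag, Finset.mem_univ, true_and,
        Finset.mem_insert, Finset.mem_singleton, Prod.mk.injEq]
      constructor
      · rintro ⟨h1, h2⟩
        exact (swap_fiber a b x y hab h1).1 h2
      · intro h
        have hxy : x ≠ y := by
          rcases h with ⟨rfl, rfl⟩ | ⟨rfl, rfl⟩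
          · exact hab
          · exact hab.symm
        exact ⟨hxy, (swap_fiber a b x y hab hxy).2 h⟩
    rw [this, Finset.sum_pair]
    · simp only [swap_comm b a]; ring
    · simp [hab]
  · rintro ⟨x, y⟩ h
    rw [mem_transpositions]
    exact ⟨x, y, by simpa using h, rfl⟩

lemma card_transpositions (n : ℕ) :
    2 * ((transpositions n).card : ℝ) = n * (n - 1) := by
  have := sum_offDiag (n := n) (fun _ => 1)
  simp only [Finset.sum_const, nsmul_eq_mul, mul_one] at this
  rw [← this, Finset.offDiag_card]
  simp only [Finset.card_univ, Fintype.card_fin]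
  rw [Nat.cast_sub (Nat.le_mul_self n)]
  push_cast; ring

lemma Ex_walk_succ (n t : ℕ) (hn : 2 ≤ n) (φ : Perm (Fin n) → ℝ) :
    Ex (walk n 1 (t + 1)) φ = Ex (walk n 1 t) (fun σ => (1 / ((n : ℝ) * (n - 1))) *
      ∑ p ∈ (univ : Finset (Fin n)).offDiag, φ (σ * swap p.1 p.2)) := by
  rw [walk_succ, Ex_conv]
  congr 1
  funext σ
  rw [sum_offDiag (fun h => φ (σ * h)), ← card_transpositions]
  simp only [unifOn, mul_ite, mul_zero]
  rw [Finset.sum_ite_mem, Finset.univ_inter, ← Finset.sum_mul]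
  have : ((transpositions n).card : ℝ) ≠ 0 := by
    intro h
    have h2 := card_transpositions n
    rw [h] at h2
    have : (2 : ℝ) ≤ n := by exact_mod_cast hn
    nlinarith
  field_simp

lemma cycles_nonempty (n : ℕ) (hn : 4 ≤ n) : (cycles n 1).Nonempty := by
  obtain ⟨g, hg⟩ := (Equiv.Perm.exists_with_cycleType_iff (Fin n) (m := {n - 1})).2
    ⟨by simp, by simp; omega⟩
  refine ⟨g, (mem_cycles g).2 ⟨?_, ?_⟩⟩
  · rw [← Equiv.Perm.card_cycleType_eq_one, hg]; simp
  · rw [← Equiv.Perm.sum_cycleType, hg]; simp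

lemma Ex_walk_zero (n : ℕ) (hn : 4 ≤ n) (φ : Perm (Fin n) → ℝ) (a : ℝ)
    (h : ∀ σ ∈ cycles n 1, φ σ = a) : Ex (walk n 1 0) φ = a := by
  rw [walk_zero]
  simp only [Ex, unifOn, mul_ite, mul_zero]
  rw [Finset.sum_ite_mem, Finset.univ_inter, ← Finset.sum_mul, Finset.sum_congr rfl h]
  have : ((cycles n 1).card : ℝ) ≠ 0 := by
    exact_mod_cast (Finset.card_pos.2 (cycles_nonempty n hn)).ne'
  simp
  field_simp

/-- Number of fixed points of the square. -/
def sq {n : ℕ} (σ : Perm (Fin n)) : ℕ := (univ.filter fun i => σ (σ i) = i).card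

lemma fix_cycle {n : ℕ} (hn : 4 ≤ n) (σ : Perm (Fin n)) (h : σ ∈ cycles n 1) :
    fixCount σ = 1 := by
  have h2 := ((mem_cycles σ).1 h).2
  have : (univ.filter fun i => σ i = i) = σ.supportᶜ := by
    ext i; simp
  rw [fixCount, this, Finset.card_compl, h2]
  simp; omega

lemma sq_cycle {n : ℕ} (hn : 4 ≤ n) (σ : Perm (Fin n)) (h : σ ∈ cycles n 1) :
    sq σ = 1 := by
  rw [← fix_cycle hn σ h]
  unfold sq fixCount
  congr 1
  ext i
  simp only [Finset.mem_filter, Finset.mem_univ, true_and]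
  constructor
  · intro hi
    by_contra hne
    obtain ⟨h1, h2⟩ := (mem_cycles σ).1 h
    have h3 : σ ^ 2 = 1 := h1.pow_eq_one_iff.2 ⟨i, hne, by simpa [pow_two] using hi⟩
    have h4 := orderOf_le_of_pow_eq_one (by norm_num) h3
    rw [h1.orderOf, h2] at h4
    omega
  · intro hi; rw [hi, hi]

lemma fix_le_sq {n : ℕ} (σ : Perm (Fin n)) : fixCount σ ≤ sq σ := by
  apply Finset.card_le_card
  intro i
  simp only [Finset.mem_filter, Finset.mem_univ, true_and]
  intro hi; rw [hi, hi]

/-! ### The exponential bound -/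

lemma swap_cases {n : ℕ} (x y b : Fin n) :
    (b = x ∧ swap x y b = y) ∨ (b = y ∧ swap x y b = x) ∨
      (b ≠ x ∧ b ≠ y ∧ swap x y b = b) := by
  by_cases h1 : b = x
  · left; simp [h1]
  by_cases h2 : b = y
  · right; left; simp [h2]
  · right; right; exact ⟨h1, h2, swap_apply_of_ne_of_ne h1 h2⟩

lemma sq_swap_le {n : ℕ} (σ : Perm (Fin n)) (x y : Fin n) :
    sq (σ * swap x y) ≤ sq σ + 4 := by
  have hsub : (univ.filter fun i => (σ * swap x y) ((σ * swap x y) i) = i) ⊆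
      (univ.filter fun i => σ (σ i) = i) ∪ {x, y, σ⁻¹ x, σ⁻¹ y} := by
    intro b
    simp only [Finset.mem_filter, Finset.mem_univ, true_and, Finset.mem_union,
      Finset.mem_insert, Finset.mem_singleton, Perm.eq_inv_iff_eq]
    intro h
    simp only [Perm.mul_apply] at h
    rcases swap_cases x y b with h1 | h1 | ⟨h1, h2, h3⟩
    · tauto
    · tauto
    · rw [h3] at h
      rcases swap_cases x y (σ b) with h4 | h4 | ⟨h4, h5, h6⟩
      · tauto
      · tauto
      · rw [h6] at h; tauto
  calc sq (σ * swap x y) ≤ _ := Finset.card_le_card hsub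
    _ ≤ _ := Finset.card_union_le _ _
    _ ≤ sq σ + 4 := by unfold sq; gcongr; exact Finset.card_le_four

/-- The pairs for which the square may gain fixed points. -/
def bad {n : ℕ} (σ : Perm (Fin n)) : Finset (Fin n × Fin n) :=
  ((univ.image fun y => (σ y, y)) ∪ (univ.image fun x => (x, σ x))) ∪
    ((univ.image fun y => (σ (σ y), y)) ∪ (univ.image fun x => (x, σ (σ x))))

lemma card_bad {n : ℕ} (σ : Perm (Fin n)) : (bad σ).card ≤ 4 * n := by
  have h : ∀ f : Fin n → Fin n × Fin n, (univ.image f).card ≤ n := fun f => by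
    simpa using Finset.card_image_le (s := univ) (f := f)
  unfold bad
  refine (Finset.card_union_le _ _).trans ?_
  have h1 := Finset.card_union_le (univ.image fun y => (σ y, y)) (univ.image fun x => (x, σ x))
  have h2 := Finset.card_union_le (univ.image fun y => (σ (σ y), y))
    (univ.image fun x => (x, σ (σ x)))
  have := h (fun y => (σ y, y))
  have := h (fun x => (x, σ x))
  have := h (fun y => (σ (σ y), y))
  have := h (fun x => (x, σ (σ x)))
  omega

lemma sq_swap_good {n : ℕ} (σ : Perm (Fin n)) (x y : Fin n) (h : (x, y) ∉ bad σ) :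
    sq (σ * swap x y) ≤ sq σ := by
  have h1 : σ y ≠ x := by intro h1; apply h; simp [bad, h1]
  have h2 : σ x ≠ y := by intro h1; apply h; simp [bad, h1]
  have h3 : σ (σ y) ≠ x := by intro h1; apply h; simp [bad, h1]
  have h4 : σ (σ x) ≠ y := by intro h1; apply h; simp [bad, h1]
  apply Finset.card_le_card
  intro b
  simp only [Finset.mem_filter, Finset.mem_univ, true_and]
  intro hb
  simp only [Perm.mul_apply] at hb
  rcases swap_cases x y b with ⟨rfl, e⟩ | ⟨rfl, e⟩ | ⟨e1, e2, e⟩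
  · rw [e] at hb
    rcases swap_cases b y (σ y) with ⟨f1, f⟩ | ⟨f1, f⟩ | ⟨f1, f2, f⟩ <;> rw [f] at hb
    · exact absurd f1 h1
    · rw [hb, hb]
    · exact absurd hb h3
  · rw [e] at hb
    rcases swap_cases x b (σ x) with ⟨f1, f⟩ | ⟨f1, f⟩ | ⟨f1, f2, f⟩ <;> rw [f] at hb
    · rw [hb, hb]
    · exact absurd f1 h2
    · exact absurd hb h4
  · rw [e] at hb
    rcases swap_cases x y (σ b) with ⟨f1, f⟩ | ⟨f1, f⟩ | ⟨f1, f2, f⟩ <;> rw [f] at hb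
    · rw [hb] at h3; exact absurd f1 h3
    · rw [hb] at h4; exact absurd f1 h4
    · exact hb

lemma sum_two_pow {n : ℕ} (σ : Perm (Fin n)) :
    ∑ p ∈ (univ : Finset (Fin n)).offDiag, (2 : ℝ) ^ sq (σ * swap p.1 p.2)
      ≤ ((n : ℝ) * (n - 1) + 60 * n) * 2 ^ sq σ := by
  have key : ∀ p ∈ (univ : Finset (Fin n)).offDiag, (2 : ℝ) ^ sq (σ * swap p.1 p.2)
      ≤ 2 ^ sq σ + if p ∈ bad σ then 15 * 2 ^ sq σ else 0 := by
    rintro ⟨x, y⟩ -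
    split_ifs with h
    · calc (2 : ℝ) ^ sq (σ * swap x y) ≤ 2 ^ (sq σ + 4) :=
            pow_le_pow_right₀ (by norm_num) (sq_swap_le σ x y)
        _ = _ := by rw [pow_add]; ring
    · simpa using pow_le_pow_right₀ (by norm_num : (1 : ℝ) ≤ 2) (sq_swap_good σ x y h)
  refine (Finset.sum_le_sum key).trans ?_
  rw [Finset.sum_add_distrib, Finset.sum_const, Finset.offDiag_card, Finset.sum_ite_mem,
    Finset.sum_const, nsmul_eq_mul, nsmul_eq_mul]
  have h1 : (((univ : Finset (Fin n)).offDiag ∩ bad σ).card : ℝ) ≤ 4 * n := by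
    exact_mod_cast (Finset.card_le_card Finset.inter_subset_right).trans (card_bad σ)
  simp only [Finset.card_univ, Fintype.card_fin]
  rw [Nat.cast_sub (Nat.le_mul_self n)]
  push_cast
  have h2 : (0 : ℝ) < 2 ^ sq σ := by positivity
  nlinarith

lemma Ex_two_pow_step (n t : ℕ) (hn : 4 ≤ n) :
    Ex (walk n 1 (t + 1)) (fun σ => 2 ^ sq σ)
      ≤ (1 + 120 / n) * Ex (walk n 1 t) (fun σ => 2 ^ sq σ) := by
  rw [Ex_walk_succ n t (by omega), ← Ex_smul]
  refine Ex_mono (walk_nonneg _ _ _) fun σ => ?_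
  have hn' : (4 : ℝ) ≤ n := by exact_mod_cast hn
  have hpos : 0 < (n : ℝ) * (n - 1) := by nlinarith
  have h2 : (0 : ℝ) < 2 ^ sq σ := by positivity
  refine (mul_le_mul_of_nonneg_left (sum_two_pow σ) (by positivity)).trans ?_
  rw [← mul_assoc]
  refine mul_le_mul_of_nonneg_right ?_ h2.le
  rw [one_div, inv_mul_le_iff₀ hpos]
  have : (n : ℝ) * (n - 1) * (1 + 120 / n) = n * (n - 1) + 120 * (n - 1) := by field_simp
  rw [this]; nlinarith

lemma Ex_two_pow_le (n t : ℕ) (hn : 4 ≤ n) (c : ℝ) (ht : (t : ℝ) ≤ c * n) :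
    Ex (walk n 1 t) (fun σ => 2 ^ sq σ) ≤ 2 * Real.exp (120 * c) := by
  have h0 : ∀ t, Ex (walk n 1 t) (fun σ => 2 ^ sq σ) ≤ 2 * (1 + 120 / n) ^ t := by
    intro t
    induction t with
    | zero =>
      rw [Ex_walk_zero n hn _ 2 (fun σ h => by rw [sq_cycle hn σ h]; simp)]; simp
    | succ t ih =>
      refine (Ex_two_pow_step n t hn).trans ?_
      rw [pow_succ]
      have : (0 : ℝ) ≤ 1 + 120 / n := by positivity
      nlinarith
  have hn' : (4 : ℝ) ≤ n := by exact_mod_cast hn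
  refine (h0 t).trans ?_
  gcongr
  calc (1 + 120 / (n : ℝ)) ^ t ≤ (Real.exp (120 / n)) ^ t := by
        gcongr
        rw [add_comm]; exact Real.add_one_le_exp _
    _ = Real.exp (t * (120 / n)) := by rw [Real.exp_nat_mul]
    _ ≤ _ := by
        apply Real.exp_le_exp.2
        rw [mul_div_assoc', div_le_iff₀ (by linarith)]
        linarith

/-! ### One step of the fixed point count -/

lemma sum_split {n : ℕ} (f : Fin n → ℕ) (x y : Fin n) (hxy : x ≠ y) :
    ∑ i, f i = f x + f y + ∑ i ∈ (univ.erase x).erase y, f i := by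
  rw [← Finset.add_sum_erase _ f (Finset.mem_univ x),
    ← Finset.add_sum_erase _ f (a := y) (by simp [hxy.symm]), add_assoc]

lemma fix_swap {n : ℕ} (σ : Perm (Fin n)) (x y : Fin n) (hxy : x ≠ y) :
    fixCount (σ * swap x y) + ((if σ x = x then 1 else 0) + (if σ y = y then 1 else 0))
      = fixCount σ + ((if σ y = x then 1 else 0) + (if σ x = y then 1 else 0)) := by
  unfold fixCount
  rw [Finset.card_filter, Finset.card_filter, sum_split _ x y hxy,
    sum_split (fun i => if σ i = i then 1 else 0) x y hxy]
  have : ∑ i ∈ (univ.erase x).erase y, (if (σ * swap x y) i = i then 1 else 0)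
      = ∑ i ∈ (univ.erase x).erase y, (if σ i = i then 1 else 0) := by
    refine Finset.sum_congr rfl fun i hi => ?_
    simp only [Finset.mem_erase, Finset.mem_univ, and_true] at hi
    rw [Perm.mul_apply, swap_apply_of_ne_of_ne hi.2 hi.1]
  rw [this]
  simp only [Perm.mul_apply, swap_apply_left, swap_apply_right]
  ring

lemma step_err {n : ℕ} (σ : Perm (Fin n)) (x y : Fin n) (hxy : x ≠ y) (φ : ℕ → ℝ) (M : ℝ)
    (h0 : ∀ k, 0 ≤ φ k) (hM : ∀ k ≤ fixCount σ + 2, φ k ≤ M) :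
    |φ (fixCount (σ * swap x y)) - φ (fixCount σ)
      - ((if σ x = x then 1 else 0) + (if σ y = y then 1 else 0))
        * (φ (fixCount σ - 1) - φ (fixCount σ))
      - ((if σ y = x then 1 else 0) + (if σ x = y then 1 else 0))
        * (φ (fixCount σ + 1) - φ (fixCount σ))|
    ≤ 4 * M * ((if σ x = x ∧ σ y = y then 1 else 0) + (if σ y = x ∧ σ x = y then 1 else 0)) := by
  have hs := fix_swap σ x y hxy
  generalize fixCount (σ * swap x y) = N' at *
  generalize fixCount σ = N at *
  have e1 := hM N (by omega)
  have e2 := hM (N + 1) (by omega)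
  have e3 := hM (N + 2) (by omega)
  have e4 := hM (N - 1) (by omega)
  have e5 := hM (N - 2) (by omega)
  have g1 := h0 N
  have g2 := h0 (N + 1)
  have g3 := h0 (N + 2)
  have g4 := h0 (N - 1)
  have g5 := h0 (N - 2)
  by_cases a : σ x = x <;> by_cases b : σ y = y
  · have c : σ y ≠ x := by grind
    have d : σ x ≠ y := by grind
    simp only [a, b, hxy, hxy.symm, if_true, if_false, and_self] at hs ⊢
    have : N' = N - 2 := by omega
    subst this
    rw [abs_le]; constructor <;> linarith
  · have c : σ y ≠ x := by
      intro h; exact hxy (σ.injective (a.trans h.symm))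
    have d : σ x ≠ y := by grind
    have : N' = N - 1 := by simp [a, b, c, hxy] at hs; omega
    subst this
    simp [a, b, c, hxy]
  · have c : σ y ≠ x := by grind
    have d : σ x ≠ y := by
      intro h; exact hxy (σ.injective (h.trans b.symm))
    have : N' = N - 1 := by simp [a, b, d, hxy.symm] at hs; omega
    subst this
    simp [a, b, d, hxy.symm]
  · by_cases c : σ y = x <;> by_cases d : σ x = y
    · have : N' = N + 2 := by simp [c, d, hxy, hxy.symm] at hs; omega
      subst this
      simp only [c, d, hxy, hxy.symm, if_true, if_false, and_self]
      rw [abs_le]; constructor <;> linarith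
    · have : N' = N + 1 := by simp [a, c, d, hxy] at hs; omega
      subst this
      simp [a, c, d, hxy]
    · have : N' = N + 1 := by simp [b, c, d, hxy.symm] at hs; omega
      subst this
      simp [b, c, d, hxy.symm]
    · have : N' = N := by simp [a, b, c, d] at hs; omega
      subst this
      simp [a, b, c, d]

lemma sum_od {n : ℕ} (f : Fin n × Fin n → ℝ) :
    ∑ p ∈ (univ : Finset (Fin n)).offDiag, f p
      = ∑ x, ∑ y, if x = y then 0 else f (x, y) := by
  rw [← Finset.sum_product' univ univ (fun x y => if x = y then 0 else f (x, y))]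
  have : (univ : Finset (Fin n)).offDiag
      = (univ ×ˢ univ : Finset (Fin n × Fin n)).filter (fun p => ¬ p.1 = p.2) := by
    ext p; simp
  rw [this, Finset.sum_filter]
  refine Finset.sum_congr rfl fun p _ => ?_
  simp

lemma sum_ne {n : ℕ} (x : Fin n) (a : ℝ) :
    ∑ y : Fin n, (if x = y then 0 else a) = (n - 1) * a := by
  have : ∀ y : Fin n, (if x = y then 0 else a) = a - if x = y then a else 0 := by
    intro y; split_ifs <;> simp
  simp_rw [this]
  rw [Finset.sum_sub_distrib, Finset.sum_ite_eq]
  simp; ring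

lemma fixCount_eq_sum {n : ℕ} (σ : Perm (Fin n)) :
    (fixCount σ : ℝ) = ∑ x, if σ x = x then 1 else 0 := by
  simp [fixCount]

lemma sum_a {n : ℕ} (σ : Perm (Fin n)) :
    ∑ p ∈ (univ : Finset (Fin n)).offDiag, (if σ p.1 = p.1 then (1 : ℝ) else 0)
      = (n - 1) * fixCount σ := by
  rw [sum_od, fixCount_eq_sum, Finset.mul_sum]
  exact Finset.sum_congr rfl fun x _ => sum_ne x (if σ x = x then 1 else 0)

lemma sum_b {n : ℕ} (σ : Perm (Fin n)) :
    ∑ p ∈ (univ : Finset (Fin n)).offDiag, (if σ p.2 = p.2 then (1 : ℝ) else 0)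
      = (n - 1) * fixCount σ := by
  rw [sum_od, Finset.sum_comm, fixCount_eq_sum, Finset.mul_sum]
  refine Finset.sum_congr rfl fun x _ => ?_
  rw [← sum_ne x]
  refine Finset.sum_congr rfl fun y _ => ?_
  simp only [eq_comm]

lemma sum_d {n : ℕ} (σ : Perm (Fin n)) :
    ∑ p ∈ (univ : Finset (Fin n)).offDiag, (if σ p.1 = p.2 then (1 : ℝ) else 0)
      = n - fixCount σ := by
  rw [sum_od, fixCount_eq_sum]
  have : (n : ℝ) = ∑ x : Fin n, (1 : ℝ) := by simp
  rw [this, ← Finset.sum_sub_distrib]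
  refine Finset.sum_congr rfl fun x _ => ?_
  rw [Finset.sum_eq_single (σ x)]
  · by_cases h : σ x = x
    · simp [h]
    · simp [h, Ne.symm h]
  · intro b _ hb
    simp [hb.symm]
  · simp

lemma sum_c {n : ℕ} (σ : Perm (Fin n)) :
    ∑ p ∈ (univ : Finset (Fin n)).offDiag, (if σ p.2 = p.1 then (1 : ℝ) else 0)
      = n - fixCount σ := by
  rw [← sum_d σ, sum_od, sum_od, Finset.sum_comm]
  refine Finset.sum_congr rfl fun x _ => Finset.sum_congr rfl fun y _ => ?_
  simp only [eq_comm]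

lemma sum_ab {n : ℕ} (σ : Perm (Fin n)) :
    ∑ p ∈ (univ : Finset (Fin n)).offDiag, (if σ p.1 = p.1 ∧ σ p.2 = p.2 then (1 : ℝ) else 0)
      ≤ (fixCount σ : ℝ) ^ 2 := by
  rw [Finset.sum_boole, pow_two]
  unfold fixCount
  rw [← Nat.cast_mul, ← Finset.card_product]
  norm_cast
  apply Finset.card_le_card
  intro p
  simp

lemma sum_cd {n : ℕ} (σ : Perm (Fin n)) :
    ∑ p ∈ (univ : Finset (Fin n)).offDiag, (if σ p.2 = p.1 ∧ σ p.1 = p.2 then (1 : ℝ) else 0)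
      ≤ sq σ := by
  rw [Finset.sum_boole]
  unfold sq
  norm_cast
  apply Finset.card_le_card_of_injOn Prod.fst
  · intro p
    simp only [Finset.coe_filter, Finset.mem_offDiag, Finset.mem_univ, true_and, Set.mem_ofPred_eq]
    rintro ⟨_, h1, h2⟩
    rw [h2, h1]
  · intro p hp q hq h
    simp only [Finset.coe_filter, Finset.mem_offDiag, Finset.mem_univ, true_and,
      Set.mem_ofPred_eq] at hp hq
    ext1
    · exact h
    · rw [← hp.2.2, ← hq.2.2, h]

lemma sum_step {n : ℕ} (σ : Perm (Fin n)) (φ : ℕ → ℝ) (M : ℝ)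
    (h0 : ∀ k, 0 ≤ φ k) (hM : ∀ k ≤ fixCount σ + 2, φ k ≤ M) :
    |∑ p ∈ (univ : Finset (Fin n)).offDiag, φ (fixCount (σ * swap p.1 p.2))
      - n * (n - 1) * φ (fixCount σ)
      - 2 * (n - 1) * (fixCount σ * (φ (fixCount σ - 1) - φ (fixCount σ)))
      - 2 * (n - fixCount σ) * (φ (fixCount σ + 1) - φ (fixCount σ))|
    ≤ 4 * M * ((fixCount σ : ℝ) ^ 2 + sq σ) := by
  have hM0 : 0 ≤ M := (h0 0).trans (hM 0 (by omega))
  have key := Finset.sum_le_sum (s := (univ : Finset (Fin n)).offDiag) fun p hp =>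
    step_err σ p.1 p.2 (by simpa using hp) φ M h0 hM
  have key2 := (Finset.abs_sum_le_sum_abs _ _).trans key
  rw [← Finset.mul_sum, Finset.sum_add_distrib] at key2
  have key3 := key2.trans
    (mul_le_mul_of_nonneg_left (add_le_add (sum_ab σ) (sum_cd σ)) (by positivity))
  refine le_of_eq_of_le ?_ key3
  congr 1
  rw [Finset.sum_sub_distrib, Finset.sum_sub_distrib, Finset.sum_sub_distrib, Finset.sum_const,
    ← Finset.sum_mul, ← Finset.sum_mul, Finset.sum_add_distrib, Finset.sum_add_distrib,
    sum_a, sum_b, sum_c, sum_d, Finset.offDiag_card, nsmul_eq_mul]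
  simp only [Finset.card_univ, Fintype.card_fin]
  rw [Nat.cast_sub (Nat.le_mul_self n)]
  push_cast; ring

/-! ### Falling factorials -/

lemma desc_mul (N i : ℕ) :
    (N : ℝ) * N.descFactorial i = N.descFactorial (i + 1) + i * N.descFactorial i := by
  rw [Nat.descFactorial_succ]
  rcases le_or_gt i N with h | h
  · push_cast [Nat.cast_sub h]; ring
  · rw [Nat.descFactorial_of_lt h]; simp

lemma desc_up (N m : ℕ) :
    ((N + 1).descFactorial (m + 1) : ℝ) - N.descFactorial (m + 1)
      = (m + 1) * N.descFactorial m := by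
  rw [Nat.succ_descFactorial_succ]
  have := desc_mul N m
  push_cast
  linarith

lemma desc_down (N m : ℕ) :
    (N : ℝ) * (((N - 1).descFactorial (m + 1) : ℝ) - N.descFactorial (m + 1))
      = -((m + 1) * N.descFactorial (m + 1)) := by
  rcases N with _ | N
  · simp
  · have h := desc_up N m
    have h2 : ((N + 1).descFactorial (m + 1) : ℝ) = (N + 1) * N.descFactorial m := by
      rw [Nat.succ_descFactorial_succ]; push_cast; ring
    simp only [Nat.add_sub_cancel]
    rw [show ((N.descFactorial (m + 1) : ℝ) - (N + 1).descFactorial (m + 1))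
      = - ((m + 1) * N.descFactorial m) by linarith, h2]
    push_cast; ring

lemma desc_le (k N i : ℕ) (h : k ≤ N) : (k.descFactorial i : ℝ) ≤ (N : ℝ) ^ i := by
  exact_mod_cast (Nat.descFactorial_le_pow k i).trans (Nat.pow_le_pow_left h i)

lemma pow_eq_sum (N r : ℕ) :
    (N : ℝ) ^ r = ∑ i ∈ Finset.range (r + 1), (stirling2 r i : ℝ) * N.descFactorial i := by
  have hz : ∀ r k, r < k → stirling2 r k = 0 := by
    intro r
    induction r with
    | zero => intro k hk; obtain ⟨k, rfl⟩ := Nat.exists_eq_add_of_lt hk; simp [stirling2]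
    | succ r ih =>
      intro k hk
      obtain ⟨k, rfl⟩ : ∃ j, k = j + 1 := ⟨k - 1, by omega⟩
      simp [stirling2, ih k (by omega), ih (k + 1) (by omega)]
  induction r with
  | zero => simp [stirling2]
  | succ r ih =>
    rw [pow_succ, ih, Finset.sum_mul, Finset.sum_range_succ' _ (r + 1)]
    have e : ∀ i, ((stirling2 r i : ℝ) * N.descFactorial i) * N
        = (stirling2 r i : ℝ) * N.descFactorial (i + 1)
          + stirling2 r i * i * N.descFactorial i := by
      intro i
      have := desc_mul N i
      linear_combination (stirling2 r i : ℝ) * this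
    simp_rw [e]
    rw [Finset.sum_add_distrib]
    have e2 : ∑ i ∈ Finset.range (r + 1), (stirling2 r i : ℝ) * i * N.descFactorial i
        = ∑ i ∈ Finset.range (r + 1),
          (stirling2 r (i + 1) : ℝ) * (i + 1) * N.descFactorial (i + 1) := by
      have := Finset.sum_range_succ'
        (fun i => (stirling2 r i : ℝ) * i * N.descFactorial i) (r + 1)
      rw [Finset.sum_range_succ, hz r (r + 1) (by omega)] at this
      simpa using this
    rw [e2, ← Finset.sum_add_distrib]
    simp only [stirling2, Nat.cast_zero, zero_mul, add_zero]
    refine Finset.sum_congr rfl fun i _ => ?_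
    push_cast; ring

lemma pow_le_two_pow (j : ℕ) : ∃ K : ℝ, 0 ≤ K ∧ ∀ s : ℕ, ((s : ℝ) + 2) ^ j ≤ K * 2 ^ s := by
  obtain ⟨B, hB⟩ := (tendsto_pow_const_div_const_pow_of_one_lt j
    (by norm_num : (1 : ℝ) < 2)).bddAbove_range
  have hB' : ∀ n : ℕ, (n : ℝ) ^ j / 2 ^ n ≤ B := fun n => hB ⟨n, rfl⟩
  refine ⟨4 * B, ?_, fun s => ?_⟩
  · have := hB' 1
    have : (0 : ℝ) ≤ (1 : ℕ) ^ j / 2 ^ 1 := by positivity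
    linarith
  · have := hB' (s + 2)
    rw [div_le_iff₀ (by positivity)] at this
    push_cast at this
    rw [pow_add] at this
    linarith

/-- Factorial moments. -/
def a (n i t : ℕ) : ℝ := Ex (walk n 1 t) (fun σ => ((fixCount σ).descFactorial i : ℝ))

lemma step_pointwise (m : ℕ) : ∃ K : ℝ, 0 ≤ K ∧ ∀ n : ℕ, 4 ≤ n → ∀ σ : Perm (Fin n),
    |(1 / ((n : ℝ) * (n - 1))) * ∑ p ∈ (univ : Finset (Fin n)).offDiag,
        ((fixCount (σ * swap p.1 p.2)).descFactorial (m + 1) : ℝ)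
      + (-(1 - 2 * (m + 1) / n) * (fixCount σ).descFactorial (m + 1)
      + -(2 * (m + 1) / n) * (fixCount σ).descFactorial m)| ≤ K / n ^ 2 * 2 ^ sq σ := by
  obtain ⟨K, hK, hb⟩ := pow_le_two_pow (m + 3)
  refine ⟨2 * (4 + 2 * (m + 1)) * K, by positivity, fun n hn σ => ?_⟩
  have hn' : (4 : ℝ) ≤ n := by exact_mod_cast hn
  have hpos : 0 < (n : ℝ) * (n - 1) := by nlinarith
  have hNs : (fixCount σ : ℝ) ≤ sq σ := by exact_mod_cast fix_le_sq σ
  have hN0 : (0 : ℝ) ≤ fixCount σ := by positivity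
  have h := sum_step σ (fun k => (k.descFactorial (m + 1) : ℝ)) (((sq σ : ℝ) + 2) ^ (m + 1))
    (fun k => by positivity) (fun k hk => by
      have := desc_le k (sq σ + 2) (m + 1) (by have := fix_le_sq σ; omega)
      push_cast at this; exact this)
  simp only [desc_down, desc_up] at h
  have hD : ((fixCount σ).descFactorial m : ℝ) ≤ ((sq σ : ℝ) + 2) ^ m := by
    have := desc_le (fixCount σ) (sq σ + 2) m (by have := fix_le_sq σ; omega)
    push_cast at this; exact this
  have hD0 : (0 : ℝ) ≤ ((fixCount σ).descFactorial m : ℝ) := by positivity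
  set T := ∑ p ∈ (univ : Finset (Fin n)).offDiag,
        ((fixCount (σ * swap p.1 p.2)).descFactorial (m + 1) : ℝ) with hT
  set D1 := ((fixCount σ).descFactorial (m + 1) : ℝ)
  set D0 := ((fixCount σ).descFactorial m : ℝ)
  set N := (fixCount σ : ℝ)
  set s := (sq σ : ℝ)
  have hs : 0 ≤ s := hN0.trans hNs
  have hb' := hb (sq σ)
  change (s + 2) ^ (m + 3) ≤ _ at hb'
  have e : (1 / ((n : ℝ) * (n - 1))) * T
      + (-(1 - 2 * (m + 1) / n) * D1 + -(2 * (m + 1) / n) * D0)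
      = (1 / ((n : ℝ) * (n - 1))) * ((T - n * (n - 1) * D1 - 2 * (n - 1) * -((m + 1) * D1)
        - 2 * (n - N) * ((m + 1) * D0)) + 2 * (1 - N) * ((m + 1) * D0)) := by
    have : (n : ℝ) - 1 ≠ 0 := by linarith
    field_simp
    ring
  rw [e, abs_mul, abs_of_pos (by positivity : 0 < 1 / ((n : ℝ) * (n - 1)))]
  have h2 : |2 * (1 - N) * ((m + 1) * D0)| ≤ 2 * (m + 1) * (s + 2) ^ (m + 3) := by
    rw [abs_mul, abs_of_nonneg (by positivity : (0 : ℝ) ≤ (m + 1) * D0)]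
    have : |2 * (1 - N)| ≤ 2 * (s + 2) := by
      rw [abs_le]; constructor <;> linarith
    calc |2 * (1 - N)| * ((m + 1) * D0) ≤ (2 * (s + 2)) * ((m + 1) * (s + 2) ^ m) := by gcongr
      _ = 2 * (m + 1) * (s + 2) ^ (m + 1) := by ring
      _ ≤ _ := by
        gcongr
        · linarith
        · omega
  have h3 : 4 * (s + 2) ^ (m + 1) * (N ^ 2 + s) ≤ 4 * (s + 2) ^ (m + 3) := by
    have : N ^ 2 + s ≤ (s + 2) ^ 2 := by nlinarith
    calc 4 * (s + 2) ^ (m + 1) * (N ^ 2 + s) ≤ 4 * (s + 2) ^ (m + 1) * (s + 2) ^ 2 := by gcongr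
      _ = _ := by ring
  have h4 := (abs_add_le _ _).trans (add_le_add (h.trans h3) h2)
  have h5 : 4 * (s + 2) ^ (m + 3) + 2 * (m + 1) * (s + 2) ^ (m + 3)
      ≤ (4 + 2 * (m + 1)) * (K * 2 ^ sq σ) := by
    rw [← add_mul]; gcongr
  have h6 : 1 / ((n : ℝ) * (n - 1)) ≤ 2 / n ^ 2 := by
    rw [div_le_div_iff₀ hpos (by positivity)]; nlinarith
  calc _ ≤ 2 / (n : ℝ) ^ 2 * ((4 + 2 * (m + 1)) * (K * 2 ^ sq σ)) := by
        gcongr; exact h4.trans h5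
    _ = _ := by ring

lemma a_step (c : ℝ) (m : ℕ) : ∃ K : ℝ, 0 ≤ K ∧ ∀ n : ℕ, 4 ≤ n → ∀ t : ℕ, (t : ℝ) ≤ c * n →
    |a n (m + 1) (t + 1) - ((1 - 2 * (m + 1) / n) * a n (m + 1) t
      + 2 * (m + 1) / n * a n m t)| ≤ K / n ^ 2 := by
  obtain ⟨K, hK, h⟩ := step_pointwise m
  refine ⟨K * (2 * Real.exp (120 * c)), by positivity, fun n hn t ht => ?_⟩
  have h1 := Ex_abs_le (walk_nonneg n 1 t) (h n hn)
  rw [Ex_add, Ex_add, Ex_smul _ _ (-(1 - 2 * ((m : ℝ) + 1) / n)),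
    Ex_smul _ _ (-(2 * ((m : ℝ) + 1) / n)), Ex_smul _ _ (K / (n : ℝ) ^ 2),
    ← Ex_walk_succ n t (by omega) (fun σ => ((fixCount σ).descFactorial (m + 1) : ℝ))] at h1
  have h2 := Ex_two_pow_le n t hn c ht
  have h3 := h1.trans (mul_le_mul_of_nonneg_left h2 (by positivity))
  refine le_of_eq_of_le ?_ (h3.trans_eq (by ring))
  congr 1
  unfold a
  ring

lemma a_zero (n i : ℕ) (hn : 4 ≤ n) : a n i 0 = (Nat.descFactorial 1 i : ℝ) :=
  Ex_walk_zero n hn _ _ fun σ h => by rw [fix_cycle hn σ h]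

lemma a_const (n t : ℕ) (hn : 4 ≤ n) : a n 0 t = 1 := by
  induction t with
  | zero => rw [a_zero n 0 hn]; simp
  | succ t ih =>
    rw [← ih]
    unfold a
    rw [Ex_walk_succ n t (by omega)]
    congr 1
    funext σ
    have hn' : (4 : ℝ) ≤ n := by exact_mod_cast hn
    have h1 : (n : ℝ) - 1 ≠ 0 := by linarith
    simp only [Nat.descFactorial_zero, Nat.cast_one, Finset.sum_const, nsmul_eq_mul, mul_one,
      Finset.offDiag_card, Finset.card_univ, Fintype.card_fin]
    rw [Nat.cast_sub (Nat.le_mul_self n)]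
    push_cast
    field_simp

/-! ### The limiting profile -/

/-- Limit of the factorial moments, with `w = 1 - exp (-2 * c)`. -/
def P (i : ℕ) (w : ℝ) : ℝ := w ^ i + i * (1 - w) * w ^ (i - 1)

lemma pow_taylor (k : ℕ) (w z : ℝ) (h0 : 0 ≤ w) (h1 : w ≤ 1) (h2 : 0 ≤ w + z) (h3 : w + z ≤ 1) :
    |(w + z) ^ k - w ^ k - k * w ^ (k - 1) * z| ≤ k ^ 2 * z ^ 2 := by
  induction k with
  | zero => simp
  | succ k ih =>
    have e : (w + z) ^ (k + 1) - w ^ (k + 1) - ((k + 1 : ℕ) : ℝ) * w ^ (k + 1 - 1) * z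
        = (w + z) * ((w + z) ^ k - w ^ k - k * w ^ (k - 1) * z) + k * w ^ (k - 1) * z ^ 2 := by
      rcases k with _ | k
      · simp
      · simp only [Nat.add_sub_cancel]; push_cast; ring
    rw [e]
    refine (abs_add_le _ _).trans ?_
    rw [abs_mul, abs_of_nonneg h2,
      abs_of_nonneg (by positivity : (0 : ℝ) ≤ k * w ^ (k - 1) * z ^ 2)]
    have i1 : (w + z) * |(w + z) ^ k - w ^ k - k * w ^ (k - 1) * z| ≤ 1 * (k ^ 2 * z ^ 2) := by
      gcongr
    have i2 : k * w ^ (k - 1) * z ^ 2 ≤ k * 1 * z ^ 2 := by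
      gcongr; exact pow_le_one₀ h0 h1
    push_cast
    nlinarith [sq_nonneg z, mul_nonneg (Nat.cast_nonneg (α := ℝ) k) (sq_nonneg z)]

lemma P_step (m : ℕ) (n : ℕ) (hn : 2 ≤ n) (w : ℝ) (h0 : 0 ≤ w) (h1 : w ≤ 1) :
    |P (m + 1) (w + 2 / n * (1 - w)) - ((1 - 2 * (m + 1) / n) * P (m + 1) w
      + 2 * (m + 1) / n * P m w)| ≤ (8 * (m + 1) ^ 3) / n ^ 2 := by
  have hn' : (2 : ℝ) ≤ n := by exact_mod_cast hn
  set z := 2 / (n : ℝ) * (1 - w) with hz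
  have hz0 : 0 ≤ z := mul_nonneg (by positivity) (by linarith)
  have hz2 : z ≤ 2 / n := by
    rw [hz]; apply mul_le_of_le_one_right (by positivity); linarith
  have hz1 : z ≤ 1 - w := by
    rw [hz]; apply mul_le_of_le_one_left (by linarith)
    rw [div_le_one (by linarith)]; exact hn'
  have t1 := pow_taylor m w z h0 h1 (by linarith) (by linarith)
  have t2 := pow_taylor (m + 1) w z h0 h1 (by linarith) (by linarith)
  have e : P (m + 1) (w + z) - ((1 - 2 * (m + 1) / n) * P (m + 1) w + 2 * (m + 1) / n * P m w)
      = (m + 1) * ((w + z) ^ m - w ^ m - m * w ^ (m - 1) * z)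
        - m * ((w + z) ^ (m + 1) - w ^ (m + 1) - ((m + 1 : ℕ) : ℝ) * w ^ (m + 1 - 1) * z) := by
    unfold P
    have hzz : 2 * ((m : ℝ) + 1) / n * (1 - w) = (m + 1) * z := by rw [hz]; ring
    rcases m with _ | m
    · simp
    · simp only [Nat.add_sub_cancel]
      push_cast at hzz ⊢
      linear_combination (-(m + 1 : ℝ) * (1 - w) * w ^ m) * hzz
  rw [e]
  refine (abs_sub _ _).trans ?_
  rw [abs_mul, abs_mul, abs_of_nonneg (by positivity : (0 : ℝ) ≤ (m : ℝ) + 1),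
    abs_of_nonneg (by positivity : (0 : ℝ) ≤ (m : ℝ))]
  have hzs : z ^ 2 ≤ 4 / n ^ 2 := by
    calc z ^ 2 ≤ (2 / (n : ℝ)) ^ 2 := by gcongr
      _ = _ := by ring
  push_cast at t2 ⊢
  calc _ ≤ ((m : ℝ) + 1) * ((m + 1) ^ 2 * z ^ 2) + (m + 1) * ((m + 1) ^ 2 * z ^ 2) := by
        gcongr
        · refine t1.trans ?_
          gcongr; linarith
        · linarith
    _ = 2 * (m + 1) ^ 3 * z ^ 2 := by ring
    _ ≤ 2 * (m + 1) ^ 3 * (4 / n ^ 2) := by gcongr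
    _ = _ := by ring

/-- Discrete time parameter. -/
def w (n t : ℕ) : ℝ := 1 - (1 - 2 / (n : ℝ)) ^ t

lemma w_mem (n t : ℕ) (hn : 4 ≤ n) : 0 ≤ w n t ∧ w n t ≤ 1 := by
  have hn' : (4 : ℝ) ≤ n := by exact_mod_cast hn
  have h1 : 2 / (n : ℝ) ≤ 1 := by rw [div_le_one (by linarith)]; linarith
  have h2 : 0 ≤ 2 / (n : ℝ) := by positivity
  unfold w
  constructor
  · have := pow_le_one₀ (n := t) (by linarith : 0 ≤ 1 - 2 / (n : ℝ)) (by linarith)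
    linarith
  · have := pow_nonneg (by linarith : 0 ≤ 1 - 2 / (n : ℝ)) t
    linarith

lemma w_succ (n t : ℕ) : w n (t + 1) = w n t + 2 / n * (1 - w n t) := by
  unfold w; ring

lemma compare (c : ℝ) (i : ℕ) : ∃ M : ℝ, 0 ≤ M ∧ ∀ n : ℕ, 4 ≤ n → 2 * i ≤ n →
    ∀ t : ℕ, (t : ℝ) ≤ c * n → |a n i t - P i (w n t)| ≤ M / n := by
  induction i with
  | zero =>
    refine ⟨0, le_rfl, fun n hn _ t _ => ?_⟩
    rw [a_const n t hn]; simp [P]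
  | succ m ih =>
    obtain ⟨M, hM, ih⟩ := ih
    obtain ⟨K, hK, hs⟩ := a_step c m
    set Q : ℝ := 2 * (m + 1) * M + K + 8 * (m + 1) ^ 3 with hQ
    have hQ0 : 0 ≤ Q := by positivity
    refine ⟨|c| * Q, by positivity, fun n hn hmn t ht => ?_⟩
    have hn' : (4 : ℝ) ≤ n := by exact_mod_cast hn
    have hmn' : 2 * ((m : ℝ) + 1) ≤ n := by exact_mod_cast hmn
    have claim : ∀ t : ℕ, (t : ℝ) ≤ c * n →
        |a n (m + 1) t - P (m + 1) (w n t)| ≤ t * (Q / n ^ 2) := by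
      intro t
      induction t with
      | zero =>
        intro _
        rw [a_zero n _ hn]
        rcases m with _ | m <;> simp [P, w]
      | succ t iht =>
        intro ht
        have ht' : (t : ℝ) ≤ c * n := by push_cast at ht; linarith
        have j1 := iht ht'
        have j2 := ih n hn (by omega) t ht'
        have j3 := hs n hn t ht'
        have j4 := P_step m n (by omega) (w n t) (w_mem n t hn).1 (w_mem n t hn).2
        rw [← w_succ] at j4
        have hc1 : 0 ≤ 2 * ((m : ℝ) + 1) / n := by positivity
        have hc2 : 0 ≤ 1 - 2 * ((m : ℝ) + 1) / n := by
          have : 2 * ((m : ℝ) + 1) / n ≤ 1 := by rw [div_le_one (by linarith)]; exact hmn'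
          linarith
        have e : a n (m + 1) (t + 1) - P (m + 1) (w n (t + 1))
          = ((a n (m + 1) (t + 1) - ((1 - 2 * (m + 1) / n) * a n (m + 1) t
              + 2 * (m + 1) / n * a n m t))
            - (P (m + 1) (w n (t + 1)) - ((1 - 2 * (m + 1) / n) * P (m + 1) (w n t)
              + 2 * (m + 1) / n * P m (w n t))))
            + ((1 - 2 * (m + 1) / n) * (a n (m + 1) t - P (m + 1) (w n t))
              + 2 * (m + 1) / n * (a n m t - P m (w n t))) := by ring
        rw [e]
        refine (abs_add_le _ _).trans ?_
        have k1 := (abs_sub _ _).trans (add_le_add j3 j4)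
        have k2 := abs_add_le ((1 - 2 * ((m : ℝ) + 1) / n) * (a n (m + 1) t - P (m + 1) (w n t)))
          (2 * ((m : ℝ) + 1) / n * (a n m t - P m (w n t)))
        rw [abs_mul, abs_mul, abs_of_nonneg hc1, abs_of_nonneg hc2] at k2
        have k3 : (1 - 2 * ((m : ℝ) + 1) / n) * |a n (m + 1) t - P (m + 1) (w n t)|
            ≤ t * (Q / n ^ 2) := by
          refine (mul_le_of_le_one_left (abs_nonneg _) (by linarith)).trans j1
        have k4 : 2 * ((m : ℝ) + 1) / n * |a n m t - P m (w n t)|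
            ≤ 2 * ((m : ℝ) + 1) / n * (M / n) := by gcongr
        refine (add_le_add k1 (k2.trans (add_le_add k3 k4))).trans_eq ?_
        rw [hQ]; push_cast; field_simp; ring
    refine (claim t ht).trans ?_
    have : (t : ℝ) ≤ |c| * n := ht.trans (by gcongr; exact le_abs_self c)
    calc (t : ℝ) * (Q / n ^ 2) ≤ (|c| * n) * (Q / n ^ 2) := by gcongr
      _ = _ := by field_simp

lemma w_tendsto (c : ℝ) (hc : 0 < c) :
    Tendsto (fun n : ℕ => w n ⌊c * (n : ℝ)⌋₊) atTop (nhds (1 - Real.exp (-2 * c))) := by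
  have h1 : Tendsto (fun n : ℕ => (⌊c * (n : ℝ)⌋₊ : ℝ) / n) atTop (nhds c) :=
    (tendsto_nat_floor_mul_div_atTop hc.le).comp tendsto_natCast_atTop_atTop
  have h2 : Tendsto (fun n : ℕ => (n : ℝ) * Real.log (1 + -2 / n)) atTop (nhds (-2)) :=
    (Real.tendsto_mul_log_one_add_div_atTop (-2)).comp tendsto_natCast_atTop_atTop
  have h3 := (Real.continuous_exp.tendsto _).comp (h2.mul h1)
  refine Tendsto.sub tendsto_const_nhds (h3.congr' ?_)
  filter_upwards [eventually_ge_atTop 4] with n hn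
  have hn' : (4 : ℝ) ≤ n := by exact_mod_cast hn
  have h4 : 2 / (n : ℝ) < 1 := by rw [div_lt_one (by linarith)]; linarith
  have e : (n : ℝ) * Real.log (1 + -2 / n) * ((⌊c * (n : ℝ)⌋₊ : ℝ) / n)
      = (⌊c * (n : ℝ)⌋₊ : ℝ) * Real.log (1 - 2 / n) := by
    rw [neg_div, ← sub_eq_add_neg]; field_simp
  simp only [Function.comp]
  rw [e, Real.exp_nat_mul, Real.exp_log (by linarith)]

lemma a_tendsto (c : ℝ) (hc : 0 < c) (i : ℕ) :
    Tendsto (fun n : ℕ => a n i ⌊c * (n : ℝ)⌋₊) atTop (nhds (P i (1 - Real.exp (-2 * c)))) := by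
  obtain ⟨M, _, h⟩ := compare c i
  have hP : Continuous (P i) := by unfold P; fun_prop
  have h1 := (hP.tendsto _).comp (w_tendsto c hc)
  have h2 : Tendsto (fun n : ℕ => a n i ⌊c * (n : ℝ)⌋₊ - P i (w n ⌊c * (n : ℝ)⌋₊)) atTop
      (nhds 0) := by
    refine squeeze_zero_norm' ?_ (tendsto_const_div_atTop_nhds_zero_nat M)
    filter_upwards [eventually_ge_atTop 4, eventually_ge_atTop (2 * i)] with n hn hi
    exact h n hn hi _ (Nat.floor_le (by positivity))
  simpa using h2.add h1

end

end FixMoment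

/-- After a random `(n-1)`-cycle and `⌊cn⌋` random transpositions, the `r`-th moment of
the number of fixed points converges to
`Σ_{i=1}^r S(r,i) (1 + i e^{-2c}/(1-e^{-2c})) (1-e^{-2c})^i`. -/
theorem fixCount_moment_tendsto (c : ℝ) (hc : 0 < c) (r : ℕ) (hr : 1 ≤ r) :
    Filter.Tendsto
      (fun n : ℕ => ∑ σ : Equiv.Perm (Fin n),
        ((fixCount σ : ℝ)) ^ r * walk n 1 ⌊c * (n : ℝ)⌋₊ σ)
      Filter.atTop
      (nhds (∑ i ∈ Finset.Icc 1 r, (stirling2 r i : ℝ) *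
        (1 + (i : ℝ) * Real.exp (-2 * c) / (1 - Real.exp (-2 * c))) *
        (1 - Real.exp (-2 * c)) ^ i)) := by
  have hx : 0 < 1 - Real.exp (-2 * c) := by
    have : Real.exp (-2 * c) < 1 := Real.exp_lt_one_iff.mpr (by linarith)
    linarith
  have h1 : Filter.Tendsto (fun n : ℕ => ∑ i ∈ Finset.Icc 1 r,
      (stirling2 r i : ℝ) * FixMoment.a n i ⌊c * (n : ℝ)⌋₊) Filter.atTop
      (nhds (∑ i ∈ Finset.Icc 1 r,
        (stirling2 r i : ℝ) * FixMoment.P i (1 - Real.exp (-2 * c)))) :=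
    tendsto_finsetSum _ fun i _ => (FixMoment.a_tendsto c hc i).const_mul _
  refine (h1.congr fun n => ?_).trans_eq ?_
  · unfold FixMoment.a FixMoment.Ex
    simp_rw [Finset.mul_sum]
    rw [Finset.sum_comm]
    refine Finset.sum_congr rfl fun σ _ => ?_
    rw [FixMoment.pow_eq_sum, Finset.sum_mul]
    obtain ⟨r, rfl⟩ : ∃ j, r = j + 1 := ⟨r - 1, by omega⟩
    rw [Finset.range_eq_Ico, Finset.sum_eq_sum_Ico_succ_bot (by omega)]
    simp only [stirling2, Nat.cast_zero, zero_mul, zero_add]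
    refine Finset.sum_congr (by ext; simp) fun i _ => ?_
    ring
  · congr 1
    refine Finset.sum_congr rfl fun i hi => ?_
    obtain ⟨i, rfl⟩ : ∃ j, i = j + 1 := ⟨i - 1, by simp at hi; omega⟩
    unfold FixMoment.P
    simp only [Nat.add_sub_cancel]
    have hx' := hx.ne'
    generalize Real.exp (-2 * c) = x at hx'
    field_simp
    ring
end
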